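/- Let Γ be a free, properly discontinuous group of automorphisms of the unit ball B ⊂ ℂⁿ such that ∑_{γ∈Γ} (1 − |γ(a)|) < ∞ for some point a ∈ B. Then the Bergman metric exists on the quotient manifold B/Γ. -/

import Mathlib

open Set Metric Filter MeasureTheory Topology

noncomputable section

variable {E : Type*} [NormedAddCommGroup E] [NormedSpace ℂ E]

/-- `f` is an automorphism (biholomorphic self-map) of the domain `Ω`. -/
def IsAutOn (Ω : Set E) (f : E → E) : Prop :=
  DifferentiableOn ℂ f Ω ∧ MapsTo f Ω Ω ∧
    ∃ g : E → E, DifferentiableOn ℂ g Ω ∧ MapsTo g Ω Ω ∧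
      EqOn (g ∘ f) id Ω ∧ EqOn (f ∘ g) id Ω

/-- `Γ` is a group of automorphisms of the domain `Ω`. -/
structure IsAutGroupOn (Ω : Set E) (Γ : Set (E → E)) : Prop where
  aut : ∀ γ ∈ Γ, IsAutOn Ω γ
  id_mem : id ∈ Γ
  comp_mem : ∀ γ ∈ Γ, ∀ σ ∈ Γ, γ ∘ σ ∈ Γ
  inv_mem : ∀ γ ∈ Γ, ∃ σ ∈ Γ, EqOn (σ ∘ γ) id Ω ∧ EqOn (γ ∘ σ) id Ω

/-- `Γ` acts properly discontinuously on `Ω`: for any pair of compact subsets of `Ω`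
only finitely many elements of `Γ` move the first one into the second one. -/
def ProperlyDiscontinuousOn (Ω : Set E) (Γ : Set (E → E)) : Prop :=
  ∀ K₁ K₂ : Set E, K₁ ⊆ Ω → K₂ ⊆ Ω → IsCompact K₁ → IsCompact K₂ →
    {γ ∈ Γ | (γ '' K₁ ∩ K₂).Nonempty}.Finite

/-- The action of `Γ` on `Ω` is free: an element with a fixed point acts as the identity. -/
def FreeActionOn (Ω : Set E) (Γ : Set (E → E)) : Prop :=
  ∀ γ ∈ Γ, (∃ z ∈ Ω, γ z = z) → EqOn γ id Ω

/-- Plurisubharmonicity of an `EReal`-valued function `u` on `Ω`: `u` is upper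
semicontinuous and, on every closed disc inside `Ω` on every complex line, `u` is dominated
by any harmonic function (real part of a holomorphic function) dominating it on the
boundary circle. -/
def IsPSHOn (u : E → EReal) (Ω : Set E) : Prop :=
  UpperSemicontinuousOn u Ω ∧
  ∀ z v : E, ∀ r : ℝ, 0 < r → (∀ w : ℂ, ‖w‖ ≤ r → z + w • v ∈ Ω) →
    ∀ f : ℂ → ℂ, Differentiable ℂ f →
      (∀ w : ℂ, ‖w‖ = r → u (z + w • v) ≤ ((f w).re : EReal)) →
      ∀ w : ℂ, ‖w‖ ≤ r → u (z + w • v) ≤ ((f w).re : EReal)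

/-- Plurisubharmonicity for a real-valued function. -/
def IsPSHOnR (u : E → ℝ) (Ω : Set E) : Prop :=
  IsPSHOn (fun z => (u z : EReal)) Ω

/-- The Laplacian at `0` of `w ↦ u (z + w • v)`, `w ∈ ℂ`; up to the factor `1/4` this is
the Levi form of `u` at `z` evaluated at the direction `v`. -/
def lineLaplacian (u : E → ℝ) (z v : E) : ℝ :=
  deriv (deriv fun t : ℝ => u (z + (t : ℂ) • v)) 0 +
  deriv (deriv fun t : ℝ => u (z + ((t : ℂ) * Complex.I) • v)) 0

/-- Strict plurisubharmonicity (for a `C²` function): the Levi form is positive definite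
at every point of `Ω`. -/
def IsStrictPSHOn (u : E → ℝ) (Ω : Set E) : Prop :=
  ∀ z ∈ Ω, ∀ v : E, v ≠ 0 → 0 < lineLaplacian u z v

/-- The quotient manifold `Ω/Γ` is Stein: `Γ`-invariant holomorphic functions (that is,
holomorphic functions of the quotient) separate the points of the quotient, and the
quotient is holomorphically convex: the holomorphically convex hull (in the quotient) of
any compact set is compact, i.e. is contained in the `Γ`-saturation of a compact subset
of `Ω`. -/
def QuotientIsStein (Ω : Set E) (Γ : Set (E → E)) : Prop :=
  (∀ z ∈ Ω, ∀ w ∈ Ω, (∀ γ ∈ Γ, γ z ≠ w) →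
      ∃ f : E → ℂ, DifferentiableOn ℂ f Ω ∧ (∀ γ ∈ Γ, ∀ x ∈ Ω, f (γ x) = f x) ∧
        f z ≠ f w) ∧
  (∀ K : Set E, K ⊆ Ω → IsCompact K → ∃ L : Set E, L ⊆ Ω ∧ IsCompact L ∧
      {z ∈ Ω | ∀ f : E → ℂ, DifferentiableOn ℂ f Ω →
          (∀ γ ∈ Γ, ∀ x ∈ Ω, f (γ x) = f x) →
          ‖f z‖ ≤ sSup ((fun x => ‖f x‖) '' K)} ⊆ ⋃ γ ∈ Γ, γ '' L)

/-- The quotient manifold `Ω/Γ` possesses a negative `C^∞` strictly plurisubharmonic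
function, i.e. there is a `Γ`-invariant negative `C^∞` strictly plurisubharmonic function
on `Ω`. -/
def QuotientHasNegSPSH (Ω : Set E) (Γ : Set (E → E)) : Prop :=
  ∃ u : E → ℝ, (∀ γ ∈ Γ, ∀ z ∈ Ω, u (γ z) = u z) ∧ (∀ z ∈ Ω, u z < 0) ∧
    ContDiffOn ℝ (⊤ : ℕ∞) u Ω ∧ IsStrictPSHOn u Ω

/-- The pluricomplex Green function of `Ω` with pole `w`. -/
def pcGreen (Ω : Set E) (z w : E) : EReal :=
  sSup {t : EReal | ∃ u : E → EReal, IsPSHOn u Ω ∧ (∀ x ∈ Ω, u x < 0) ∧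
    (∃ C : ℝ, ∀ᶠ x in 𝓝[Ω \ {w}] w, u x ≤ ((Real.log ‖x - w‖ + C : ℝ) : EReal)) ∧
    t = u z}

/-- The pluricomplex Green function of `Ω` with pole `w` exists: it has a logarithmic
pole at `w` and is bounded away from `-∞` outside a neighborhood of `w`. -/
def GreenExistsAt (Ω : Set E) (w : E) : Prop :=
  (∃ C : ℝ, ∀ᶠ z in 𝓝[Ω \ {w}] w,
      ((Real.log ‖z - w‖ - C : ℝ) : EReal) ≤ pcGreen Ω z w ∧
        pcGreen Ω z w ≤ ((Real.log ‖z - w‖ + C : ℝ) : EReal)) ∧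
  ∃ r : ℝ, 0 < r ∧ ∃ C : ℝ, ∀ z ∈ Ω, z ∉ ball w r → ((-C : ℝ) : EReal) ≤ pcGreen Ω z w

/-- `Ω` is pluricomplex hyperbolic. -/
def PlcpxHyperbolic (Ω : Set E) : Prop :=
  ∀ w ∈ Ω, GreenExistsAt Ω w

/-- `Ω` is a Stein domain: it is open, holomorphically convex, and holomorphic functions
separate its points. -/
def IsSteinDomain (Ω : Set E) : Prop :=
  IsOpen Ω ∧
  (∀ K : Set E, K ⊆ Ω → IsCompact K →
      IsCompact {z ∈ Ω | ∀ f : E → ℂ, DifferentiableOn ℂ f Ω →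
        ‖f z‖ ≤ sSup ((fun x => ‖f x‖) '' K)}) ∧
  ∀ z ∈ Ω, ∀ w ∈ Ω, z ≠ w → ∃ f : E → ℂ, DifferentiableOn ℂ f Ω ∧ f z ≠ f w

/-- The pluricomplex Green function of the quotient `Ω/Γ` with pole `π w`, pulled back to
`Ω`: the supremum of all `Γ`-invariant negative plurisubharmonic functions on `Ω` with a
logarithmic pole at `w`. -/
def quotGreen (Ω : Set E) (Γ : Set (E → E)) (z w : E) : EReal :=
  sSup {t : EReal | ∃ u : E → EReal, IsPSHOn u Ω ∧ (∀ x ∈ Ω, u x < 0) ∧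
    (∀ γ ∈ Γ, ∀ x ∈ Ω, u (γ x) = u x) ∧
    (∃ C : ℝ, ∀ᶠ x in 𝓝[Ω \ {w}] w, u x ≤ ((Real.log ‖x - w‖ + C : ℝ) : EReal)) ∧
    t = u z}

/-- The pluricomplex Green function of the quotient `Ω/Γ` with pole `π w` exists. -/
def QuotientGreenExistsAt (Ω : Set E) (Γ : Set (E → E)) (w : E) : Prop :=
  (∃ C : ℝ, ∀ᶠ z in 𝓝[Ω \ {w}] w,
      ((Real.log ‖z - w‖ - C : ℝ) : EReal) ≤ quotGreen Ω Γ z w ∧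
        quotGreen Ω Γ z w ≤ ((Real.log ‖z - w‖ + C : ℝ) : EReal)) ∧
  ∃ r : ℝ, 0 < r ∧ ∃ C : ℝ, ∀ z ∈ Ω, (∀ γ ∈ Γ, γ z ∉ ball w r) →
    ((-C : ℝ) : EReal) ≤ quotGreen Ω Γ z w

/-- The quotient `Ω/Γ` is pluricomplex hyperbolic. -/
def QuotientPlcpxHyperbolic (Ω : Set E) (Γ : Set (E → E)) : Prop :=
  ∀ w ∈ Ω, QuotientGreenExistsAt Ω Γ w

/-- `D` is a fundamental domain for the action of `Γ` on `Ω`. -/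
def IsFundamentalDomainOn (Ω : Set E) (Γ : Set (E → E)) (D : Set E) : Prop :=
  D ⊆ Ω ∧ (∀ z ∈ Ω, ∃ γ ∈ Γ, γ z ∈ D) ∧
    ∀ z ∈ D, ∀ w ∈ D, (∃ γ ∈ Γ, γ z = w) → z = w

/-- The orbit of the point `a` under `Γ`. -/
def orbitOf (Γ : Set (E → E)) (a : E) : Set E := (fun γ : E → E => γ a) '' Γ

/-- The set of cluster (accumulation) points of the orbit of `a` under `Γ`. -/
def clusterPtsOfOrbit (Γ : Set (E → E)) (a : E) : Set E :=
  {b : E | AccPt b (𝓟 (orbitOf Γ a))}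

/-- The limit set of `Γ` acting on the bounded domain `Ω`. -/
def limitSet (Ω : Set E) (Γ : Set (E → E)) : Set E :=
  {w ∈ frontier Ω | ∃ K : Set E, K ⊆ Ω ∧ IsCompact K ∧
    ∃ z : ℕ → E, (∀ k, z k ∈ Ω) ∧ Tendsto z atTop (𝓝 w) ∧
      ∃ γ : ℕ → E → E, (∀ k, γ k ∈ Γ) ∧ ∀ k, γ k (z k) ∈ K}

/-- `ψ` is a barrier at the boundary point `p` of `Ω`. -/
def IsBarrierAt (Ω : Set E) (p : E) (ψ : E → ℝ) : Prop :=
  ContinuousOn ψ (closure Ω) ∧ IsPSHOnR ψ Ω ∧ ψ p = 0 ∧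
    ∀ z ∈ closure Ω, z ≠ p → ψ z < 0

/-- `Ω` is B-regular: there is a barrier at every boundary point. -/
def BRegular (Ω : Set E) : Prop :=
  ∀ p ∈ frontier Ω, ∃ ψ : E → ℝ, IsBarrierAt Ω p ψ

/-- Integer iterates of a map `f` with (two-sided) inverse `g`. -/
def zIter (f g : E → E) : ℤ → E → E
  | Int.ofNat k => f^[k]
  | Int.negSucc k => g^[k + 1]

/-- `Γ` is an (algebraically) cyclic group of automorphisms of `Ω`: it consists of the
integer powers of a single automorphism. -/
def IsCyclicAutGroupOn (Ω : Set E) (Γ : Set (E → E)) : Prop :=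
  ∃ γ ∈ Γ, ∃ γ' ∈ Γ, EqOn (γ' ∘ γ) id Ω ∧ EqOn (γ ∘ γ') id Ω ∧
    (∀ k : ℤ, zIter γ γ' k ∈ Γ) ∧ ∀ σ ∈ Γ, ∃ k : ℤ, EqOn σ (zIter γ γ' k) Ω

/-- The complex Jacobian determinant of `γ` at `z`. -/
def jacDet (γ : E → E) (z : E) : ℂ :=
  LinearMap.det ((fderiv ℂ γ z : E →L[ℂ] E) : E →ₗ[ℂ] E)

instance (n : ℕ) : MeasurableSpace (EuclideanSpace ℂ (Fin n)) := borel _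
instance (n : ℕ) : BorelSpace (EuclideanSpace ℂ (Fin n)) := ⟨rfl⟩
/-- Lebesgue (Haar) measure on `ℂⁿ`. -/
instance (n : ℕ) : MeasureSpace (EuclideanSpace ℂ (Fin n)) := ⟨Measure.addHaar⟩

/-- The Bergman kernel of the quotient `Ω/Γ` (on the diagonal), pulled back to `Ω`:
the supremum of `‖f z‖²` over all holomorphic `f` on `Ω` transforming like automorphic
forms of weight one (i.e. `L²` holomorphic `n`-forms on the quotient) with `L²`-norm at
most one over a fundamental domain `D`. -/
def quotBergmanKernel {n : ℕ} (Ω : Set (EuclideanSpace ℂ (Fin n)))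
    (Γ : Set (EuclideanSpace ℂ (Fin n) → EuclideanSpace ℂ (Fin n)))
    (D : Set (EuclideanSpace ℂ (Fin n))) (z : EuclideanSpace ℂ (Fin n)) : ℝ :=
  sSup {t : ℝ | ∃ f : EuclideanSpace ℂ (Fin n) → ℂ, DifferentiableOn ℂ f Ω ∧
    (∀ γ ∈ Γ, ∀ x ∈ Ω, f (γ x) * jacDet γ x = f x) ∧
    IntegrableOn (fun x => ‖f x‖ ^ 2) D ∧ (∫ x in D, ‖f x‖ ^ 2) ≤ 1 ∧ t = ‖f z‖ ^ 2}

/-- The Bergman metric exists on the quotient `Ω/Γ`: the Bergman kernel of the quotient is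
positive and the Levi form of its logarithm is positive definite everywhere. -/
def QuotientBergmanMetricExists {n : ℕ} (Ω : Set (EuclideanSpace ℂ (Fin n)))
    (Γ : Set (EuclideanSpace ℂ (Fin n) → EuclideanSpace ℂ (Fin n))) : Prop :=
  ∃ D : Set (EuclideanSpace ℂ (Fin n)), IsFundamentalDomainOn Ω Γ D ∧ MeasurableSet D ∧
    ∀ z ∈ Ω, 0 < quotBergmanKernel Ω Γ D z ∧
      ∀ v : EuclideanSpace ℂ (Fin n), v ≠ 0 →
        0 < lineLaplacian (fun x => Real.log (quotBergmanKernel Ω Γ D x)) z v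

section SeveralVariables

variable {V W : Type*} [NormedAddCommGroup V] [NormedSpace ℂ V]
  [NormedAddCommGroup W] [NormedSpace ℂ W]

/-- Cauchy estimate for the derivative of a bounded holomorphic map. -/
theorem norm_fderiv_le_of_norm_le {f : V → W} {x : V} {r M : ℝ} (hr : 0 < r)
    (hf : DifferentiableOn ℂ f (ball x r)) (hM : ∀ y ∈ ball x r, ‖f y‖ ≤ M) :
    ‖fderiv ℂ f x‖ ≤ 2 * M / r := by
  refine Complex.norm_fderiv_le_div_of_mapsTo_ball hf (fun y hy => ?_) hr
  rw [mem_closedBall, dist_eq_norm]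
  calc ‖f y - f x‖ ≤ ‖f y‖ + ‖f x‖ := norm_sub_le _ _
    _ ≤ M + M := add_le_add (hM y hy) (hM x (mem_ball_self hr))
    _ = 2 * M := by ring

/-- Quadratic Taylor estimate for a bounded holomorphic map. -/
theorem norm_sub_sub_fderiv_le {f : V → W} {x z : V} {r M : ℝ} (hr : 0 < r)
    (hf : DifferentiableOn ℂ f (ball x r)) (hM : ∀ y ∈ ball x r, ‖f y‖ ≤ M)
    (hz : z ∈ ball x r) :
    ‖f z - f x - fderiv ℂ f x (z - x)‖ ≤ 4 * M * (‖z - x‖ / r) ^ 2 := by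
  set g : V → W := fun y => f y - fderiv ℂ f x (y - x) with hg
  have hgx : g x = f x := by simp [hg]
  have hM0 : 0 ≤ M := (norm_nonneg _).trans (hM x (mem_ball_self hr))
  have hd : DifferentiableOn ℂ g (ball x r) := by
    refine hf.sub (Differentiable.differentiableOn ?_)
    fun_prop
  have hmaps : MapsTo g (ball x r) (closedBall (g x) (4 * M)) := by
    intro y hy
    rw [mem_closedBall, dist_eq_norm, hgx]
    have h1 := norm_fderiv_le_of_norm_le hr hf hM
    have h2 : ‖fderiv ℂ f x (y - x)‖ ≤ 2 * M := by
      calc ‖fderiv ℂ f x (y - x)‖ ≤ ‖fderiv ℂ f x‖ * ‖y - x‖ := ContinuousLinearMap.le_opNorm _ _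
        _ ≤ (2 * M / r) * r := by
            gcongr
            exact (mem_ball_iff_norm.1 hy).le
        _ = 2 * M := by field_simp
    calc ‖g y - f x‖ = ‖f y - fderiv ℂ f x (y - x) - f x‖ := rfl
      _ ≤ ‖f y‖ + ‖fderiv ℂ f x (y - x)‖ + ‖f x‖ :=
          (norm_sub_le _ _).trans (add_le_add_left (norm_sub_le _ _) _)
      _ ≤ M + 2 * M + M := add_le_add (add_le_add (hM y hy) h2) (hM x (mem_ball_self hr))
      _ = 4 * M := by ring
  have hn : (g · - g x) =o[𝓝 x] (fun w ↦ ‖w - x‖ ^ 1) := by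
    have := ((hf x (mem_ball_self hr)).differentiableAt
      (ball_mem_nhds x hr)).hasFDerivAt.isLittleO
    simp only [pow_one]
    refine (this.norm_right).congr_left fun y => ?_
    rw [hgx]
    exact sub_right_comm _ _ _
  have := Complex.dist_le_mul_div_pow_of_mapsTo_ball_of_isLittleO hd hmaps hn hz
  rw [dist_eq_norm, dist_eq_norm, hgx] at this
  rwa [sub_right_comm]

/-- Locally uniform limits of holomorphic maps are holomorphic. -/
theorem differentiableAt_of_tendstoUniformlyOn_ball [CompleteSpace W] {f : ℕ → V → W} {g : V → W}
    {x : V} {r : ℝ} (hr : 0 < r) (hf : ∀ᶠ k in atTop, DifferentiableOn ℂ (f k) (ball x r))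
    (hfg : TendstoUniformlyOn f g atTop (ball x r)) : DifferentiableAt ℂ g x := by
  have hr2 : 0 < r / 2 := by positivity
  have hsub : ∀ y ∈ ball x (r / 2), ball y (r / 2) ⊆ ball x r := fun y hy =>
    ball_subset_ball' (by rw [mem_ball] at hy; linarith)
  have hC : UniformCauchySeqOn (fun k => fderiv ℂ (f k)) atTop (ball x (r / 2)) := by
    rw [Metric.uniformCauchySeqOn_iff]
    intro ε hε
    obtain ⟨N, hN⟩ := (Metric.uniformCauchySeqOn_iff.1 hfg.uniformCauchySeqOn)
      (ε * r / 8) (by positivity)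
    obtain ⟨N', hN'⟩ := eventually_atTop.1 hf
    refine ⟨max N N', fun m hm n hn y hy => ?_⟩
    have hym : y ∈ ball x r := hsub y hy (mem_ball_self hr2)
    have dm := hN' m (le_of_max_le_right hm)
    have dn := hN' n (le_of_max_le_right hn)
    have h := norm_fderiv_le_of_norm_le (f := fun y => f m y - f n y) (x := y) (M := ε * r / 8)
      hr2 ((dm.mono (hsub y hy)).sub (dn.mono (hsub y hy)))
      (fun w hw => by
        rw [← dist_eq_norm]
        exact (hN m (le_of_max_le_left hm) n (le_of_max_le_left hn) w (hsub y hy hw)).le)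
    rw [fderiv_fun_sub ((dm y hym).differentiableAt (isOpen_ball.mem_nhds hym))
      ((dn y hym).differentiableAt (isOpen_ball.mem_nhds hym))] at h
    rw [dist_eq_norm]
    refine h.trans_lt ?_
    have : 2 * (ε * r / 8) / (r / 2) = ε / 2 := by field_simp; ring
    rw [this]; linarith
  have hlim : ∀ y ∈ ball x (r / 2), ∃ l, Tendsto (fun k => fderiv ℂ (f k) y) atTop (𝓝 l) :=
    fun y hy => cauchySeq_tendsto_of_complete (hC.cauchySeq hy)
  choose! g' hg' using hlim
  have hU := hC.tendstoUniformlyOn_of_tendsto hg'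
  obtain ⟨N', hN'⟩ := eventually_atTop.1 hf
  have hx2 : x ∈ ball x (r / 2) := mem_ball_self hr2
  refine (hasFDerivAt_of_tendstoUniformlyOnFilter (l := atTop) (f := f)
    (f' := fun k => fderiv ℂ (f k)) (g := g) (g' := g') (x := x) ?_ ?_ ?_).differentiableAt
  · have := (tendstoUniformlyOn_iff_tendstoUniformlyOnFilter.1 hU)
    exact this.mono_right (le_principal_iff.2 (ball_mem_nhds x hr2))
  · have h3 : Ici N' ×ˢ ball x r ∈ (atTop : Filter ℕ) ×ˢ 𝓝 x :=
      prod_mem_prod (Ici_mem_atTop N') (ball_mem_nhds x hr)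
    filter_upwards [h3] with p hp
    exact (((hN' p.1 hp.1) p.2 hp.2).differentiableAt (isOpen_ball.mem_nhds hp.2)).hasFDerivAt
  · filter_upwards [ball_mem_nhds x hr] with y hy
    exact hfg.tendsto_at hy

/-- The directional derivatives of a holomorphic map are holomorphic. -/
theorem differentiableOn_fderiv_apply [CompleteSpace W] {f : V → W} {Ω : Set V} (hΩ : IsOpen Ω)
    (hf : DifferentiableOn ℂ f Ω) (v : V) :
    DifferentiableOn ℂ (fun x => fderiv ℂ f x v) Ω := by
  intro x hx
  refine DifferentiableAt.differentiableWithinAt ?_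
  have hcont : ContinuousAt f x := (hf.continuousOn.continuousAt (hΩ.mem_nhds hx))
  obtain ⟨r, hr, hrΩ⟩ : ∃ r > 0, ball x r ⊆ Ω ∩ {y | ‖f y‖ < ‖f x‖ + 1} :=
    Metric.mem_nhds_iff.1 (inter_mem (hΩ.mem_nhds hx)
      (hcont.norm.eventually_lt continuousAt_const (by simp)))
  have hr2 : 0 < r / 2 := by positivity
  set M := ‖f x‖ + 1
  have hM0 : 0 < M := by positivity
  have hsub : ∀ y ∈ ball x (r / 2), ball y (r / 2) ⊆ ball x r := fun y hy =>
    ball_subset_ball' (by rw [mem_ball] at hy; linarith)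
  have hbig : ∀ᶠ k : ℕ in atTop, ‖v‖ < (r / 2) * (k : ℝ) ∧ 0 < (k : ℝ) := by
    have h1 : Tendsto (fun k : ℕ => (r / 2) * (k : ℝ)) atTop atTop :=
      tendsto_natCast_atTop_atTop.const_mul_atTop hr2
    filter_upwards [h1.eventually_gt_atTop ‖v‖, eventually_gt_atTop 0] with k hk hk0
    exact ⟨hk, by exact_mod_cast hk0⟩
  refine differentiableAt_of_tendstoUniformlyOn_ball (r := r / 2) hr2
    (f := fun (k : ℕ) y => (k : ℂ) • (f (y + (k : ℂ)⁻¹ • v) - f y)) ?_ ?_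
  · filter_upwards [hbig] with k ⟨hk, hk0⟩ y hy
    have hyv : y + (k : ℂ)⁻¹ • v ∈ ball x r := by
      refine hsub y hy ?_
      rw [mem_ball, dist_eq_norm, add_sub_cancel_left, norm_smul, norm_inv, Complex.norm_natCast,
        inv_mul_lt_iff₀ hk0]
      linarith
    have hyx : y ∈ ball x r := hsub y hy (mem_ball_self hr2)
    have d1 : DifferentiableAt ℂ f (y + (k : ℂ)⁻¹ • v) :=
      hf.differentiableAt (hΩ.mem_nhds (hrΩ hyv).1)
    have d2 : DifferentiableAt ℂ f y := hf.differentiableAt (hΩ.mem_nhds (hrΩ hyx).1)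
    have d3 : DifferentiableAt ℂ (fun y => f (y + (k : ℂ)⁻¹ • v)) y :=
      DifferentiableAt.comp y (f := fun y => y + (k : ℂ)⁻¹ • v) d1 (by fun_prop)
    exact ((d3.sub d2).const_smul (k : ℂ)).differentiableWithinAt
  · rw [Metric.tendstoUniformlyOn_iff]
    intro ε hε
    have hlim : Tendsto (fun k : ℕ => (4 * M * (‖v‖ / (r / 2)) ^ 2) / (k : ℝ)) atTop (𝓝 0) :=
      tendsto_const_div_atTop_nhds_zero_nat _
    filter_upwards [hbig, hlim.eventually_lt_const hε] with k ⟨hk, hk0⟩ hkε y hy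
    have hyv : y + (k : ℂ)⁻¹ • v ∈ ball y (r / 2) := by
      rw [mem_ball, dist_eq_norm, add_sub_cancel_left, norm_smul, norm_inv, Complex.norm_natCast,
        inv_mul_lt_iff₀ hk0]
      linarith
    have h := norm_sub_sub_fderiv_le (f := f) (M := M) hr2
      (hf.mono fun w hw => (hrΩ (hsub y hy hw)).1)
      (fun w hw => (hrΩ (hsub y hy hw)).2.le) hyv
    rw [add_sub_cancel_left] at h
    have hkC : (k : ℂ) ≠ 0 := by
      intro h0; simp only [Nat.cast_eq_zero] at h0; simp [h0] at hk0
    have e : fderiv ℂ f y v - (k : ℂ) • (f (y + (k : ℂ)⁻¹ • v) - f y)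
        = -((k : ℂ) • (f (y + (k : ℂ)⁻¹ • v) - f y - fderiv ℂ f y ((k : ℂ)⁻¹ • v))) := by
      rw [map_smul, smul_sub (k : ℂ) (_ - _), smul_smul, mul_inv_cancel₀ hkC, one_smul]
      exact (neg_sub _ _).symm
    rw [dist_eq_norm, e, norm_neg, norm_smul, Complex.norm_natCast]
    refine (mul_le_mul_of_nonneg_left h hk0.le).trans_lt ?_
    refine lt_of_eq_of_lt ?_ hkε
    rw [norm_smul, norm_inv, Complex.norm_natCast]
    field_simp

/-- Finite products of holomorphic functions are holomorphic. -/
theorem differentiableOn_prod {ι : Type*} {s : Finset ι} {f : ι → V → ℂ} {Ω : Set V}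
    (hf : ∀ i ∈ s, DifferentiableOn ℂ (f i) Ω) :
    DifferentiableOn ℂ (fun x => ∏ i ∈ s, f i x) Ω := by
  classical
  intro x hx
  exact (HasFDerivWithinAt.finsetProd
    fun i hi => (hf i hi x hx).hasFDerivWithinAt).differentiableWithinAt

/-- Jacobian determinants of holomorphic self-maps are holomorphic. -/
theorem differentiableOn_jacDet [FiniteDimensional ℂ V] {f : V → V} {Ω : Set V} (hΩ : IsOpen Ω)
    (hf : DifferentiableOn ℂ f Ω) : DifferentiableOn ℂ (jacDet f) Ω := by
  have : CompleteSpace V := FiniteDimensional.complete ℂ V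
  set b := Module.finBasis ℂ V
  have h : jacDet f = fun x => Matrix.det (LinearMap.toMatrix b b
      ((fderiv ℂ f x : V →L[ℂ] V) : V →ₗ[ℂ] V)) := by
    funext x
    rw [jacDet, LinearMap.det_toMatrix]
  rw [h]
  simp only [Matrix.det_apply, LinearMap.toMatrix_apply]
  refine DifferentiableOn.fun_sum fun σ _ => DifferentiableOn.const_smul ?_ _
  have hentry : ∀ i, DifferentiableOn ℂ (fun x => b.repr (fderiv ℂ f x (b i)) (σ i)) Ω := by
    intro i
    have hl : Differentiable ℂ (fun w : V => b.repr w (σ i)) :=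
      (LinearMap.toContinuousLinearMap (b.coord (σ i))).differentiable
    exact hl.comp_differentiableOn (differentiableOn_fderiv_apply hΩ hf (b i))
  exact differentiableOn_prod fun i _ => hentry i

/-- A series of holomorphic maps with locally summable bounds may be differentiated termwise. -/
theorem hasFDerivAt_tsum_of_summable_bound [CompleteSpace W] {ι : Type*} {f : ι → V → W} {x : V}
    {r : ℝ} {u : ι → ℝ} (hr : 0 < r) (hf : ∀ i, DifferentiableOn ℂ (f i) (ball x r))
    (hu : Summable u) (hfu : ∀ i, ∀ y ∈ ball x r, ‖f i y‖ ≤ u i) :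
    HasFDerivAt (fun y => ∑' i, f i y) (∑' i, fderiv ℂ (f i) x) x := by
  have hr2 : 0 < r / 2 := by positivity
  have hsub : ∀ y ∈ ball x (r / 2), ball y (r / 2) ⊆ ball x r := fun y hy =>
    ball_subset_ball' (by rw [mem_ball] at hy; linarith)
  have hx : x ∈ ball x (r / 2) := mem_ball_self hr2
  let : NormedSpace ℝ V := NormedSpace.restrictScalars ℝ ℂ V
  refine hasFDerivAt_tsum_of_isPreconnected (u := fun i => 2 * u i / (r / 2)) ?_ isOpen_ball
    (convex_ball x (r / 2)).isPreconnected (fun i y hy => ?_) (fun i y hy => ?_) hx ?_ hx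
  · exact (hu.mul_left 2).div_const _
  · have hyr := hsub y hy (mem_ball_self hr2)
    exact ((hf i).differentiableAt (isOpen_ball.mem_nhds hyr)).hasFDerivAt
  · exact norm_fderiv_le_of_norm_le hr2 ((hf i).mono (hsub y hy))
      fun w hw => hfu i w (hsub y hy hw)
  · exact Summable.of_norm_bounded hu fun i => hfu i x (mem_ball_self hr)

end SeveralVariables

section RealDeterminant

variable {V : Type*} [NormedAddCommGroup V] [NormedSpace ℂ V]

/-- The real determinant of a complex-linear map is the squared modulus of its determinant. -/
theorem abs_det_restrictScalars (L : V →ₗ[ℂ] V) :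
    |LinearMap.det (L.restrictScalars ℝ)| = ‖LinearMap.det L‖ ^ 2 := by
  rw [LinearMap.det_restrictScalars, Algebra.norm_complex_apply, Complex.normSq_eq_norm_sq,
    abs_of_nonneg (by positivity)]

/-- Complex-linear isometries have unimodular determinant. -/
theorem norm_det_of_isometry [FiniteDimensional ℂ V] (L : V →ₗ[ℂ] V) (hL : ∀ x, ‖L x‖ = ‖x‖) :
    ‖LinearMap.det L‖ = 1 := by
  let : MeasurableSpace V := borel V
  have : BorelSpace V := ⟨rfl⟩
  have hinj : Function.Injective L := by
    rw [← LinearMap.ker_eq_bot, LinearMap.ker_eq_bot']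
    intro x hx
    rw [← norm_eq_zero, ← hL, hx, norm_zero]
  have hsurj : Function.Surjective L := LinearMap.injective_iff_surjective.1 hinj
  have himg : (L.restrictScalars ℝ) '' ball 0 1 = ball 0 1 := by
    ext y
    constructor
    · rintro ⟨x, hx, rfl⟩
      simpa [hL] using hx
    · intro hy
      obtain ⟨x, rfl⟩ := hsurj y
      exact ⟨x, by simpa [hL] using hy, rfl⟩
  have h := Measure.addHaar_image_linearMap (Measure.addHaar : Measure V)
    (L.restrictScalars ℝ) (ball 0 1)
  rw [himg, abs_det_restrictScalars] at h
  have hpos : (Measure.addHaar : Measure V) (ball 0 1) ≠ 0 :=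
    (measure_ball_pos _ _ one_pos).ne'
  have h1 : ENNReal.ofReal (‖LinearMap.det L‖ ^ 2) = 1 :=
    (ENNReal.mul_eq_right hpos measure_ball_lt_top.ne).1 h.symm
  rw [ENNReal.ofReal_eq_one] at h1
  nlinarith [norm_nonneg (LinearMap.det L)]

end RealDeterminant

section MeanValue

variable {V : Type*} [NormedAddCommGroup V] [NormedSpace ℂ V] [FiniteDimensional ℂ V]
  [MeasurableSpace V] [BorelSpace V] (μ : Measure V) [μ.IsAddHaarMeasure]

theorem measurePreserving_smul_of_norm_eq_one {ζ : ℂ} (hζ : ‖ζ‖ = 1) :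
    MeasurePreserving (fun x : V => ζ • x) μ μ := by
  refine ⟨(continuous_const_smul ζ).measurable, ?_⟩
  set L : V →ₗ[ℂ] V := ζ • LinearMap.id with hL
  have hdet : ‖LinearMap.det L‖ = 1 := norm_det_of_isometry L fun x => by simp [hL, norm_smul, hζ]
  have hreal : |LinearMap.det (L.restrictScalars ℝ)| = 1 := by
    rw [abs_det_restrictScalars, hdet, one_pow]
  have h := Measure.map_linearMap_addHaar_eq_smul_addHaar μ (f := L.restrictScalars ℝ)
    (by intro h0; simp [h0] at hreal)
  rw [abs_inv, hreal] at h
  simp only [inv_one, ENNReal.ofReal_one, one_smul] at h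
  exact h

/-- Mean value property on a ball, with a radial weight. -/
theorem setIntegral_ball_radial_mul {Ω : Set V} {r : ℝ} (hΩ : IsOpen Ω)
    (hr : closedBall 0 r ⊆ Ω) {g : V → ℂ} (hg : DifferentiableOn ℂ g Ω) {h : ℝ → ℝ}
    (hh : IntegrableOn (fun y => h ‖y‖) (ball 0 r) μ) :
    ∫ y in ball 0 r, (h ‖y‖ : ℂ) * g y ∂μ = (∫ y in ball 0 r, h ‖y‖ ∂μ : ℝ) * g 0 := by
  have hproper : ProperSpace V := FiniteDimensional.proper ℂ V
  obtain ⟨M, hM⟩ := (isCompact_closedBall (0 : V) r).exists_bound_of_continuousOn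
    (hg.continuousOn.mono hr)
  set e : ℝ → ℂ := fun θ => Complex.exp (θ * Complex.I) with he
  have hen : ∀ θ, ‖e θ‖ = 1 := fun θ => Complex.norm_exp_ofReal_mul_I θ
  have hecont : Continuous e := by fun_prop
  -- rotation invariance
  have hrot : ∀ θ : ℝ, ∫ y in ball 0 r, (h ‖y‖ : ℂ) * g (e θ • y) ∂μ
      = ∫ y in ball 0 r, (h ‖y‖ : ℂ) * g y ∂μ := by
    intro θ
    have hmp := measurePreserving_smul_of_norm_eq_one μ (hen θ)
    have hemb : MeasurableEmbedding (fun x : V => e θ • x) :=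
      (Homeomorph.smulOfNeZero (e θ) (by rw [← norm_ne_zero_iff, hen]; simp)).measurableEmbedding
    have hpre : (fun x : V => e θ • x) ⁻¹' ball 0 r = ball 0 r := by
      ext x; simp [norm_smul, hen]
    have := hmp.setIntegral_preimage_emb hemb (fun y => (h ‖y‖ : ℂ) * g y) (ball 0 r)
    rw [hpre] at this
    simpa [norm_smul, hen] using this
  have hmaps : ∀ (y : V) (θ : ℝ), y ∈ ball (0 : V) r → e θ • y ∈ closedBall (0 : V) r := by
    intro y θ hy
    rw [mem_closedBall_zero_iff, norm_smul, hen, one_mul]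
    exact (mem_ball_zero_iff.1 hy).le
  have hinteg : Integrable (Function.uncurry fun (y : V) (θ : ℝ) => (h ‖y‖ : ℂ) * g (e θ • y))
      ((μ.restrict (ball 0 r)).prod (volume.restrict (Ioc 0 (2 * Real.pi)))) := by
    have h1 : Integrable (fun p : V × ℝ => (h ‖p.1‖ : ℂ))
        ((μ.restrict (ball 0 r)).prod (volume.restrict (Ioc 0 (2 * Real.pi)))) :=
      Integrable.comp_fst (f := fun y : V => (h ‖y‖ : ℂ)) hh.ofReal _
    refine h1.mul_bdd (c := M) ?_ ?_
    · rw [Measure.prod_restrict]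
      refine ContinuousOn.aestronglyMeasurable ?_ (measurableSet_ball.prod measurableSet_Ioc)
      refine hg.continuousOn.comp (Continuous.continuousOn (by fun_prop)) ?_
      rintro ⟨y, θ⟩ ⟨hy, -⟩
      exact hr (hmaps y θ hy)
    · rw [Measure.prod_restrict]
      refine (ae_restrict_iff' (measurableSet_ball.prod measurableSet_Ioc)).2 (ae_of_all _ ?_)
      rintro ⟨y, θ⟩ ⟨hy, -⟩
      exact hM _ (hmaps y θ hy)
  have hswap := integral_integral_swap hinteg
  have hinner : ∀ y ∈ ball (0 : V) r,
      ∫ θ in Ioc 0 (2 * Real.pi), (h ‖y‖ : ℂ) * g (e θ • y) = (2 * Real.pi) * h ‖y‖ * g 0 := by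
    intro y hy
    have hslice : DiffContOnCl ℂ (fun w : ℂ => g (w • y)) (ball 0 |(1 : ℝ)|) := by
      refine DifferentiableOn.diffContOnCl fun w hw => ?_
      have hw' : ‖w‖ ≤ 1 := by
        have := closure_ball_subset_closedBall hw
        simpa using this
      have hmem : w • y ∈ closedBall (0 : V) r := by
        rw [mem_closedBall_zero_iff, norm_smul]
        exact (mul_le_of_le_one_left (norm_nonneg _) hw').trans (mem_ball_zero_iff.1 hy).le
      have d := hg.differentiableAt (hΩ.mem_nhds (hr hmem))
      exact (DifferentiableAt.comp w (f := fun w : ℂ => w • y) d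
        (by fun_prop)).differentiableWithinAt
    have := hslice.circleAverage
    rw [Real.circleAverage_def, intervalIntegral.integral_of_le (by positivity)] at this
    simp only [circleMap_zero, Complex.ofReal_one, one_mul, zero_smul] at this
    rw [integral_const_mul, ← this, Complex.real_smul]
    have hpi : (Real.pi : ℂ) ≠ 0 := by exact_mod_cast Real.pi_ne_zero
    push_cast
    field_simp
    rfl
  have hL : ∫ y in ball 0 r, (∫ θ in Ioc 0 (2 * Real.pi), (h ‖y‖ : ℂ) * g (e θ • y)) ∂μ
      = (2 * Real.pi) * ((∫ y in ball 0 r, h ‖y‖ ∂μ : ℝ) * g 0) := by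
    rw [setIntegral_congr_fun measurableSet_ball hinner, integral_mul_const, integral_const_mul,
      integral_complex_ofReal, mul_assoc]
  have hR : ∫ θ in Ioc 0 (2 * Real.pi), ∫ y in ball 0 r, (h ‖y‖ : ℂ) * g (e θ • y) ∂μ
      = (2 * Real.pi) * ∫ y in ball 0 r, (h ‖y‖ : ℂ) * g y ∂μ := by
    simp only [hrot]
    rw [setIntegral_const]
    simp [Real.pi_pos.le]
  rw [hL, hR] at hswap
  exact (mul_left_cancel₀ (by simp [Real.pi_ne_zero]) hswap).symm

/-- Sub-mean value property of `‖f‖²`. -/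
theorem norm_sq_mul_measureReal_ball_le {Ω : Set V} {x : V} {r : ℝ} (hΩ : IsOpen Ω)
    (hr : closedBall x r ⊆ Ω) {f : V → ℂ} (hf : DifferentiableOn ℂ f Ω) :
    ‖f x‖ ^ 2 * μ.real (ball x r) ≤ ∫ y in ball x r, ‖f y‖ ^ 2 ∂μ := by
  set g : V → ℂ := fun y => f (x + y) ^ 2 with hgdef
  have hΩ' : IsOpen ((fun y => x + y) ⁻¹' Ω) := hΩ.preimage (by fun_prop)
  have hg : DifferentiableOn ℂ g ((fun y => x + y) ⁻¹' Ω) :=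
    (hf.comp (by fun_prop) (mapsTo_preimage _ _)).pow 2
  have hr' : closedBall 0 r ⊆ (fun y => x + y) ⁻¹' Ω := fun y hy => hr (by simpa using hy)
  have h := setIntegral_ball_radial_mul μ (h := fun _ => 1) hΩ' hr' hg
    (integrableOn_const measure_ball_lt_top.ne)
  simp only [Complex.ofReal_one, one_mul, setIntegral_const, smul_eq_mul, mul_one] at h
  have hball : (fun y => x + y) ⁻¹' ball x r = ball 0 r := by ext; simp
  have hreal : μ.real (ball (0 : V) r) = μ.real (ball x r) := by
    rw [measureReal_def, measureReal_def, Measure.addHaar_ball_center μ x]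
  have htr : ∫ y in ball 0 r, ‖f (x + y)‖ ^ 2 ∂μ = ∫ y in ball x r, ‖f y‖ ^ 2 ∂μ := by
    rw [← hball]
    exact (measurePreserving_add_left μ x).setIntegral_preimage_emb
      (MeasurableEquiv.addLeft x).measurableEmbedding (fun y => ‖f y‖ ^ 2) _
  rw [← htr, ← hreal]
  calc ‖f x‖ ^ 2 * μ.real (ball 0 r) = ‖(μ.real (ball (0 : V) r) : ℂ) * g 0‖ := by
        simp [hgdef, mul_comm, abs_of_nonneg measureReal_nonneg]
    _ = ‖∫ y in ball 0 r, g y ∂μ‖ := by rw [h]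
    _ ≤ ∫ y in ball 0 r, ‖g y‖ ∂μ := norm_integral_le_integral_norm _
    _ = _ := by simp [hgdef]

end MeanValue

section BallAutomorphisms

theorem sq_sqrt_one_sub_norm_sq {V : Type*} [NormedAddCommGroup V] {a : V} (ha : ‖a‖ < 1) :
    √(1 - ‖a‖ ^ 2) ^ 2 = 1 - ‖a‖ ^ 2 :=
  Real.sq_sqrt (by nlinarith [norm_nonneg a])

theorem sqrt_one_sub_norm_sq_pos {V : Type*} [NormedAddCommGroup V] {a : V} (ha : ‖a‖ < 1) : 0 < √(1 - ‖a‖ ^ 2) :=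
  Real.sqrt_pos.2 (by nlinarith [norm_nonneg a])

variable {V : Type*} [NormedAddCommGroup V] [InnerProductSpace ℂ V]

/-- The involutive automorphism of the unit ball exchanging `0` and `a`. -/
def ballInvolution (a x : V) : V :=
  (1 - inner ℂ a x)⁻¹ • ((1 - inner ℂ a x / (1 + (√(1 - ‖a‖ ^ 2) : ℂ))) • a
    - (√(1 - ‖a‖ ^ 2) : ℂ) • x)

theorem norm_inner_lt_one {a x : V} (ha : ‖a‖ < 1) (hx : ‖x‖ ≤ 1) : ‖inner ℂ a x‖ < 1 :=
  (norm_inner_le_norm a x).trans_lt (by nlinarith [norm_nonneg a, norm_nonneg x])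

theorem one_sub_inner_ne_zero {a x : V} (ha : ‖a‖ < 1) (hx : ‖x‖ ≤ 1) :
    (1 : ℂ) - inner ℂ a x ≠ 0 := by
  intro h
  have := norm_inner_lt_one ha hx
  rw [← sub_eq_zero.1 h] at this
  simp at this

@[simp] theorem ballInvolution_zero (a : V) : ballInvolution a 0 = a := by
  simp [ballInvolution]

theorem one_sub_norm_sq_ballInvolution {a x : V} (ha : ‖a‖ < 1) (hx : ‖x‖ ≤ 1) :
    1 - ‖ballInvolution a x‖ ^ 2
      = (1 - ‖a‖ ^ 2) * (1 - ‖x‖ ^ 2) / ‖1 - inner ℂ a x‖ ^ 2 := by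
  have hd := one_sub_inner_ne_zero ha hx
  have hs := sq_sqrt_one_sub_norm_sq ha
  have hs0 := sqrt_one_sub_norm_sq_pos ha
  rw [ballInvolution, norm_smul, norm_inv]
  set s := √(1 - ‖a‖ ^ 2)
  set p : ℂ := inner ℂ a x with hp
  have hdn : ‖1 - p‖ ≠ 0 := norm_ne_zero_iff.2 hd
  have hnum : ‖(1 - p / (1 + (s : ℂ))) • a - (s : ℂ) • x‖ ^ 2
      = ‖1 - p‖ ^ 2 - (1 - ‖a‖ ^ 2) * (1 - ‖x‖ ^ 2) := by
    rw [@norm_sub_sq ℂ, inner_smul_left, inner_smul_right, ← hp, norm_smul, norm_smul, mul_pow,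
      mul_pow]
    have e1 : ‖(1 : ℂ) - p‖ ^ 2 = 1 - 2 * p.re + ‖p‖ ^ 2 := by
      rw [← Complex.normSq_eq_norm_sq, ← Complex.normSq_eq_norm_sq, Complex.normSq_apply,
        Complex.normSq_apply]
      simp; ring
    obtain ⟨q, hqs⟩ : ∃ q : ℝ, q = (1 + s)⁻¹ := ⟨_, rfl⟩
    have hq : p / (1 + (s : ℂ)) = (q : ℂ) * p := by
      rw [hqs]; push_cast; rw [div_eq_inv_mul]
    have e2 : ‖(1 : ℂ) - p / (1 + (s : ℂ))‖ ^ 2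
        = 1 - 2 * q * p.re + q ^ 2 * ‖p‖ ^ 2 := by
      rw [hq, ← Complex.normSq_eq_norm_sq, ← Complex.normSq_eq_norm_sq, Complex.normSq_apply,
        Complex.normSq_apply]
      simp; ring
    have e3 : RCLike.re ((starRingEnd ℂ) (1 - p / (1 + (s : ℂ))) * ((s : ℂ) * p))
        = s * p.re - s * q * ‖p‖ ^ 2 := by
      rw [hq, ← Complex.normSq_eq_norm_sq, Complex.normSq_apply]
      simp; ring
    rw [e1, e2, e3]
    have hsn : ‖(s : ℂ)‖ ^ 2 = s ^ 2 := by simp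
    have hA : ‖a‖ ^ 2 = 1 - s ^ 2 := by rw [hs]; ring
    rw [hsn, hA, hqs]
    have : (1 + s) ≠ 0 := by positivity
    field_simp
    ring
  rw [mul_pow, hnum]
  field_simp
  ring

theorem ballInvolution_mem {a x : V} (ha : ‖a‖ < 1) (hx : ‖x‖ < 1) : ‖ballInvolution a x‖ < 1 := by
  have h := one_sub_norm_sq_ballInvolution ha hx.le
  have hd := one_sub_inner_ne_zero ha hx.le
  have : 0 < (1 - ‖a‖ ^ 2) * (1 - ‖x‖ ^ 2) / ‖1 - inner ℂ a x‖ ^ 2 := by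
    have h1 : 0 < 1 - ‖a‖ ^ 2 := by nlinarith [norm_nonneg a]
    have h2 : 0 < 1 - ‖x‖ ^ 2 := by nlinarith [norm_nonneg x]
    have h3 : 0 < ‖1 - inner ℂ a x‖ := norm_pos_iff.2 hd
    positivity
  nlinarith [norm_nonneg (ballInvolution a x)]

theorem norm_ballInvolution_le {a x : V} (ha : ‖a‖ < 1) (hx : ‖x‖ ≤ 1) :
    ‖ballInvolution a x‖ ≤ 1 := by
  have h := one_sub_norm_sq_ballInvolution ha hx
  have : 0 ≤ (1 - ‖a‖ ^ 2) * (1 - ‖x‖ ^ 2) / ‖1 - inner ℂ a x‖ ^ 2 := by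
    have h1 : 0 ≤ 1 - ‖a‖ ^ 2 := by nlinarith [norm_nonneg a]
    have h2 : 0 ≤ 1 - ‖x‖ ^ 2 := by nlinarith [norm_nonneg x]
    positivity
  nlinarith [norm_nonneg (ballInvolution a x)]

theorem ballInvolution_ballInvolution {a x : V} (ha : ‖a‖ < 1) (hx : ‖x‖ ≤ 1) :
    ballInvolution a (ballInvolution a x) = x := by
  have hd := one_sub_inner_ne_zero ha hx
  have hs := sq_sqrt_one_sub_norm_sq ha
  have hs0 := sqrt_one_sub_norm_sq_pos ha
  have hA : (inner ℂ a a : ℂ) = 1 - (√(1 - ‖a‖ ^ 2) : ℂ) ^ 2 := by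
    rw [inner_self_eq_norm_sq_to_K, ← Complex.ofReal_pow, hs]
    push_cast
    simp
  set y := ballInvolution a x with hy
  rw [ballInvolution] at hy ⊢
  set s := √(1 - ‖a‖ ^ 2)
  set p : ℂ := inner ℂ a x with hp
  have hs1 : (1 + (s : ℂ)) ≠ 0 := by
    have : (1 + s) ≠ 0 := by positivity
    exact_mod_cast this
  have hsC : (s : ℂ) ≠ 0 := by exact_mod_cast hs0.ne'
  have hin : (inner ℂ a y : ℂ) = 1 - (s : ℂ) ^ 2 / (1 - p) := by
    rw [hy, inner_smul_right, inner_sub_right, inner_smul_right, inner_smul_right, hA, ← hp]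
    field_simp
    ring
  rw [hin, hy]
  have h1 : (1 - (1 - (s : ℂ) ^ 2 / (1 - p)))⁻¹ = (1 - p) / (s : ℂ) ^ 2 := by
    rw [sub_sub_cancel, inv_div]
  rw [h1, smul_sub, smul_smul, smul_smul, smul_smul, smul_sub, smul_smul, smul_smul]
  have h2 : (1 - p) / (s : ℂ) ^ 2 * (1 - (1 - (s : ℂ) ^ 2 / (1 - p)) / (1 + s))
      = (1 - p) / (s : ℂ) ^ 2 * ↑s * (1 - p)⁻¹ * (1 - p / (1 + s)) := by
    field_simp
    ring
  have h3 : (1 - p) / (s : ℂ) ^ 2 * ↑s * (1 - p)⁻¹ * (s : ℂ) = 1 := by field_simp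
  rw [h2, h3, one_smul, sub_sub_cancel]

@[simp] theorem ballInvolution_self {a : V} (ha : ‖a‖ < 1) : ballInvolution a a = 0 := by
  have := ballInvolution_ballInvolution ha (x := 0) (by simp)
  simpa using this

theorem differentiableAt_ballInvolution {a x : V} (h : (1 : ℂ) - inner ℂ a x ≠ 0) :
    DifferentiableAt ℂ (ballInvolution a) x := by
  have hin : Differentiable ℂ (fun x : V => (inner ℂ a x : ℂ)) := (innerSL ℂ a).differentiable
  unfold ballInvolution
  refine DifferentiableAt.smul (DifferentiableAt.inv ?_ h) ?_
  · exact (hin x).const_sub 1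
  · refine DifferentiableAt.sub (DifferentiableAt.smul_const ?_ _) (by fun_prop)
    simp only [div_eq_mul_inv]
    exact ((hin x).mul_const _).const_sub 1

theorem differentiableOn_ballInvolution {a : V} (ha : ‖a‖ < 1) :
    DifferentiableOn ℂ (ballInvolution a) (ball 0 1) := fun _ hx =>
  (differentiableAt_ballInvolution
    (one_sub_inner_ne_zero ha (mem_ball_zero_iff.1 hx).le)).differentiableWithinAt

theorem mapsTo_ballInvolution {a : V} (ha : ‖a‖ < 1) :
    MapsTo (ballInvolution a) (ball 0 1) (ball 0 1) := fun _ hx =>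
  mem_ball_zero_iff.2 (ballInvolution_mem ha (mem_ball_zero_iff.1 hx))

theorem fderiv_ballInvolution_zero (a h : V) :
    fderiv ℂ (ballInvolution a) 0 h = (1 - (1 + (√(1 - ‖a‖ ^ 2) : ℂ))⁻¹) • (inner ℂ a h : ℂ) • a
      - (√(1 - ‖a‖ ^ 2) : ℂ) • h := by
  set s := √(1 - ‖a‖ ^ 2) with hs
  have hin : HasFDerivAt (fun x : V => (inner ℂ a x : ℂ)) (innerSL ℂ a) 0 :=
    (innerSL ℂ a).hasFDerivAt
  have h1 : HasFDerivAt (fun x : V => (1 - (inner ℂ a x : ℂ))⁻¹) (innerSL ℂ a) 0 := by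
    have := (hasDerivAt_inv (x := (1 : ℂ) - inner ℂ a (0 : V)) (by simp)).comp_hasFDerivAt
      (0 : V) (hin.const_sub 1)
    simpa [Function.comp_def] using this
  have h2 : HasFDerivAt (fun x : V => (1 - (inner ℂ a x : ℂ) / (1 + (s : ℂ))) • a - (s : ℂ) • x)
      ((-((1 + (s : ℂ))⁻¹ • innerSL ℂ a)).smulRight a - (s : ℂ) • ContinuousLinearMap.id ℂ V) 0 := by
    refine HasFDerivAt.sub (HasFDerivAt.smul_const ?_ a) ?_
    · have := (hin.mul_const (1 + (s : ℂ))⁻¹).const_sub 1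
      simpa [div_eq_mul_inv] using this
    · exact (hasFDerivAt_id (0 : V)).const_smul (s : ℂ)
  have h3 : HasFDerivAt (ballInvolution a) _ 0 := h1.smul h2
  rw [h3.fderiv]
  simp only [_root_.add_apply, _root_.smul_apply,
    _root_.sub_apply, ContinuousLinearMap.smulRight_apply,
    _root_.neg_apply, innerSL_apply_apply, inner_zero_right, sub_zero, inv_one,
    one_smul, zero_div, smul_zero, ContinuousLinearMap.id_apply, smul_eq_mul]
  module

variable [FiniteDimensional ℂ V]

theorem norm_jacDet_ballInvolution_zero {a : V} (ha : ‖a‖ < 1) :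
    ‖jacDet (ballInvolution a) 0‖ = √(1 - ‖a‖ ^ 2) ^ (Module.finrank ℂ V + 1) := by
  have hs := sq_sqrt_one_sub_norm_sq ha
  have hs0 := sqrt_one_sub_norm_sq_pos ha
  have hfd := fderiv_ballInvolution_zero a
  have hA : (inner ℂ a a : ℂ) = 1 - (√(1 - ‖a‖ ^ 2) : ℂ) ^ 2 := by
    rw [inner_self_eq_norm_sq_to_K, ← Complex.ofReal_pow, hs]
    push_cast
    simp
  set s := √(1 - ‖a‖ ^ 2) with hsdef
  have hsC : (s : ℂ) ≠ 0 := by exact_mod_cast hs0.ne'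
  have hs1 : (1 + (s : ℂ)) ≠ 0 := by
    have : (1 + s) ≠ 0 := by positivity
    exact_mod_cast this
  have hlin : ((fderiv ℂ (ballInvolution a) 0 : V →L[ℂ] V) : V →ₗ[ℂ] V)
      = (-(s : ℂ)) • LinearMap.transvection ((innerSL ℂ a : V →L[ℂ] ℂ) : V →ₗ[ℂ] ℂ)
        (-((s : ℂ)⁻¹ * (1 - (1 + (s : ℂ))⁻¹)) • a) := by
    ext h
    simp only [ContinuousLinearMap.coe_coe, hfd, LinearMap.smul_apply, LinearMap.transvection.apply,
      innerSL_apply_apply, smul_add, smul_smul]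
    have : -(s : ℂ) * (inner ℂ a h * -((s : ℂ)⁻¹ * (1 - (1 + (s : ℂ))⁻¹)))
      = (1 - (1 + (s : ℂ))⁻¹) * inner ℂ a h := by field_simp
    rw [this]
    module
  rw [jacDet, hlin, LinearMap.det_smul, LinearMap.transvection.det, norm_mul, norm_pow, norm_neg,
    pow_succ]
  simp only [ContinuousLinearMap.coe_coe, innerSL_apply_apply, inner_smul_right, hA]
  have : 1 + -((s : ℂ)⁻¹ * (1 - (1 + (s : ℂ))⁻¹)) * (1 - (s : ℂ) ^ 2) = s := by
    field_simp
    ring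
  rw [this, Complex.norm_real, Real.norm_of_nonneg hs0.le]

end BallAutomorphisms

section

theorem jacDet_comp {V : Type*} [NormedAddCommGroup V] [NormedSpace ℂ V] {f g : V → V} {x : V}
    (hf : DifferentiableAt ℂ f (g x)) (hg : DifferentiableAt ℂ g x) :
    jacDet (f ∘ g) x = jacDet f (g x) * jacDet g x := by
  rw [jacDet, fderiv_comp x hf hg, jacDet, jacDet, ← LinearMap.det_comp]
  rfl

theorem jacDet_congr {V : Type*} [NormedAddCommGroup V] [NormedSpace ℂ V] {f g : V → V} {x : V}
    (h : f =ᶠ[𝓝 x] g) : jacDet f x = jacDet g x := by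
  rw [jacDet, h.fderiv_eq, jacDet]

theorem jacDet_id {V : Type*} [NormedAddCommGroup V] [NormedSpace ℂ V] (x : V) :
    jacDet (id : V → V) x = 1 := by
  simp [jacDet]

variable {V : Type*} [NormedAddCommGroup V] [InnerProductSpace ℂ V]

theorem IsAutOn.exists_one_sub_norm_sq_eq {γ : V → V} (h : IsAutOn (ball (0 : V) 1) γ) :
    ∃ c : V, ‖c‖ < 1 ∧ ∀ x ∈ ball (0 : V) 1,
      1 - ‖γ x‖ ^ 2 = (1 - ‖c‖ ^ 2) * (1 - ‖x‖ ^ 2) / ‖1 - inner ℂ c x‖ ^ 2 := by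
  obtain ⟨hd, hm, γ', hd', hm', hl, hr⟩ := h
  have h0 : (0 : V) ∈ ball (0 : V) 1 := mem_ball_self one_pos
  have hc : ‖γ' 0‖ < 1 := mem_ball_zero_iff.1 (hm' h0)
  refine ⟨γ' 0, hc, fun x hx => ?_⟩
  have hx' : ‖x‖ < 1 := mem_ball_zero_iff.1 hx
  rw [← one_sub_norm_sq_ballInvolution hc hx'.le]
  have hφ := mapsTo_ballInvolution hc
  have hφd := differentiableOn_ballInvolution hc
  congr 2
  refine le_antisymm ?_ ?_
  · have := Complex.norm_le_norm_of_mapsTo_ball (f := γ ∘ ballInvolution (γ' 0))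
      (z := ballInvolution (γ' 0) x) (hd.comp hφd hφ)
      ((hm.comp hφ).mono_right ball_subset_closedBall)
      (by simpa using hr h0) (by simpa using hφ hx)
    simpa [ballInvolution_ballInvolution hc hx'.le] using this
  · have := Complex.norm_le_norm_of_mapsTo_ball (f := ballInvolution (γ' 0) ∘ γ')
      (z := γ x) (hφd.comp hd' hm')
      ((hφ.comp hm').mono_right ball_subset_closedBall)
      (by simp [ballInvolution_self hc]) (by simpa using hm hx)
    have e : γ' (γ x) = x := hl hx
    simpa [e] using this

theorem one_sub_norm_le_norm_one_sub_inner {c x : V} (hc : ‖c‖ ≤ 1) :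
    1 - ‖x‖ ≤ ‖1 - inner ℂ c x‖ := by
  have h1 := norm_sub_norm_le (1 : ℂ) (inner ℂ c x)
  have h2 := norm_inner_le_norm (𝕜 := ℂ) c x
  rw [norm_one] at h1
  nlinarith [norm_nonneg x, norm_nonneg c]

variable [FiniteDimensional ℂ V]

theorem norm_jacDet_of_fixed_zero {T T' : V → V} (hd : DifferentiableOn ℂ T (ball 0 1))
    (hm : MapsTo T (ball 0 1) (ball 0 1)) (hd' : DifferentiableOn ℂ T' (ball 0 1))
    (hm' : MapsTo T' (ball 0 1) (ball 0 1)) (hl : EqOn (T' ∘ T) id (ball 0 1)) (h0 : T 0 = 0) :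
    ‖jacDet T 0‖ = 1 := by
  have hb : (0 : V) ∈ ball (0 : V) 1 := mem_ball_self one_pos
  have hn : ball (0 : V) 1 ∈ 𝓝 (0 : V) := ball_mem_nhds _ one_pos
  have h0' : T' 0 = 0 := by simpa [h0] using hl hb
  have h1 := Complex.norm_fderiv_le_one_of_mapsTo_ball hd
    (by rw [h0]; exact hm.mono_right ball_subset_closedBall) one_pos
  have h1' := Complex.norm_fderiv_le_one_of_mapsTo_ball hd'
    (by rw [h0']; exact hm'.mono_right ball_subset_closedBall) one_pos
  have hcomp : (fderiv ℂ T' 0).comp (fderiv ℂ T 0) = ContinuousLinearMap.id ℂ V := by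
    have := fderiv_comp (0 : V) (g := T') (f := T) (by rw [h0]; exact hd'.differentiableAt hn)
      (hd.differentiableAt hn)
    rw [h0] at this
    rw [← this, (hl.eventuallyEq_of_mem hn).fderiv_eq, fderiv_id]
  refine norm_det_of_isometry _ fun v => le_antisymm ?_ ?_
  · simpa using (fderiv ℂ T 0).le_of_opNorm_le h1 v
  · have := (fderiv ℂ T' 0).le_of_opNorm_le h1' (fderiv ℂ T 0 v)
    rw [one_mul] at this
    have e : fderiv ℂ T' 0 (fderiv ℂ T 0 v) = v := congrArg (· v) hcomp
    rwa [e] at this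

theorem norm_jacDet_ballInvolution_self {a : V} (ha : ‖a‖ < 1) :
    ‖jacDet (ballInvolution a) a‖ * √(1 - ‖a‖ ^ 2) ^ (Module.finrank ℂ V + 1) = 1 := by
  have hn : ball (0 : V) 1 ∈ 𝓝 (0 : V) := ball_mem_nhds _ one_pos
  have hφd := differentiableOn_ballInvolution ha
  have h := jacDet_comp (f := ballInvolution a) (g := ballInvolution a) (x := (0 : V))
    (by rw [ballInvolution_zero]
        exact hφd.differentiableAt (isOpen_ball.mem_nhds (mem_ball_zero_iff.2 ha)))
    (hφd.differentiableAt hn)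
  rw [jacDet_congr (f := ballInvolution a ∘ ballInvolution a) (g := id) (Filter.eventually_of_mem hn fun x hx =>
    ballInvolution_ballInvolution ha (mem_ball_zero_iff.1 hx).le), jacDet_id,
    ballInvolution_zero] at h
  rw [← norm_jacDet_ballInvolution_zero ha, ← norm_mul, ← h, norm_one]

theorem IsAutOn.norm_jacDet_mul {γ : V → V} (h : IsAutOn (ball (0 : V) 1) γ) {x : V}
    (hx : x ∈ ball (0 : V) 1) :
    ‖jacDet γ x‖ * √(1 - ‖x‖ ^ 2) ^ (Module.finrank ℂ V + 1)
      = √(1 - ‖γ x‖ ^ 2) ^ (Module.finrank ℂ V + 1) := by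
  obtain ⟨hd, hm, γ', hd', hm', hl, hr⟩ := h
  have hx' : ‖x‖ < 1 := mem_ball_zero_iff.1 hx
  have hb : ‖γ x‖ < 1 := mem_ball_zero_iff.1 (hm hx)
  have hn : ball (0 : V) 1 ∈ 𝓝 (0 : V) := ball_mem_nhds _ one_pos
  have hx₁ := mapsTo_ballInvolution hx'
  have hx₂ := differentiableOn_ballInvolution hx'
  have hb₁ := mapsTo_ballInvolution hb
  have hb₂ := differentiableOn_ballInvolution hb
  have h1 : ‖jacDet (ballInvolution (γ x) ∘ γ ∘ ballInvolution x) 0‖ = 1 := by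
    refine norm_jacDet_of_fixed_zero (T' := ballInvolution x ∘ γ' ∘ ballInvolution (γ x))
      (hb₂.comp (hd.comp hx₂ hx₁) (hm.comp hx₁)) (hb₁.comp (hm.comp hx₁))
      (hx₂.comp (hd'.comp hb₂ hb₁) (hm'.comp hb₁)) (hx₁.comp (hm'.comp hb₁)) (fun y hy => ?_) ?_
    · have e₁ := ballInvolution_ballInvolution hb (mem_ball_zero_iff.1 (hm (hx₁ hy))).le
      have e₂ : γ' (γ (ballInvolution x y)) = _ := hl (hx₁ hy)
      have e₃ := ballInvolution_ballInvolution hx' (mem_ball_zero_iff.1 hy).le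
      simp [e₁, e₂, e₃]
    · simp [ballInvolution_self hb]
  rw [jacDet_comp, jacDet_comp] at h1
  · simp only [Function.comp_apply, ballInvolution_zero, norm_mul,
      norm_jacDet_ballInvolution_zero hx'] at h1
    have h2 := norm_jacDet_ballInvolution_self hb
    have h3 : ‖jacDet (ballInvolution (γ x)) (γ x)‖ ≠ 0 := fun h => by simp [h] at h2
    exact mul_left_cancel₀ h3 (h1.trans h2.symm)
  · rw [ballInvolution_zero]; exact hd.differentiableAt (isOpen_ball.mem_nhds hx)
  · exact hx₂.differentiableAt hn
  · simp only [Function.comp_apply, ballInvolution_zero]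
    exact hb₂.differentiableAt (isOpen_ball.mem_nhds (hm hx))
  · exact (hd.comp hx₂ hx₁).differentiableAt hn

theorem IsAutOn.exists_norm_jacDet_eq {γ : V → V} (h : IsAutOn (ball (0 : V) 1) γ) :
    ∃ c : V, ‖c‖ < 1 ∧ 1 - ‖γ 0‖ ^ 2 = 1 - ‖c‖ ^ 2 ∧ ∀ x ∈ ball (0 : V) 1,
      1 - ‖γ x‖ ^ 2 = (1 - ‖c‖ ^ 2) * (1 - ‖x‖ ^ 2) / ‖1 - inner ℂ c x‖ ^ 2 ∧
      ‖jacDet γ x‖ = (√(1 - ‖c‖ ^ 2) / ‖1 - inner ℂ c x‖) ^ (Module.finrank ℂ V + 1) := by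
  obtain ⟨c, hc, hx⟩ := h.exists_one_sub_norm_sq_eq
  refine ⟨c, hc, by simpa using hx 0 (mem_ball_self one_pos), fun x hxB => ⟨hx x hxB, ?_⟩⟩
  have hx' : ‖x‖ < 1 := mem_ball_zero_iff.1 hxB
  have h1 := h.norm_jacDet_mul hxB
  have h2 := sqrt_one_sub_norm_sq_pos hx'
  have h3 : 0 ≤ 1 - ‖c‖ ^ 2 := by nlinarith [norm_nonneg c]
  have h4 : 0 ≤ 1 - ‖x‖ ^ 2 := by nlinarith [norm_nonneg x]
  rw [hx x hxB, Real.sqrt_div (mul_nonneg h3 h4), Real.sqrt_mul h3, Real.sqrt_sq (norm_nonneg _),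
    mul_div_right_comm, mul_pow] at h1
  exact mul_right_cancel₀ (pow_ne_zero _ h2.ne') h1

theorem IsAutOn.one_sub_norm_sq_le {γ : V → V} (h : IsAutOn (ball (0 : V) 1) γ) {x : V}
    (hx : x ∈ ball (0 : V) 1) : 1 - ‖γ x‖ ^ 2 ≤ (1 - ‖γ 0‖ ^ 2) / (1 - ‖x‖) ^ 2 := by
  obtain ⟨c, hc, h0, h1⟩ := h.exists_norm_jacDet_eq
  have hx' : ‖x‖ < 1 := mem_ball_zero_iff.1 hx
  have h3 : 0 ≤ 1 - ‖c‖ ^ 2 := by nlinarith [norm_nonneg c]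
  have h2 := one_sub_norm_le_norm_one_sub_inner (x := x) hc.le
  rw [(h1 x hx).1, h0]
  gcongr
  · nlinarith

theorem IsAutOn.le_one_sub_norm_sq {γ : V → V} (h : IsAutOn (ball (0 : V) 1) γ) {x : V}
    (hx : x ∈ ball (0 : V) 1) :
    (1 - ‖γ 0‖ ^ 2) ≤ 4 / (1 - ‖x‖ ^ 2) * (1 - ‖γ x‖ ^ 2) := by
  obtain ⟨c, hc, h0, h1⟩ := h.exists_norm_jacDet_eq
  have hx' : ‖x‖ < 1 := mem_ball_zero_iff.1 hx
  have h3 : 0 ≤ 1 - ‖c‖ ^ 2 := by nlinarith [norm_nonneg c]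
  have h4 : 0 < 1 - ‖x‖ ^ 2 := by nlinarith [norm_nonneg x]
  have h5 : 0 < ‖1 - inner ℂ c x‖ := norm_pos_iff.2 (one_sub_inner_ne_zero hc hx'.le)
  have h6 : ‖1 - inner ℂ c x‖ ≤ 2 := by
    have := norm_sub_le (1 : ℂ) (inner ℂ c x)
    have h7 := norm_inner_lt_one hc hx'.le
    rw [norm_one] at this
    linarith
  rw [(h1 x hx).1, h0]
  have : 4 / (1 - ‖x‖ ^ 2) * ((1 - ‖c‖ ^ 2) * (1 - ‖x‖ ^ 2) / ‖1 - inner ℂ c x‖ ^ 2)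
      = (1 - ‖c‖ ^ 2) * (4 / ‖1 - inner ℂ c x‖ ^ 2) := by
    field_simp
  rw [this]
  refine le_mul_of_one_le_right h3 ?_
  rw [one_le_div (by positivity)]
  nlinarith

theorem IsAutOn.norm_jacDet_le {γ : V → V} (h : IsAutOn (ball (0 : V) 1) γ) {x : V}
    (hx : x ∈ ball (0 : V) 1) :
    ‖jacDet γ x‖ ≤ (1 - ‖γ 0‖ ^ 2) / (1 - ‖x‖) ^ (Module.finrank ℂ V + 1) := by
  obtain ⟨c, hc, h0, h1⟩ := h.exists_norm_jacDet_eq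
  have hx' : 0 < 1 - ‖x‖ := by linarith [mem_ball_zero_iff.1 hx]
  have h3 : 0 ≤ 1 - ‖c‖ ^ 2 := by nlinarith [norm_nonneg c]
  have h2 := one_sub_norm_le_norm_one_sub_inner (x := x) hc.le
  have h4 : √(1 - ‖c‖ ^ 2) ≤ 1 := Real.sqrt_le_one.2 (by nlinarith [norm_nonneg c])
  rw [(h1 x hx).2, h0, div_pow]
  gcongr
  rcases subsingleton_or_nontrivial V with hV | hV
  · simp [Subsingleton.elim c 0]
  · have : 2 ≤ Module.finrank ℂ V + 1 := Nat.succ_le_succ (Module.finrank_pos)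
    exact (pow_le_pow_of_le_one (Real.sqrt_nonneg _) h4 this).trans_eq (Real.sq_sqrt h3)

end

section

variable {V : Type*} [NormedAddCommGroup V] [InnerProductSpace ℂ V]

/-- A group of permutations acting freely on the unit ball by automorphisms, whose orbits
satisfy the Blaschke-type condition. -/
structure IsBallGroup (G : Subgroup (Equiv.Perm V)) : Prop where
  isAutOn : ∀ g : G, IsAutOn (ball (0 : V) 1) g.1
  eq_one : ∀ g : G, ∀ z ∈ ball (0 : V) 1, g.1 z = z → g = 1
  summable : Summable fun g : G => 1 - ‖g.1 0‖ ^ 2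

namespace IsBallGroup

variable {G : Subgroup (Equiv.Perm V)} (hG : IsBallGroup G)
include hG

theorem mapsTo (g : G) : MapsTo g.1 (ball (0 : V) 1) (ball 0 1) := (hG.isAutOn g).2.1

theorem differentiableOn (g : G) : DifferentiableOn ℂ g.1 (ball (0 : V) 1) := (hG.isAutOn g).1

theorem differentiableAt (g : G) {x : V} (hx : x ∈ ball (0 : V) 1) : DifferentiableAt ℂ g.1 x :=
  (hG.differentiableOn g).differentiableAt (isOpen_ball.mem_nhds hx)

theorem one_sub_norm_sq_pos (g : G) : 0 < 1 - ‖g.1 0‖ ^ 2 := by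
  have := mem_ball_zero_iff.1 (hG.mapsTo g (mem_ball_self one_pos))
  nlinarith [norm_nonneg (g.1 0)]

theorem countable : Countable G := by
  have h := hG.summable.countable_support
  rwa [show Function.support (fun g : G => 1 - ‖g.1 0‖ ^ 2) = univ from
    eq_univ_of_forall fun g => (hG.one_sub_norm_sq_pos g).ne', countable_univ_iff] at h

theorem jacDet_mul (g h : G) {x : V} (hx : x ∈ ball (0 : V) 1) :
    jacDet (g * h).1 x = jacDet g.1 (h.1 x) * jacDet h.1 x :=
  jacDet_comp (f := g.1) (g := h.1) (hG.differentiableAt g (hG.mapsTo h hx))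
    (hG.differentiableAt h hx)

theorem image_eq (g : G) {W : Set V} (hW : W ⊆ ball (0 : V) 1) :
    g.1 '' W = ball (0 : V) 1 ∩ g⁻¹.1 ⁻¹' W := by
  ext x
  simp only [mem_image, mem_inter_iff, mem_preimage]
  constructor
  · rintro ⟨y, hy, rfl⟩
    refine ⟨hG.mapsTo g (hW hy), ?_⟩
    simpa using hy
  · rintro ⟨-, h⟩
    exact ⟨_, h, by simp⟩

theorem isOpen_image (g : G) {W : Set V} (hW : W ⊆ ball (0 : V) 1) (ho : IsOpen W) :
    IsOpen (g.1 '' W) := by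
  rw [hG.image_eq g hW]
  exact (hG.differentiableOn g⁻¹).continuousOn.isOpen_inter_preimage isOpen_ball ho

variable [FiniteDimensional ℂ V]

theorem continuousOn_jacDet (g : G) : ContinuousOn (jacDet g.1) (ball (0 : V) 1) :=
  (differentiableOn_jacDet isOpen_ball (hG.differentiableOn g)).continuousOn

theorem finite_setOf_norm_le {ρ : ℝ} (hρ : ρ < 1) :
    {g : G | ∃ x : V, ‖x‖ ≤ ρ ∧ ‖g.1 x‖ ≤ ρ}.Finite := by
  have h1 : ∀ᶠ g in cofinite, 1 - ‖(g : G).1 0‖ ^ 2 < (1 - ρ) ^ 3 :=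
    hG.summable.tendsto_cofinite_zero.eventually_lt_const (by
      have : 0 < 1 - ρ := by linarith
      positivity)
  refine (eventually_cofinite.1 h1).subset ?_
  rintro g ⟨x, hx, hgx⟩
  simp only [mem_ofPred_eq, not_lt]
  have hxB : x ∈ ball (0 : V) 1 := mem_ball_zero_iff.2 (hx.trans_lt hρ)
  have h2 := (hG.isAutOn g).one_sub_norm_sq_le hxB
  have h3 : 0 < 1 - ‖x‖ := by linarith
  rw [le_div_iff₀ (by positivity)] at h2
  have h4 : (1 - ρ) ^ 2 ≤ (1 - ‖x‖) ^ 2 := by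
    gcongr
  have h5 : 1 - ρ ≤ 1 - ‖g.1 x‖ ^ 2 := by nlinarith [norm_nonneg (g.1 x)]
  calc (1 - ρ) ^ 3 = (1 - ρ) * (1 - ρ) ^ 2 := by ring
    _ ≤ (1 - ‖g.1 x‖ ^ 2) * (1 - ‖x‖) ^ 2 := by
      gcongr
      linarith
    _ ≤ _ := h2

theorem exists_ball_disjoint {z : V} (hz : z ∈ ball (0 : V) 1) :
    ∃ r > 0, closedBall z r ⊆ ball 0 1 ∧ ∀ g : G, g ≠ 1 → ∀ x ∈ ball z r, g.1 x ∉ ball z r := by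
  have hz' := mem_ball_zero_iff.1 hz
  set ρ := (1 + ‖z‖) / 2 with hρ
  have hρ1 : ρ < 1 := by linarith
  have hfin := hG.finite_setOf_norm_le hρ1
  have h1 : ∀ g ∈ {g : G | ∃ x : V, ‖x‖ ≤ ρ ∧ ‖g.1 x‖ ≤ ρ}, ∀ᶠ s in 𝓝[>] (0 : ℝ),
      g ≠ 1 → ∀ x ∈ ball z s, g.1 x ∉ ball z s := by
    intro g _
    by_cases hg : g = 1
    · simp [hg]
    have hgz : 0 < dist (g.1 z) z := dist_pos.2 fun h => hg (hG.eq_one g z hz h)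
    have hc := Metric.continuousAt_iff.1 (hG.differentiableAt g hz).continuousAt _
      (half_pos hgz)
    obtain ⟨δ, hδ, hc⟩ := hc
    filter_upwards [Ioo_mem_nhdsGT (lt_min hδ (half_pos hgz))] with s hs _ x hx hgx
    have h2 := hc ((mem_ball.1 hx).trans (hs.2.trans_le (min_le_left _ _)))
    have h3 := (mem_ball.1 hgx).trans (hs.2.trans_le (min_le_right _ _))
    have := dist_triangle_left (g.1 z) z (g.1 x)
    linarith
  have h2 : ∀ᶠ s in 𝓝[>] (0 : ℝ), s < (1 - ‖z‖) / 2 :=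
    eventually_nhdsWithin_of_eventually_nhds (eventually_lt_nhds (by linarith))
  obtain ⟨s, ⟨hs1, hs2⟩, hs0⟩ := (((hfin.eventually_all).2 h1).and h2).and
    self_mem_nhdsWithin |>.exists
  have hle : ∀ x ∈ closedBall z s, ‖x‖ ≤ ρ := fun x hx => by
    have := norm_le_norm_add_norm_sub' x z
    rw [mem_closedBall_iff_norm] at hx
    linarith
  refine ⟨s, hs0, fun x hx => mem_ball_zero_iff.2 ((hle x hx).trans_lt hρ1),
    fun g hg x hx hgx => ?_⟩
  exact hs1 g ⟨x, hle x (ball_subset_closedBall hx), hle _ (ball_subset_closedBall hgx)⟩ hg x hx hgx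

theorem exists_fundamentalDomain [MeasurableSpace V] [BorelSpace V] :
    ∃ D : Set V, MeasurableSet D ∧ D ⊆ ball 0 1 ∧ (∀ z ∈ ball (0 : V) 1, ∃ g : G, g.1 z ∈ D) ∧
      ∀ z ∈ D, ∀ g : G, g.1 z ∈ D → g = 1 := by
  have := hG.countable
  choose! r hr0 hrB hr using fun z (hz : z ∈ ball (0 : V) 1) => hG.exists_ball_disjoint hz
  obtain ⟨t, htB, htc, ht⟩ := TopologicalSpace.countable_cover_nhdsWithin
    (f := fun z => ball z (r z)) fun z (hz : z ∈ ball (0 : V) 1) =>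
      mem_nhdsWithin_of_mem_nhds (ball_mem_nhds z (hr0 z hz))
  have htn : t.Nonempty := by
    obtain ⟨x, hx, -⟩ := mem_iUnion₂.1 (ht (mem_ball_self one_pos))
    exact ⟨x, hx⟩
  obtain ⟨z, rfl⟩ := htc.exists_eq_range htn
  have hzB : ∀ k, z k ∈ ball (0 : V) 1 := fun k => htB ⟨k, rfl⟩
  set W : ℕ → Set V := fun k => ball (z k) (r (z k)) with hW
  have hWB : ∀ k, W k ⊆ ball 0 1 := fun k => ball_subset_closedBall.trans (hrB _ (hzB k))
  have hcov : ∀ x ∈ ball (0 : V) 1, ∃ k, x ∈ W k := fun x hx => by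
    simpa [hW] using ht hx
  refine ⟨⋃ k, W k \ ⋃ j : Fin k, ⋃ g : G, g.1 '' W j, ?_, ?_, ?_, ?_⟩
  · refine .iUnion fun k => isOpen_ball.measurableSet.diff ?_
    exact .iUnion fun j => .iUnion fun g => (hG.isOpen_image g (hWB j) isOpen_ball).measurableSet
  · exact iUnion_subset fun k => sdiff_subset.trans (hWB k)
  · intro x hx
    have hex : ∃ k, ∃ g : G, g.1 x ∈ W k := by
      obtain ⟨k, hk⟩ := hcov x hx
      exact ⟨k, 1, hk⟩
    classical
    obtain ⟨g, hg⟩ := Nat.find_spec hex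
    refine ⟨g, mem_iUnion.2 ⟨Nat.find hex, hg, ?_⟩⟩
    simp only [mem_iUnion, not_exists]
    rintro j h ⟨y, hy, hyx⟩
    refine Nat.find_min hex j.2 ⟨h⁻¹ * g, ?_⟩
    have : (h⁻¹ * g).1 x = y := by simp [← hyx]
    rwa [this]
  · intro x hx g hgx
    obtain ⟨k, hk, hk'⟩ := mem_iUnion.1 hx
    obtain ⟨l, hl, hl'⟩ := mem_iUnion.1 hgx
    simp only [mem_iUnion, not_exists] at hk' hl'
    rcases lt_trichotomy k l with h | rfl | h
    · exact (hl' ⟨k, h⟩ g ⟨x, hk, rfl⟩).elim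
    · by_contra hg
      exact hr _ (hzB k) g hg x hk hl
    · exact (hk' ⟨l, h⟩ g⁻¹ ⟨g.1 x, hl, by simp⟩).elim

end IsBallGroup

end

section

/-- `D` is an exact measurable fundamental domain for the action of `G` on the unit ball. -/
structure IsBallFundamentalDomain {V : Type*} [NormedAddCommGroup V] [InnerProductSpace ℂ V]
    [MeasurableSpace V] (G : Subgroup (Equiv.Perm V)) (D : Set V) : Prop where
  measurableSet : MeasurableSet D
  subset_ball : D ⊆ ball 0 1
  exists_mem : ∀ z ∈ ball (0 : V) 1, ∃ g : G, g.1 z ∈ D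
  eq_one : ∀ z ∈ D, ∀ g : G, g.1 z ∈ D → g = 1

variable {V : Type*} [NormedAddCommGroup V] [InnerProductSpace ℂ V] [MeasurableSpace V]
  {G : Subgroup (Equiv.Perm V)} {D : Set V}

theorem IsBallFundamentalDomain.iUnion_image (hD : IsBallFundamentalDomain G D)
    (hG : IsBallGroup G) : ⋃ g : G, g.1 '' D = ball (0 : V) 1 := by
  refine Subset.antisymm (iUnion_subset fun g => ?_) fun x hx => ?_
  · rintro _ ⟨x, hx, rfl⟩
    exact hG.mapsTo g (hD.subset_ball hx)
  · obtain ⟨g, hg⟩ := hD.exists_mem x hx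
    exact mem_iUnion.2 ⟨g⁻¹, _, hg, by simp⟩

theorem IsBallFundamentalDomain.pairwise_disjoint (hD : IsBallFundamentalDomain G D) :
    Pairwise (Function.onFun Disjoint fun g : G => g.1 '' D) := by
  intro g h hgh
  rw [Function.onFun, Set.disjoint_left]
  rintro _ ⟨x, hx, rfl⟩ ⟨y, hy, hxy⟩
  have h1 := hD.eq_one y hy (g⁻¹ * h) (by simpa [hxy] using hx)
  exact hgh (inv_mul_eq_one.1 h1)

variable [BorelSpace V]

theorem IsBallGroup.measurableSet_image (hG : IsBallGroup G) (g : G) {s : Set V}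
    (hs : MeasurableSet s) (hsB : s ⊆ ball 0 1) : MeasurableSet (g.1 '' s) := by
  rw [hG.image_eq g hsB]
  have h : MeasurableSet (Subtype.val '' ((ball (0 : V) 1).domRestrict g⁻¹.1 ⁻¹' s)) :=
    isOpen_ball.measurableSet.subtype_image
      ((continuousOn_iff_continuous_domRestrict.1 (hG.differentiableOn g⁻¹).continuousOn).measurable hs)
  convert h using 1
  ext x
  simp [Set.domRestrict_apply, and_comm]

variable [FiniteDimensional ℂ V] (μ : Measure V) [μ.IsAddHaarMeasure]

theorem IsBallGroup.lintegral_image (hG : IsBallGroup G) (g : G) {s : Set V}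
    (hs : MeasurableSet s) (hsB : s ⊆ ball 0 1) (f : V → ENNReal) :
    ∫⁻ x in g.1 '' s, f x ∂μ = ∫⁻ x in s, f (g.1 x) * ‖jacDet g.1 x‖ₑ ^ 2 ∂μ := by
  rw [lintegral_image_eq_lintegral_abs_det_fderiv_mul μ hs
    (f' := fun x => (fderiv ℂ g.1 x).restrictScalars ℝ) (fun x hx =>
      (((hG.differentiableAt g (hsB hx)).hasFDerivAt).restrictScalars ℝ).hasFDerivWithinAt)
    g.1.injective.injOn]
  refine lintegral_congr fun x => ?_
  rw [show ((fderiv ℂ g.1 x).restrictScalars ℝ).det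
    = LinearMap.det ((fderiv ℂ g.1 x : V →ₗ[ℂ] V).restrictScalars ℝ) from rfl,
    abs_det_restrictScalars, mul_comm, ← ofReal_norm, ENNReal.ofReal_pow (norm_nonneg _)]
  rfl

theorem IsBallFundamentalDomain.lintegral_ball (hD : IsBallFundamentalDomain G D)
    (hG : IsBallGroup G) (f : V → ENNReal) :
    ∫⁻ x in ball (0 : V) 1, f x ∂μ
      = ∑' g : G, ∫⁻ x in D, f (g.1 x) * ‖jacDet g.1 x‖ₑ ^ 2 ∂μ := by
  have := hG.countable
  rw [← hD.iUnion_image hG, lintegral_iUnion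
    (fun g => hG.measurableSet_image g hD.measurableSet hD.subset_ball) hD.pairwise_disjoint]
  exact tsum_congr fun g => hG.lintegral_image μ g hD.measurableSet hD.subset_ball f

omit [FiniteDimensional ℂ V] [μ.IsAddHaarMeasure] in
theorem IsBallGroup.aemeasurable_enorm_comp (hG : IsBallGroup G) {s : Set V}
    (hs : MeasurableSet s) (hsB : s ⊆ ball 0 1) {ψ : V → ℂ}
    (hψ : ContinuousOn ψ (ball 0 1)) (g : G) :
    AEMeasurable (fun x => ‖ψ (g.1 x)‖ₑ) (μ.restrict s) :=
  ((hψ.comp (hG.differentiableOn g).continuousOn (hG.mapsTo g)).mono hsB).aemeasurable hs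
    |>.enorm

omit [μ.IsAddHaarMeasure] in
theorem IsBallGroup.aemeasurable_enorm_jacDet (hG : IsBallGroup G) {s : Set V}
    (hs : MeasurableSet s) (hsB : s ⊆ ball 0 1) (g : G) :
    AEMeasurable (fun x => ‖jacDet g.1 x‖ₑ) (μ.restrict s) :=
  ((hG.continuousOn_jacDet g).mono hsB).aemeasurable hs |>.enorm

theorem IsBallFundamentalDomain.lintegral_sq_tsum_enorm (hD : IsBallFundamentalDomain G D)
    (hG : IsBallGroup G) {ψ : V → ℂ} (hψ : ContinuousOn ψ (ball 0 1)) :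
    ∫⁻ x in D, (∑' g : G, ‖ψ (g.1 x)‖ₑ * ‖jacDet g.1 x‖ₑ) ^ 2 ∂μ
      = ∑' g : G, ∫⁻ x in ball (0 : V) 1, ‖ψ (g.1 x)‖ₑ * ‖jacDet g.1 x‖ₑ * ‖ψ x‖ₑ ∂μ := by
  have := hG.countable
  have h1 : ∀ x ∈ D, (∑' g : G, ‖ψ (g.1 x)‖ₑ * ‖jacDet g.1 x‖ₑ) ^ 2
      = ∑' g : G, ∑' h : G, ‖ψ (g.1 (h.1 x))‖ₑ * ‖jacDet g.1 (h.1 x)‖ₑ * ‖ψ (h.1 x)‖ₑ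
        * ‖jacDet h.1 x‖ₑ ^ 2 := by
    intro x hx
    have hxB := hD.subset_ball hx
    rw [ENNReal.tsum_comm, sq, ← ENNReal.tsum_mul_left]
    refine tsum_congr fun h => ?_
    rw [← ENNReal.tsum_mul_right, ← (Equiv.mulRight h).tsum_eq]
    refine tsum_congr fun g => ?_
    rw [Equiv.coe_mulRight, hG.jacDet_mul g h hxB, enorm_mul]
    simp only [Subgroup.coe_mul, Equiv.Perm.mul_apply]
    ring
  rw [setLIntegral_congr_fun hD.measurableSet h1, lintegral_tsum]
  · refine tsum_congr fun g => ?_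
    rw [hD.lintegral_ball μ hG, lintegral_tsum]
    intro h
    exact (((hG.aemeasurable_enorm_comp μ hD.measurableSet hD.subset_ball
      (hψ.comp (hG.differentiableOn g).continuousOn (hG.mapsTo g)) h).mul
      (by exact (((hG.continuousOn_jacDet g).comp (hG.differentiableOn h).continuousOn
        (hG.mapsTo h)).mono hD.subset_ball).aemeasurable hD.measurableSet |>.enorm)).mul
      (hG.aemeasurable_enorm_comp μ hD.measurableSet hD.subset_ball hψ h)).mul
      ((hG.aemeasurable_enorm_jacDet μ hD.measurableSet hD.subset_ball h).pow_const 2)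
  · intro g
    refine AEMeasurable.tsum fun h => ?_
    exact (((hG.aemeasurable_enorm_comp μ hD.measurableSet hD.subset_ball
      (hψ.comp (hG.differentiableOn g).continuousOn (hG.mapsTo g)) h).mul
      (by exact (((hG.continuousOn_jacDet g).comp (hG.differentiableOn h).continuousOn
        (hG.mapsTo h)).mono hD.subset_ball).aemeasurable hD.measurableSet |>.enorm)).mul
      (hG.aemeasurable_enorm_comp μ hD.measurableSet hD.subset_ball hψ h)).mul
      ((hG.aemeasurable_enorm_jacDet μ hD.measurableSet hD.subset_ball h).pow_const 2)

end

section LogNormSq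

variable {L : Type*} [NormedAddCommGroup L] [InnerProductSpace ℂ L]

theorem hasDerivAt_norm_sq_complex {c : ℝ → L} {c' : L} {t : ℝ} (h : HasDerivAt c c' t) :
    HasDerivAt (fun s => ‖c s‖ ^ 2) (2 * (inner ℂ (c t) c' : ℂ).re) t := by
  let : InnerProductSpace ℝ L := InnerProductSpace.rclikeToReal ℂ L
  have := h.norm_sq
  simpa [real_inner_eq_re_inner ℂ] using this

theorem hasDerivAt_re_inner_complex {c d : ℝ → L} {c' d' : L} {t : ℝ} (h : HasDerivAt c c' t)
    (h' : HasDerivAt d d' t) :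
    HasDerivAt (fun s => (inner ℂ (c s) (d s) : ℂ).re)
      ((inner ℂ (c t) d' : ℂ).re + (inner ℂ c' (d t) : ℂ).re) t := by
  have := (Complex.reCLM.hasFDerivAt.comp_hasDerivAt t (h.inner ℂ h'))
  simpa [Function.comp_def] using this

theorem deriv_deriv_log_norm_sq {c c' : ℝ → L} {c'' : L}
    (h : ∀ᶠ t in 𝓝 (0 : ℝ), HasDerivAt c (c' t) t) (h' : HasDerivAt c' c'' 0) (h0 : c 0 ≠ 0) :
    deriv (deriv fun t => Real.log (‖c t‖ ^ 2)) 0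
      = (2 * ((inner ℂ (c 0) c'' : ℂ).re + ‖c' 0‖ ^ 2)) / ‖c 0‖ ^ 2
        - (2 * (inner ℂ (c 0) (c' 0) : ℂ).re) ^ 2 / (‖c 0‖ ^ 2) ^ 2 := by
  have hne : ∀ᶠ t in 𝓝 (0 : ℝ), c t ≠ 0 :=
    (h.self_of_nhds).continuousAt.eventually_ne h0
  have e : deriv (fun t => Real.log (‖c t‖ ^ 2))
      =ᶠ[𝓝 0] fun t => (2 * (inner ℂ (c t) (c' t) : ℂ).re) / ‖c t‖ ^ 2 := by
    filter_upwards [h, hne] with t ht htn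
    exact ((hasDerivAt_norm_sq_complex ht).log (pow_ne_zero 2 (norm_ne_zero_iff.2 htn))).deriv
  rw [e.deriv_eq]
  have hn : ‖c 0‖ ≠ 0 := norm_ne_zero_iff.2 h0
  have h1 := ((hasDerivAt_re_inner_complex h.self_of_nhds h').const_mul 2).div
    (hasDerivAt_norm_sq_complex h.self_of_nhds) (pow_ne_zero 2 hn)
  have h2 : deriv (fun t => (2 * (inner ℂ (c t) (c' t) : ℂ).re) / ‖c t‖ ^ 2) 0 = _ := h1.deriv
  rw [h2]
  have h3 : (inner ℂ (c' 0) (c' 0) : ℂ).re = ‖c' 0‖ ^ 2 := by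
    rw [inner_self_eq_norm_sq_to_K]
    norm_cast
  rw [h3]
  field_simp

theorem laplacian_log_norm_sq {Λ : ℂ → L} {Λ' : ℂ → L} {Λ'' : L}
    (h : ∀ᶠ t in 𝓝 (0 : ℂ), HasDerivAt Λ (Λ' t) t) (h' : HasDerivAt Λ' Λ'' 0) (h0 : Λ 0 ≠ 0) :
    deriv (deriv fun t : ℝ => Real.log (‖Λ t‖ ^ 2)) 0
      + deriv (deriv fun t : ℝ => Real.log (‖Λ (-(t * Complex.I))‖ ^ 2)) 0
      = 4 * ((‖Λ 0‖ * ‖Λ' 0‖) ^ 2 - ‖(inner ℂ (Λ 0) (Λ' 0) : ℂ)‖ ^ 2) / (‖Λ 0‖ ^ 2) ^ 2 := by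
  have hline : ∀ a : ℂ, ∀ F : ℂ → L, ∀ F' : L, ∀ t : ℝ, HasDerivAt F F' (a * t) →
      HasDerivAt (fun s : ℝ => F (a * s)) (a • F') t := by
    intro a F F' t hF
    have h2 : HasDerivAt (fun s : ℝ => a * (s : ℂ)) a t := by
      simpa using (Complex.ofRealCLM.hasDerivAt (x := t)).const_mul a
    exact hF.scomp t h2
  have key : ∀ a : ℂ, deriv (deriv fun t : ℝ => Real.log (‖Λ (a * t)‖ ^ 2)) 0
      = (2 * ((inner ℂ (Λ 0) (a • a • Λ'') : ℂ).re + ‖a • Λ' 0‖ ^ 2)) / ‖Λ 0‖ ^ 2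
        - (2 * (inner ℂ (Λ 0) (a • Λ' 0) : ℂ).re) ^ 2 / (‖Λ 0‖ ^ 2) ^ 2 := by
    intro a
    have ht : Tendsto (fun t : ℝ => a * (t : ℂ)) (𝓝 0) (𝓝 0) :=
      (show Continuous fun t : ℝ => a * (t : ℂ) by fun_prop).tendsto' 0 0 (by simp)
    have := deriv_deriv_log_norm_sq (c := fun t : ℝ => Λ (a * t)) (c' := fun t => a • Λ' (a * t))
      (c'' := a • a • Λ'')
      (by filter_upwards [ht.eventually h] with t ht using hline a Λ _ t ht)
      ((hline a Λ' Λ'' 0 (by simpa using h')).const_smul a) (by simpa using h0)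
    simpa using this
  have k1 := key 1
  have k2 := key (-Complex.I)
  simp only [one_mul, one_smul] at k1
  have e : (fun t : ℝ => Real.log (‖Λ (-(t * Complex.I))‖ ^ 2))
      = fun t : ℝ => Real.log (‖Λ (-Complex.I * t)‖ ^ 2) := by
    ext t
    congr 4
    ring
  rw [e, k1, k2]
  have hn : ‖Λ 0‖ ≠ 0 := norm_ne_zero_iff.2 h0
  have e1 : (inner ℂ (Λ 0) ((-Complex.I) • (-Complex.I) • Λ'') : ℂ) = - inner ℂ (Λ 0) Λ'' := by
    rw [smul_smul, inner_smul_right]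
    simp
  have e2 : ‖(-Complex.I) • Λ' 0‖ = ‖Λ' 0‖ := by simp [norm_smul]
  rw [e1, e2, inner_smul_right]
  set p : ℂ := inner ℂ (Λ 0) (Λ' 0)
  have e3 : ‖p‖ ^ 2 = p.re ^ 2 + p.im ^ 2 := by
    rw [Complex.sq_norm, Complex.normSq_apply]
    ring
  rw [e3]
  simp only [neg_mul, Complex.neg_re, Complex.mul_re, Complex.I_re, Complex.I_im, zero_mul, one_mul]
  field_simp
  ring

end LogNormSq

section Representer

variable {L M : Type*} [NormedAddCommGroup L] [InnerProductSpace ℂ L] [AddCommGroup M] [Module ℂ M]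

theorem norm_le_of_mem_closure_range (ι : M →ₗ[ℂ] L) {R : L}
    (hR : R ∈ (LinearMap.range ι).topologicalClosure) {C : ℝ} (hC : 0 ≤ C)
    (h : ∀ f, ‖(inner ℂ R (ι f) : ℂ)‖ ≤ C * ‖ι f‖) : ‖R‖ ≤ C := by
  have hcl : ∀ y ∈ closure (LinearMap.range ι : Set L), ‖(inner ℂ R y : ℂ)‖ ≤ C * ‖y‖ := by
    intro y hy
    refine closure_minimal (s := (LinearMap.range ι : Set L))
      (t := {y | ‖(inner ℂ R y : ℂ)‖ ≤ C * ‖y‖}) ?_ ?_ hy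
    · rintro _ ⟨f, rfl⟩
      exact h f
    · exact isClosed_le (by fun_prop) (by fun_prop)
  have h1 := hcl R hR
  rw [inner_self_eq_norm_sq_to_K, ← RCLike.ofReal_pow, RCLike.norm_ofReal,
    abs_of_nonneg (by positivity), sq] at h1
  rcases (norm_nonneg R).eq_or_lt with h0 | h0
  · rwa [← h0]
  · exact le_of_mul_le_mul_right h1 h0

variable [CompleteSpace L]

theorem exists_representer (ι : M →ₗ[ℂ] L) (l : M →ₗ[ℂ] ℂ) {C : ℝ} (h : ∀ f, ‖l f‖ ≤ C * ‖ι f‖) :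
    ∃ R ∈ (LinearMap.range ι).topologicalClosure, ∀ f, (inner ℂ R (ι f) : ℂ) = l f := by
  obtain ⟨s, hs⟩ := ι.rangeRestrict.exists_rightInverse_of_surjective ι.range_rangeRestrict
  have hs' : ∀ y, ι (s y) = y := fun y => congrArg Subtype.val (LinearMap.congr_fun hs y)
  have hl : ∀ f, l (s (ι.rangeRestrict f)) = l f := by
    intro f
    have h1 := h (s (ι.rangeRestrict f) - f)
    rw [map_sub ι, hs', show (ι.rangeRestrict f : L) = ι f from rfl, sub_self, norm_zero,
      mul_zero] at h1
    rw [← sub_eq_zero, ← map_sub]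
    exact norm_le_zero_iff.1 h1
  let φ : LinearMap.range ι →L[ℂ] ℂ := (l ∘ₗ s).mkContinuous C fun y => by
    have := h (s y)
    rwa [hs'] at this
  obtain ⟨ψ, hψ, -⟩ := exists_extension_norm_eq (LinearMap.range ι) φ
  set K := (LinearMap.range ι).topologicalClosure with hK
  have : CompleteSpace K := (Submodule.isClosed_topologicalClosure _).completeSpace_coe
  refine ⟨K.starProjection ((InnerProductSpace.toDual ℂ L).symm ψ), ?_, fun f => ?_⟩
  · exact Submodule.starProjection_apply_mem _ _
  · have hf : ι f ∈ K := Submodule.le_topologicalClosure _ ⟨f, rfl⟩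
    rw [Submodule.inner_starProjection_left_eq_right, Submodule.starProjection_eq_self_iff.2 hf,
      InnerProductSpace.toDual_symm_apply]
    exact (hψ (ι.rangeRestrict f)).trans (hl f)

omit [CompleteSpace L] in
theorem sSup_sq_norm_inner_eq (ι : M →ₗ[ℂ] L) {R : L}
    (hR : R ∈ (LinearMap.range ι).topologicalClosure) :
    sSup {t : ℝ | ∃ f, ‖ι f‖ ≤ 1 ∧ t = ‖(inner ℂ R (ι f) : ℂ)‖ ^ 2} = ‖R‖ ^ 2 := by
  set A := {t : ℝ | ∃ f, ‖ι f‖ ≤ 1 ∧ t = ‖(inner ℂ R (ι f) : ℂ)‖ ^ 2} with hA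
  have hub : ∀ t ∈ A, t ≤ ‖R‖ ^ 2 := by
    rintro t ⟨f, hf, rfl⟩
    gcongr
    exact (norm_inner_le_norm _ _).trans (mul_le_of_le_one_right (norm_nonneg _) hf)
  have hbdd : BddAbove A := ⟨_, hub⟩
  have hne : A.Nonempty := ⟨0, 0, by simp⟩
  refine le_antisymm (csSup_le hne hub) ?_
  have h0 : 0 ≤ sSup A := le_csSup hbdd ⟨0, by simp⟩
  have h1 : ‖R‖ ≤ √(sSup A) := by
    refine norm_le_of_mem_closure_range ι hR (Real.sqrt_nonneg _) fun f => ?_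
    rcases eq_or_ne (ι f) 0 with hf | hf
    · simp [hf]
    have hf' : 0 < ‖ι f‖ := norm_pos_iff.2 hf
    have h2 : ‖(inner ℂ R (ι ((‖ι f‖⁻¹ : ℂ) • f)) : ℂ)‖ ^ 2 ≤ sSup A :=
      le_csSup hbdd ⟨_, by simp [norm_smul, hf'.ne'], rfl⟩
    rw [map_smul, inner_smul_right, norm_mul, norm_inv, Complex.norm_real, norm_norm] at h2
    have h3 := Real.le_sqrt_of_sq_le h2
    rwa [inv_mul_le_iff₀ hf', mul_comm] at h3
  calc ‖R‖ ^ 2 ≤ √(sSup A) ^ 2 := by gcongr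
    _ = _ := Real.sq_sqrt h0

end Representer

section Kernel

variable {V L : Type*} [NormedAddCommGroup V] [NormedSpace ℂ V] [NormedAddCommGroup L]
  [InnerProductSpace ℂ L] [CompleteSpace L] {Ω : Set V} {S : Submodule ℂ (V → ℂ)}

/-- The derivative at a point in a given direction, as a linear functional on a space of
holomorphic functions. -/
def derivAtLinear (hΩ : IsOpen Ω) (hd : ∀ f : S, DifferentiableOn ℂ f.1 Ω) {z : V} (hz : z ∈ Ω)
    (v : V) : S →ₗ[ℂ] ℂ where
  toFun f := fderiv ℂ f.1 z v
  map_add' f g := by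
    have hf := (hd f).differentiableAt (hΩ.mem_nhds hz)
    have hg := (hd g).differentiableAt (hΩ.mem_nhds hz)
    rw [Submodule.coe_add, fderiv_add hf hg, _root_.add_apply]
  map_smul' c f := by
    have hf := (hd f).differentiableAt (hΩ.mem_nhds hz)
    rw [Submodule.coe_smul, fderiv_const_smul hf, _root_.smul_apply, RingHom.id_apply]

theorem exists_antiholomorphic_representer (hΩ : IsOpen Ω) (ι : S →ₗ[ℂ] L)
    (hd : ∀ f : S, DifferentiableOn ℂ f.1 Ω)
    (hb : ∀ z ∈ Ω, ∃ r > 0, ∃ C ≥ 0, ball z r ⊆ Ω ∧ ∀ f : S, ∀ x ∈ ball z r, ‖f.1 x‖ ≤ C * ‖ι f‖) :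
    ∃ k : V → L, (∀ z ∈ Ω, k z ∈ (LinearMap.range ι).topologicalClosure) ∧
      (∀ z ∈ Ω, ∀ f : S, (inner ℂ (k z) (ι f) : ℂ) = f.1 z) ∧
      ∀ z ∈ Ω, ∀ v : V, ∃ D : L, (∀ f : S, (inner ℂ D (ι f) : ℂ) = fderiv ℂ f.1 z v) ∧
        HasDerivAt (fun t : ℂ => k (z + (starRingEnd ℂ t) • v)) D 0 := by
  have hk : ∀ z, ∃ R : L, z ∈ Ω → R ∈ (LinearMap.range ι).topologicalClosure ∧
      ∀ f : S, (inner ℂ R (ι f) : ℂ) = f.1 z := by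
    intro z
    by_cases hz : z ∈ Ω
    · obtain ⟨r, hr, C, hC, -, hfC⟩ := hb z hz
      obtain ⟨R, hR, h⟩ := exists_representer ι ((LinearMap.proj z : (V → ℂ) →ₗ[ℂ] ℂ) ∘ₗ S.subtype)
        (C := C) fun f => hfC f z (mem_ball_self hr)
      exact ⟨R, fun _ => ⟨hR, h⟩⟩
    · exact ⟨0, fun h => absurd h hz⟩
  choose k hk using hk
  refine ⟨k, fun z hz => (hk z hz).1, fun z hz => (hk z hz).2, fun z hz v => ?_⟩
  obtain ⟨r, hr, C, hC, hrΩ, hfC⟩ := hb z hz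
  obtain ⟨D, hDm, hD⟩ := exists_representer ι (derivAtLinear hΩ hd hz v) (C := 2 * C / r * ‖v‖) (by
    intro f
    have h1 := norm_fderiv_le_of_norm_le hr ((hd f).mono hrΩ) (hfC f)
    refine ((fderiv ℂ f.1 z).le_of_opNorm_le h1 v).trans_eq ?_
    ring)
  refine ⟨D, hD, ?_⟩
  rw [hasDerivAt_iff_isLittleO]
  have hsmall : ∀ᶠ t : ℂ in 𝓝 0, z + (starRingEnd ℂ t) • v ∈ ball z r := by
    have : Continuous fun t : ℂ => z + (starRingEnd ℂ t) • v := by fun_prop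
    refine this.continuousAt.eventually_mem (isOpen_ball.mem_nhds ?_)
    simpa using hr
  have hO : (fun t : ℂ => k (z + (starRingEnd ℂ t) • v) - k (z + (starRingEnd ℂ 0) • v)
      - (t - 0) • D) =O[𝓝 0] fun t => ‖t - 0‖ ^ 2 := by
    refine Asymptotics.IsBigO.of_bound (4 * C * (‖v‖ / r) ^ 2) ?_
    filter_upwards [hsmall] with t ht
    rw [norm_pow, norm_norm, map_zero, zero_smul, add_zero, sub_zero]
    refine norm_le_of_mem_closure_range ι ?_ (by positivity) fun f => ?_
    · exact Submodule.sub_mem _ (Submodule.sub_mem _ (hk _ (hrΩ ht)).1 (hk _ hz).1)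
        (Submodule.smul_mem _ _ hDm)
    · rw [inner_sub_left, inner_sub_left, inner_smul_left, (hk _ (hrΩ ht)).2, (hk _ hz).2, hD]
      have h2 := norm_sub_sub_fderiv_le hr ((hd f).mono hrΩ) (hfC f) ht
      rw [add_sub_cancel_left, map_smul, smul_eq_mul, norm_smul, RCLike.norm_conj] at h2
      refine h2.trans_eq ?_
      ring
  refine hO.trans_isLittleO ?_
  simpa using Asymptotics.isLittleO_norm_pow_id (E' := ℂ) one_lt_two

end Kernel

section

variable {V L : Type*} [NormedAddCommGroup V] [NormedSpace ℂ V] [NormedAddCommGroup L]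
  [InnerProductSpace ℂ L] [CompleteSpace L] {Ω : Set V} {S : Submodule ℂ (V → ℂ)}

theorem bergman_lineLaplacian_pos (hΩ : IsOpen Ω) (ι : S →ₗ[ℂ] L)
    (hd : ∀ f : S, DifferentiableOn ℂ f.1 Ω)
    (hb : ∀ z ∈ Ω, ∃ r > 0, ∃ C ≥ 0, ball z r ⊆ Ω ∧ ∀ f : S, ∀ x ∈ ball z r, ‖f.1 x‖ ≤ C * ‖ι f‖)
    {K : V → ℝ} (hK : ∀ x ∈ Ω, K x = sSup {t | ∃ f : S, ‖ι f‖ ≤ 1 ∧ t = ‖f.1 x‖ ^ 2})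
    {z : V} (hz : z ∈ Ω) (h0 : ∃ f : S, f.1 z ≠ 0) :
    0 < K z ∧ ∀ v : V, (∀ α : ℂ, ∃ f : S, fderiv ℂ f.1 z v ≠ α * f.1 z) →
      0 < lineLaplacian (fun x => Real.log (K x)) z v := by
  obtain ⟨k, hkm, hk, hkd⟩ := exists_antiholomorphic_representer hΩ ι hd hb
  have hKk : ∀ x ∈ Ω, K x = ‖k x‖ ^ 2 := fun x hx => by
    rw [hK x hx, ← sSup_sq_norm_inner_eq ι (hkm x hx)]
    simp only [hk x hx]
  have hkz : k z ≠ 0 := by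
    obtain ⟨f, hf⟩ := h0
    intro h
    rw [← hk z hz, h, inner_zero_left] at hf
    exact hf rfl
  refine ⟨by rw [hKk z hz]; exact pow_pos (norm_pos_iff.2 hkz) 2, fun v h1 => ?_⟩
  set Λ : ℂ → L := fun t => k (z + (starRingEnd ℂ t) • v) with hΛ
  have hcont : Continuous fun t : ℂ => z + (starRingEnd ℂ t) • v := by fun_prop
  set U : Set ℂ := (fun t : ℂ => z + (starRingEnd ℂ t) • v) ⁻¹' Ω with hU
  have hUo : IsOpen U := hΩ.preimage hcont
  have hU0 : U ∈ 𝓝 (0 : ℂ) := hUo.mem_nhds (by simpa [hU] using hz)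
  have hΛd : DifferentiableOn ℂ Λ U := by
    intro t ht
    obtain ⟨D, -, hD⟩ := hkd _ ht v
    have h2 : HasDerivAt (fun s => k (z + (starRingEnd ℂ t) • v + (starRingEnd ℂ (s - t)) • v)) D t :=
      HasDerivAt.comp_sub_const t t (by simpa using hD)
    have e : (fun s => k (z + (starRingEnd ℂ t) • v + (starRingEnd ℂ (s - t)) • v)) = Λ := by
      ext s
      rw [hΛ, map_sub, sub_smul]
      congr 1
      abel
    rw [e] at h2
    exact h2.differentiableAt.differentiableWithinAt
  obtain ⟨D, hDf, hD⟩ := hkd z hz v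
  have hΛ0 : Λ 0 = k z := by simp [hΛ]
  have hΛ'0 : deriv Λ 0 = D := hD.deriv
  have hlap := laplacian_log_norm_sq (Λ := Λ) (Λ' := deriv Λ) (Λ'' := deriv (deriv Λ) 0)
    (by filter_upwards [hUo.mem_nhds (mem_of_mem_nhds hU0)] with t ht
        exact (hΛd.differentiableAt (hUo.mem_nhds ht)).hasDerivAt)
    ((hΛd.deriv hUo).differentiableAt hU0).hasDerivAt (by rwa [hΛ0])
  have e1 : (fun t : ℝ => Real.log (K (z + (t : ℂ) • v)))
      =ᶠ[𝓝 0] fun t : ℝ => Real.log (‖Λ t‖ ^ 2) := by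
    have : Continuous fun t : ℝ => z + (t : ℂ) • v := by fun_prop
    filter_upwards [this.continuousAt.eventually_mem (hΩ.mem_nhds (by simpa using hz))] with t ht
    rw [hKk _ ht, hΛ]
    simp
  have e2 : (fun t : ℝ => Real.log (K (z + ((t : ℂ) * Complex.I) • v)))
      =ᶠ[𝓝 0] fun t : ℝ => Real.log (‖Λ (-(t * Complex.I))‖ ^ 2) := by
    have : Continuous fun t : ℝ => z + ((t : ℂ) * Complex.I) • v := by fun_prop
    filter_upwards [this.continuousAt.eventually_mem (hΩ.mem_nhds (by simpa using hz))] with t ht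
    rw [hKk _ ht, hΛ]
    simp
  rw [lineLaplacian, e1.deriv.deriv_eq, e2.deriv.deriv_eq, hlap, hΛ0, hΛ'0]
  have hn : 0 < ‖k z‖ := norm_pos_iff.2 hkz
  have hcs : ‖(inner ℂ (k z) D : ℂ)‖ < ‖k z‖ * ‖D‖ := by
    refine lt_of_le_of_ne (norm_inner_le_norm _ _) fun heq => ?_
    have h3 : ∃ c : ℂ, D = c • k z := by
      rcases eq_or_ne D 0 with rfl | hD0
      · exact ⟨0, by simp⟩
      · obtain ⟨c, -, hc⟩ := (norm_inner_eq_norm_iff hkz hD0).1 heq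
        exact ⟨c, hc⟩
    obtain ⟨c, hc⟩ := h3
    obtain ⟨f, hf⟩ := h1 (starRingEnd ℂ c)
    rw [← hDf, hc, inner_smul_left, hk z hz] at hf
    exact hf rfl
  have : ‖(inner ℂ (k z) D : ℂ)‖ ^ 2 < (‖k z‖ * ‖D‖) ^ 2 := by gcongr
  have h4 : 0 < (‖k z‖ * ‖D‖) ^ 2 - ‖(inner ℂ (k z) D : ℂ)‖ ^ 2 := by linarith
  positivity

end

section

theorem norm_tsum_sub_le_tsum_compl {ι E : Type*} [NormedAddCommGroup E] [CompleteSpace E]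
    {t : ι → E} {u : ι → ℝ} (hu : Summable u) (ht : ∀ i, ‖t i‖ ≤ u i) {i₀ : ι} {T : Finset ι}
    (hi₀ : i₀ ∈ T) (hT : ∀ i ∈ T, i ≠ i₀ → t i = 0) :
    ‖∑' i, t i - t i₀‖ ≤ ∑' i : {i // i ∉ T}, u i := by
  have hs : Summable t := .of_norm_bounded hu ht
  rw [← hs.sum_add_tsum_subtype_compl T, Finset.sum_eq_single_of_mem i₀ hi₀ hT, add_sub_cancel_left]
  exact tsum_of_norm_bounded (hu.subtype _).hasSum fun i => ht i

theorem Finset.one_sub_sum_one_sub_le_prod {ι : Type*} {a : ι → ℝ} (h0 : ∀ i, 0 ≤ a i)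
    (h1 : ∀ i, a i ≤ 1) (S : Finset ι) : 1 - ∑ i ∈ S, (1 - a i) ≤ ∏ i ∈ S, a i := by
  classical
  induction S using Finset.induction_on with
  | empty => simp
  | insert i S hi ih =>
    rw [Finset.sum_insert hi, Finset.prod_insert hi]
    have h2 : ∏ j ∈ S, a j ≤ 1 := Finset.prod_le_one (fun j _ => h0 j) fun j _ => h1 j
    nlinarith [h0 i, h1 i]

theorem exists_pos_le_finset_prod {ι : Type*} {a : ι → ℝ} (h0 : ∀ i, 0 < a i) (h1 : ∀ i, a i ≤ 1)
    (hs : Summable fun i => 1 - a i) : ∃ c > 0, ∀ S : Finset ι, c ≤ ∏ i ∈ S, a i := by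
  classical
  obtain ⟨T, hT⟩ := (hs.vanishing (Iio_mem_nhds (show (0 : ℝ) < 1 / 2 by norm_num)))
  have hp : ∀ S : Finset ι, 0 < ∏ i ∈ S, a i := fun S => Finset.prod_pos fun i _ => h0 i
  refine ⟨(∏ i ∈ T, a i) * (1 / 2), mul_pos (hp T) one_half_pos, fun S => ?_⟩
  rw [← Finset.prod_inter_mul_prod_sdiff S T]
  have h2 : ∏ i ∈ T, a i ≤ ∏ i ∈ S ∩ T, a i :=
    Finset.prod_le_prod_of_subset_of_le_one Finset.inter_subset_right
      (fun i _ => (h0 i).le) fun i _ _ => h1 i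
  have h3 : 1 / 2 ≤ ∏ i ∈ S \ T, a i := by
    have h4 := Finset.one_sub_sum_one_sub_le_prod (fun i => (h0 i).le) h1 (S \ T)
    have h5 : ∑ i ∈ S \ T, (1 - a i) < 1 / 2 := hT _ Finset.sdiff_disjoint
    linarith
  have := hp (S ∩ T)
  gcongr

variable {V : Type*} [NormedAddCommGroup V] [InnerProductSpace ℂ V]

/-- `f` is holomorphic on a ball strictly larger than the unit ball. -/
def HolomorphicNearBall (f : V → ℂ) : Prop :=
  ∃ R > 1, DifferentiableOn ℂ f (ball 0 R)

namespace HolomorphicNearBall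

variable {f g : V → ℂ}

theorem mul (hf : HolomorphicNearBall f) (hg : HolomorphicNearBall g) :
    HolomorphicNearBall fun x => f x * g x := by
  obtain ⟨R, hR, h⟩ := hf
  obtain ⟨R', hR', h'⟩ := hg
  exact ⟨min R R', lt_min hR hR', (h.mono (ball_subset_ball (min_le_left _ _))).mul
    (h'.mono (ball_subset_ball (min_le_right _ _)))⟩

theorem of_differentiable (hf : Differentiable ℂ f) : HolomorphicNearBall f :=
  ⟨2, one_lt_two, hf.differentiableOn⟩

theorem prod {ι : Type*} {b : ι → V → ℂ} (hb : ∀ i, HolomorphicNearBall (b i)) (S : Finset ι) :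
    HolomorphicNearBall fun x => ∏ i ∈ S, b i x := by
  classical
  induction S using Finset.induction_on with
  | empty => simpa using of_differentiable (differentiable_const (1 : ℂ))
  | insert i S hi ih =>
    simp only [Finset.prod_insert hi]
    exact (hb i).mul ih

theorem differentiableOn (hf : HolomorphicNearBall f) : DifferentiableOn ℂ f (ball 0 1) := by
  obtain ⟨R, hR, h⟩ := hf
  exact h.mono (ball_subset_ball hR.le)

theorem exists_bound [FiniteDimensional ℂ V] (hf : HolomorphicNearBall f) :
    ∃ M ≥ 0, ∀ x ∈ ball (0 : V) 1, ‖f x‖ ≤ M := by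
  obtain ⟨R, hR, h⟩ := hf
  have : ProperSpace V := FiniteDimensional.proper ℂ V
  obtain ⟨M, hM⟩ := (isCompact_closedBall (0 : V) 1).exists_bound_of_continuousOn
    (h.continuousOn.mono (closedBall_subset_ball hR))
  exact ⟨M, (norm_nonneg _).trans (hM 0 (by simp)), fun x hx => hM x (ball_subset_closedBall hx)⟩

end HolomorphicNearBall

theorem exists_blaschke_factor {w z : V} (hw : ‖w‖ < 1) (hz : ‖z‖ < 1) (hwz : w ≠ z) :
    ∃ b : V → ℂ, HolomorphicNearBall b ∧ (∀ x ∈ ball (0 : V) 1, ‖b x‖ ≤ 1) ∧ b w = 0 ∧ b z ≠ 0 ∧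
      1 - ‖b z‖ ^ 2 = (1 - ‖w‖ ^ 2) * (1 - ‖z‖ ^ 2) / ‖1 - inner ℂ w z‖ ^ 2 := by
  set p := ballInvolution w z with hp
  have hp0 : p ≠ 0 := by
    intro h
    have := ballInvolution_ballInvolution hw hz.le
    rw [← hp, h, ballInvolution_zero] at this
    exact hwz this
  have hp0' : 0 < ‖p‖ := norm_pos_iff.2 hp0
  have hbz : (inner ℂ p p : ℂ) / ‖p‖ = ‖p‖ := by
    rw [inner_self_eq_norm_sq_to_K]
    have : (‖p‖ : ℂ) ≠ 0 := by exact_mod_cast hp0'.ne'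
    simp only [Complex.coe_algebraMap]
    field_simp
  refine ⟨fun x => inner ℂ p (ballInvolution w x) / ‖p‖,
    ⟨2 / (1 + ‖w‖), ?_, fun x hx => ?_⟩, fun x hx => ?_, ?_, ?_, ?_⟩
  · rw [gt_iff_lt, one_lt_div (by positivity)]
    linarith
  · have h1 : (1 : ℂ) - inner ℂ w x ≠ 0 := by
      intro h
      have h2 := norm_inner_le_norm (𝕜 := ℂ) w x
      rw [← sub_eq_zero.1 h, norm_one] at h2
      rw [mem_ball_zero_iff, lt_div_iff₀ (by positivity)] at hx
      nlinarith [norm_nonneg w, norm_nonneg x]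
    have h2 : DifferentiableAt ℂ (fun x => (inner ℂ p (ballInvolution w x) : ℂ)) x :=
      (innerSL ℂ p).differentiableAt.comp x (differentiableAt_ballInvolution h1)
    simp only [div_eq_mul_inv]
    exact (h2.mul_const _).differentiableWithinAt
  · have h1 := norm_inner_le_norm (𝕜 := ℂ) p (ballInvolution w x)
    have h2 := norm_ballInvolution_le hw (mem_ball_zero_iff.1 hx).le
    rw [norm_div, Complex.norm_real, norm_norm, div_le_one hp0']
    exact h1.trans (mul_le_of_le_one_right hp0'.le h2)
  · simp [ballInvolution_self hw]
  · simp only [← hp, hbz]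
    exact_mod_cast hp0'.ne'
  · simp only [← hp, hbz]
    rw [Complex.norm_real, norm_norm, hp, one_sub_norm_sq_ballInvolution hw hz.le]

namespace IsBallGroup

variable [FiniteDimensional ℂ V] {G : Subgroup (Equiv.Perm V)} (hG : IsBallGroup G)
include hG

theorem exists_blaschke_product {z : V} (hz : z ∈ ball (0 : V) 1) :
    ∃ c > 0, ∀ S : Finset G, 1 ∉ S → ∃ q : V → ℂ, HolomorphicNearBall q ∧
      (∀ x ∈ ball (0 : V) 1, ‖q x‖ ≤ 1) ∧ c ≤ ‖q z‖ ∧ ∀ g ∈ S, HasFDerivAt q (0 : V →L[ℂ] ℂ) (g.1 z) ∧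
        q (g.1 z) = 0 := by
  classical
  have hz' := mem_ball_zero_iff.1 hz
  have hgz : ∀ g : G, ‖g.1 z‖ < 1 := fun g => mem_ball_zero_iff.1 (hG.mapsTo g hz)
  have hex : ∀ g : {g : G // g ≠ 1}, ∃ b : V → ℂ, HolomorphicNearBall b ∧
      (∀ x ∈ ball (0 : V) 1, ‖b x‖ ≤ 1) ∧ b (g.1.1 z) = 0 ∧ b z ≠ 0 ∧
      1 - ‖b z‖ ^ 2 = (1 - ‖g.1.1 z‖ ^ 2) * (1 - ‖z‖ ^ 2) / ‖1 - inner ℂ (g.1.1 z) z‖ ^ 2 :=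
    fun g => exists_blaschke_factor (hgz g) hz' fun h => g.2 (hG.eq_one _ z hz h)
  choose b hb hb1 hbg hbz hbe using hex
  obtain ⟨c, hc, hcS⟩ := exists_pos_le_finset_prod (a := fun g => ‖b g z‖ ^ 2)
    (fun g => pow_pos (norm_pos_iff.2 (hbz g)) 2)
    (fun g => pow_le_one₀ (norm_nonneg _) (hb1 g z hz)) (by
      have hsum := ((hG.summable.mul_left ((1 - ‖z‖) ^ 2)⁻¹).mul_left ((1 - ‖z‖) ^ 2)⁻¹)
      refine Summable.of_nonneg_of_le (fun g => ?_) (fun g => ?_)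
        (hsum.subtype {g : G | g ≠ 1})
      · rw [sub_nonneg]
        exact pow_le_one₀ (norm_nonneg _) (hb1 g z hz)
      · have h1 := (hG.isAutOn g.1).one_sub_norm_sq_le hz
        have h2 := one_sub_norm_le_norm_one_sub_inner (x := z) (hgz g.1).le
        have h3 : 0 < 1 - ‖z‖ := by linarith
        have h4 : 0 ≤ 1 - ‖g.1.1 z‖ ^ 2 := by nlinarith [hgz g.1, norm_nonneg (g.1.1 z)]
        rw [hbe, div_eq_inv_mul]
        simp only [Function.comp_apply]
        rw [div_eq_inv_mul] at h1
        refine mul_le_mul (by gcongr) ?_ (mul_nonneg h4 (by nlinarith [norm_nonneg z]))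
          (by positivity)
        exact (mul_le_of_le_one_right h4 (by nlinarith [norm_nonneg z])).trans h1)
  refine ⟨c, hc, fun S hS => ?_⟩
  set S' : Finset {g : G // g ≠ 1} := S.subtype _ with hS'
  have hP := HolomorphicNearBall.prod hb S'
  refine ⟨_, hP.mul hP, fun x hx => ?_, ?_, fun g hg => ?_⟩
  · rw [norm_mul, norm_prod]
    have h1 : ∏ g ∈ S', ‖b g x‖ ≤ 1 :=
      Finset.prod_le_one (fun g _ => norm_nonneg _) fun g _ => hb1 g x hx
    exact mul_le_one₀ h1 (Finset.prod_nonneg fun g _ => norm_nonneg _) h1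
  · refine (hcS S').trans_eq ?_
    rw [norm_mul, norm_prod, ← sq, Finset.prod_pow]
  · have hg1 : g ≠ 1 := fun h => hS (h ▸ hg)
    have h0 : ∏ h ∈ S', b h (g.1 z) = 0 :=
      Finset.prod_eq_zero (i := ⟨g, hg1⟩) (Finset.mem_subtype.2 hg) (hbg ⟨g, hg1⟩)
    refine ⟨?_, by rw [h0, zero_mul]⟩
    have h1 := (hP.differentiableOn.differentiableAt
      (isOpen_ball.mem_nhds (hG.mapsTo g hz))).hasFDerivAt
    refine (h1.mul h1).congr_fderiv ?_
    ext v
    simp [h0]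

end IsBallGroup

end

section

variable {V : Type*} [NormedAddCommGroup V] [InnerProductSpace ℂ V]

/-- The Poincaré series of `ψ` for the group `G`. -/
def poincareSeries (G : Subgroup (Equiv.Perm V)) (ψ : V → ℂ) (x : V) : ℂ :=
  ∑' g : G, ψ (g.1 x) * jacDet g.1 x

namespace IsBallGroup

variable [FiniteDimensional ℂ V] {G : Subgroup (Equiv.Perm V)} (hG : IsBallGroup G)
include hG

omit [FiniteDimensional ℂ V] in
theorem poincareSeries_mul_jacDet (ψ : V → ℂ) (h : G) {x : V} (hx : x ∈ ball (0 : V) 1) :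
    poincareSeries G ψ (h.1 x) * jacDet h.1 x = poincareSeries G ψ x := by
  rw [poincareSeries, poincareSeries, ← tsum_mul_right,
    ← (Equiv.mulRight h).tsum_eq (fun g : G => ψ (g.1 x) * jacDet g.1 x)]
  refine tsum_congr fun g => ?_
  rw [Equiv.coe_mulRight, hG.jacDet_mul g h hx]
  simp only [Subgroup.coe_mul, Equiv.Perm.mul_apply]
  ring

theorem exists_norm_jacDet_le {z : V} (hz : z ∈ ball (0 : V) 1) :
    ∃ r > 0, ball z r ⊆ ball 0 1 ∧ ∃ C > 0, ∀ g : G, ∀ x ∈ ball z r,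
      ‖jacDet g.1 x‖ ≤ C * (1 - ‖g.1 0‖ ^ 2) := by
  have hz' := mem_ball_zero_iff.1 hz
  have hn : ∀ x ∈ ball z ((1 - ‖z‖) / 2), (1 - ‖z‖) / 2 ≤ 1 - ‖x‖ := fun x hx => by
    have := norm_le_norm_add_norm_sub' x z
    rw [mem_ball_iff_norm] at hx
    linarith
  have h0 : 0 < (1 - ‖z‖) / 2 := by linarith
  have hB : ball z ((1 - ‖z‖) / 2) ⊆ ball 0 1 := fun x hx => mem_ball_zero_iff.2 (by
    linarith [hn x hx])
  refine ⟨(1 - ‖z‖) / 2, h0, hB, (((1 - ‖z‖) / 2) ^ (Module.finrank ℂ V + 1))⁻¹, by positivity,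
    fun g x hx => ?_⟩
  refine ((hG.isAutOn g).norm_jacDet_le (hB hx)).trans ?_
  have := (hG.one_sub_norm_sq_pos g).le
  rw [div_eq_inv_mul]
  gcongr
  exact hn x hx

theorem differentiableOn_term {ψ : V → ℂ} (hψ : DifferentiableOn ℂ ψ (ball 0 1)) (g : G) :
    DifferentiableOn ℂ (fun x => ψ (g.1 x) * jacDet g.1 x) (ball 0 1) :=
  (hψ.comp (hG.differentiableOn g) (hG.mapsTo g)).mul
    (differentiableOn_jacDet isOpen_ball (hG.differentiableOn g))

theorem hasFDerivAt_poincareSeries {ψ : V → ℂ} (hψ : DifferentiableOn ℂ ψ (ball 0 1)) {M : ℝ}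
    (hM : ∀ x ∈ ball (0 : V) 1, ‖ψ x‖ ≤ M) {z : V} (hz : z ∈ ball (0 : V) 1) :
    HasFDerivAt (poincareSeries G ψ)
      (∑' g : G, fderiv ℂ (fun x => ψ (g.1 x) * jacDet g.1 x) z) z := by
  obtain ⟨r, hr, hrB, C, hC, h⟩ := hG.exists_norm_jacDet_le hz
  exact hasFDerivAt_tsum_of_summable_bound hr (fun g => (hG.differentiableOn_term hψ g).mono hrB)
    ((hG.summable.mul_left C).mul_left M) fun g x hx => by
      rw [norm_mul]
      exact mul_le_mul (hM _ (hG.mapsTo g (hrB hx))) (h g x hx) (norm_nonneg _)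
        ((norm_nonneg _).trans (hM _ hz))

theorem differentiableOn_poincareSeries {ψ : V → ℂ} (hψ : DifferentiableOn ℂ ψ (ball 0 1)) {M : ℝ}
    (hM : ∀ x ∈ ball (0 : V) 1, ‖ψ x‖ ≤ M) :
    DifferentiableOn ℂ (poincareSeries G ψ) (ball 0 1) := fun _ hz =>
  (hG.hasFDerivAt_poincareSeries hψ hM hz).differentiableAt.differentiableWithinAt

theorem exists_poincareSeries_approx {z : V} (hz : z ∈ ball (0 : V) 1) :
    ∃ C > 0, ∀ ψ : V → ℂ, DifferentiableOn ℂ ψ (ball 0 1) → ∀ M : ℝ,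
      (∀ x ∈ ball (0 : V) 1, ‖ψ x‖ ≤ M) → ∀ T : Finset G, 1 ∈ T →
      (∀ g ∈ T, g ≠ 1 → HasFDerivAt ψ (0 : V →L[ℂ] ℂ) (g.1 z) ∧ ψ (g.1 z) = 0) →
      ‖poincareSeries G ψ z - ψ z‖ ≤ C * M * ∑' g : {g // g ∉ T}, (1 - ‖g.1.1 0‖ ^ 2) ∧
      ‖fderiv ℂ (poincareSeries G ψ) z - fderiv ℂ ψ z‖
        ≤ C * M * ∑' g : {g // g ∉ T}, (1 - ‖g.1.1 0‖ ^ 2) := by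
  obtain ⟨r, hr, hrB, C, hC, h⟩ := hG.exists_norm_jacDet_le hz
  refine ⟨max C (2 * C / r), lt_max_of_lt_left hC, fun ψ hψ M hM T hT hv => ?_⟩
  have hM0 : 0 ≤ M := (norm_nonneg _).trans (hM z hz)
  have hterm : ∀ g : G, ∀ x ∈ ball z r, ‖ψ (g.1 x) * jacDet g.1 x‖ ≤ M * (C * (1 - ‖g.1 0‖ ^ 2)) :=
    fun g x hx => by
      rw [norm_mul]
      exact mul_le_mul (hM _ (hG.mapsTo g (hrB hx))) (h g x hx) (norm_nonneg _) hM0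
  have h1 : (fun x => ψ ((1 : G).1 x) * jacDet (1 : G).1 x) = ψ := by
    ext x
    have : jacDet (⇑(1 : G).1) x = 1 := jacDet_id x
    rw [this, mul_one]
    rfl
  have hs := hG.summable
  have hsum0 : 0 ≤ ∑' g : {g // g ∉ T}, (1 - ‖g.1.1 0‖ ^ 2) :=
    tsum_nonneg fun g => (hG.one_sub_norm_sq_pos g.1).le
  constructor
  · have h2 := norm_tsum_sub_le_tsum_compl (t := fun g : G => ψ (g.1 z) * jacDet g.1 z)
      ((hs.mul_left C).mul_left M) (fun g => hterm g z (mem_ball_self hr)) hT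
      fun g hg hg1 => by rw [(hv g hg hg1).2, zero_mul]
    rw [tsum_mul_left, tsum_mul_left] at h2
    have h3 := congrFun h1 z
    rw [h3] at h2
    refine h2.trans ?_
    rw [← mul_assoc, mul_comm M C]
    gcongr
    exact le_max_left _ _
  · have h2 := norm_tsum_sub_le_tsum_compl
      (t := fun g : G => fderiv ℂ (fun x => ψ (g.1 x) * jacDet g.1 x) z)
      (u := fun g : G => 2 * C / r * M * (1 - ‖g.1 0‖ ^ 2))
      (hs.mul_left _) (fun g => (norm_fderiv_le_of_norm_le hr
        ((hG.differentiableOn_term hψ g).mono hrB) (hterm g)).trans_eq (by ring)) hT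
      fun g hg hg1 => by
        obtain ⟨hd, h0⟩ := hv g hg hg1
        have h3 := (hd.comp z (hG.differentiableAt g hz).hasFDerivAt).mul
          ((differentiableOn_jacDet isOpen_ball (hG.differentiableOn g)).differentiableAt
            (isOpen_ball.mem_nhds hz)).hasFDerivAt
        have h4 : fderiv ℂ (fun x => ψ (g.1 x) * jacDet g.1 x) z = _ := h3.fderiv
        rw [h4]
        ext v
        simp [h0]
    rw [tsum_mul_left, h1] at h2
    rw [(hG.hasFDerivAt_poincareSeries hψ hM hz).fderiv]
    refine h2.trans ?_
    gcongr
    exact le_max_right _ _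

theorem exists_poincareSeries_ne_zero {z : V} (hz : z ∈ ball (0 : V) 1) :
    ∃ ψ : V → ℂ, HolomorphicNearBall ψ ∧ poincareSeries G ψ z ≠ 0 := by
  classical
  obtain ⟨c, hc, hq⟩ := hG.exists_blaschke_product hz
  obtain ⟨C, hC, h⟩ := hG.exists_poincareSeries_approx hz
  obtain ⟨T, hT⟩ := (((tendsto_tsum_compl_atTop_zero fun g : G => 1 - ‖g.1 0‖ ^ 2).eventually_lt_const (show 0 < c / C by positivity)).and
    (eventually_ge_atTop {1})).exists
  obtain ⟨hT, h1T⟩ := hT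
  obtain ⟨q, hqh, hq1, hqz, hqT⟩ := hq (T.erase 1) (by simp)
  refine ⟨q, hqh, fun h0 => ?_⟩
  have := (h q hqh.differentiableOn 1 hq1 T (by simpa using h1T)
    fun g hg hg1 => hqT g (Finset.mem_erase.2 ⟨hg1, hg⟩)).1
  rw [h0, zero_sub, norm_neg, mul_one] at this
  rw [lt_div_iff₀' hC] at hT
  linarith

theorem exists_fderiv_poincareSeries_ne {z : V} (hz : z ∈ ball (0 : V) 1) {v : V} (hv : v ≠ 0)
    (α : ℂ) : ∃ ψ : V → ℂ, HolomorphicNearBall ψ ∧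
      fderiv ℂ (poincareSeries G ψ) z v ≠ α * poincareSeries G ψ z := by
  classical
  have hv' : 0 < ‖v‖ := norm_pos_iff.2 hv
  obtain ⟨c, hc, hq⟩ := hG.exists_blaschke_product hz
  obtain ⟨C, hC, h⟩ := hG.exists_poincareSeries_approx hz
  have hε : 0 < c * ‖v‖ ^ 2 / (C * (2 * ‖v‖) * (‖v‖ + ‖α‖)) := by positivity
  obtain ⟨T, hT⟩ := (((tendsto_tsum_compl_atTop_zero fun g : G => 1 - ‖g.1 0‖ ^ 2).eventually_lt_const hε).and
    (eventually_ge_atTop {1})).exists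
  obtain ⟨hT, h1T⟩ := hT
  obtain ⟨q, hqh, hq1, hqz, hqT⟩ := hq (T.erase 1) (by simp)
  set l : V → ℂ := fun x => inner ℂ v (x - z) with hl
  have hld : ∀ x, HasFDerivAt l (innerSL ℂ v) x := fun x =>
    (innerSL ℂ v).hasFDerivAt.comp x ((hasFDerivAt_id x).sub_const z)
  have hψ : HolomorphicNearBall fun x => q x * l x :=
    hqh.mul (.of_differentiable fun x => (hld x).differentiableAt)
  refine ⟨_, hψ, fun h0 => ?_⟩
  have hqd := fun x (hx : x ∈ ball (0 : V) 1) =>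
    (hqh.differentiableOn.differentiableAt (isOpen_ball.mem_nhds hx)).hasFDerivAt
  have hb : ∀ x ∈ ball (0 : V) 1, ‖q x * l x‖ ≤ 2 * ‖v‖ := fun x hx => by
    have h1 := norm_inner_le_norm (𝕜 := ℂ) v (x - z)
    have h2 := norm_sub_le x z
    rw [mem_ball_zero_iff] at hx hz
    have h3 : ‖l x‖ ≤ 2 * ‖v‖ := h1.trans (by nlinarith)
    rw [norm_mul]
    exact (mul_le_of_le_one_left (norm_nonneg _) (hq1 x (mem_ball_zero_iff.2 hx))).trans h3
  obtain ⟨h1, h2⟩ := h _ hψ.differentiableOn (2 * ‖v‖) hb T (by simpa using h1T)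
    fun g hg hg1 => by
      obtain ⟨hd, h0⟩ := hqT g (Finset.mem_erase.2 ⟨hg1, hg⟩)
      refine ⟨(hd.mul (hld _)).congr_fderiv ?_, by rw [h0, zero_mul]⟩
      ext w
      simp [h0]
  have hlz : l z = 0 := by simp [hl]
  have hfd : fderiv ℂ (fun x => q x * l x) z v = q z * (‖v‖ : ℂ) ^ 2 := by
    have h3 : fderiv ℂ (fun x => q x * l x) z = _ := ((hqd z hz).mul (hld z)).fderiv
    rw [h3]
    simp [hlz, inner_self_eq_norm_sq_to_K]
  set τ := ∑' g : {g // g ∉ T}, (1 - ‖g.1.1 0‖ ^ 2)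
  set P := poincareSeries G fun x => q x * l x
  rw [hlz, mul_zero, sub_zero] at h1
  have h3 := (fderiv ℂ P z - fderiv ℂ (fun x => q x * l x) z).le_of_opNorm_le h2 v
  rw [_root_.sub_apply, hfd, h0] at h3
  have h4 : ‖q z * (‖v‖ : ℂ) ^ 2‖ ≤ ‖α * P z‖ + ‖α * P z - q z * (‖v‖ : ℂ) ^ 2‖ := by
    have := norm_sub_le (α * P z) (α * P z - q z * (‖v‖ : ℂ) ^ 2)
    rwa [sub_sub_cancel] at this
  rw [norm_mul, norm_pow, Complex.norm_real, norm_norm, norm_mul α] at h4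
  rw [lt_div_iff₀' (by positivity)] at hT
  have h5 : c * ‖v‖ ^ 2 ≤ ‖q z‖ * ‖v‖ ^ 2 := by gcongr
  have h6 : ‖α‖ * ‖P z‖ ≤ ‖α‖ * (C * (2 * ‖v‖) * τ) := by gcongr
  nlinarith

end IsBallGroup

end

section

variable {V : Type*} [NormedAddCommGroup V] [InnerProductSpace ℂ V] [MeasurableSpace V]
  [BorelSpace V] [FiniteDimensional ℂ V] (μ : Measure V) [μ.IsAddHaarMeasure]
  {G : Subgroup (Equiv.Perm V)} {D : Set V}

theorem IsBallFundamentalDomain.hasSum_setIntegral (hD : IsBallFundamentalDomain G D)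
    (hG : IsBallGroup G) {f : V → ℂ} (hf : IntegrableOn f (ball 0 1) μ) :
    HasSum (fun g : G => ∫ x in D, (‖jacDet g.1 x‖ : ℂ) ^ 2 * f (g.1 x) ∂μ)
      (∫ x in ball 0 1, f x ∂μ) := by
  have := hG.countable
  rw [← hD.iUnion_image hG] at hf ⊢
  have h := hasSum_integral_iUnion
    (fun g => hG.measurableSet_image g hD.measurableSet hD.subset_ball) hD.pairwise_disjoint hf
  suffices hg : ∀ g : G, ∫ x in g.1 '' D, f x ∂μ
      = ∫ x in D, (‖jacDet g.1 x‖ : ℂ) ^ 2 * f (g.1 x) ∂μ by simpa only [hg] using h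
  intro g
  rw [integral_image_eq_integral_abs_det_fderiv_smul μ hD.measurableSet
    (f' := fun x => (fderiv ℂ g.1 x).restrictScalars ℝ) (fun x hx =>
      (((hG.differentiableAt g (hD.subset_ball hx)).hasFDerivAt).restrictScalars
        ℝ).hasFDerivWithinAt) g.1.injective.injOn]
  refine integral_congr_ae (.of_forall fun x => ?_)
  simp only
  rw [show ((fderiv ℂ g.1 x).restrictScalars ℝ).det = LinearMap.det
    ((fderiv ℂ g.1 x : V →ₗ[ℂ] V).restrictScalars ℝ) from rfl, abs_det_restrictScalars,
    Complex.real_smul, Complex.ofReal_pow]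
  rfl

omit [MeasurableSpace V] [BorelSpace V] in
theorem IsBallGroup.continuousOn_mul_jacDet (hG : IsBallGroup G) {ψ : V → ℂ}
    (hψ : ContinuousOn ψ (ball 0 1)) (g : G) :
    ContinuousOn (fun x => ψ (g.1 x) * jacDet g.1 x) (ball 0 1) :=
  (hψ.comp (hG.differentiableOn g).continuousOn (hG.mapsTo g)).mul (hG.continuousOn_jacDet g)

omit [MeasurableSpace V] [BorelSpace V] in
theorem IsBallGroup.summable_norm_mul_jacDet (hG : IsBallGroup G) {ψ : V → ℂ} {M : ℝ}
    (hM : ∀ x ∈ ball (0 : V) 1, ‖ψ x‖ ≤ M) {x : V} (hx : x ∈ ball (0 : V) 1) :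
    Summable fun g : G => ‖ψ (g.1 x) * jacDet g.1 x‖ := by
  obtain ⟨r, hr, -, C, -, h⟩ := hG.exists_norm_jacDet_le hx
  refine .of_nonneg_of_le (fun _ => norm_nonneg _) (fun g => ?_)
    ((hG.summable.mul_left C).mul_left M)
  rw [norm_mul]
  exact mul_le_mul (hM _ (hG.mapsTo g hx)) (h g x (mem_ball_self hr)) (norm_nonneg _)
    ((norm_nonneg _).trans (hM _ hx))

omit [μ.IsAddHaarMeasure] in
theorem IsBallGroup.aemeasurable_poincareSeries (hG : IsBallGroup G) {ψ : V → ℂ}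
    (hψ : ContinuousOn ψ (ball 0 1)) {M : ℝ} (hM : ∀ x ∈ ball (0 : V) 1, ‖ψ x‖ ≤ M) {s : Set V}
    (hs : MeasurableSet s) (hsB : s ⊆ ball 0 1) :
    AEMeasurable (poincareSeries G ψ) (μ.restrict s) := by
  have := hG.countable
  refine aemeasurable_of_tendsto_metrizable_ae (u := (atTop : Filter (Finset G)))
    (f := fun T x => ∑ g ∈ T, ψ (g.1 x) * jacDet g.1 x) (fun T => ?_)
    ((ae_restrict_iff' hs).2 (.of_forall fun x hx => ?_))
  · refine ContinuousOn.aemeasurable ?_ hs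
    exact continuousOn_finsetSum _ fun g _ => (hG.continuousOn_mul_jacDet hψ g).mono hsB
  · exact (hG.summable_norm_mul_jacDet hM (hsB hx)).of_norm.hasSum

omit [MeasurableSpace V] [BorelSpace V] in
theorem IsBallGroup.enorm_poincareSeries_le (hG : IsBallGroup G) {ψ : V → ℂ} {M : ℝ}
    (hM : ∀ x ∈ ball (0 : V) 1, ‖ψ x‖ ≤ M) {x : V} (hx : x ∈ ball (0 : V) 1) :
    ‖poincareSeries G ψ x‖ₑ ≤ ∑' g : G, ‖ψ (g.1 x)‖ₑ * ‖jacDet g.1 x‖ₑ := by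
  have h := hG.summable_norm_mul_jacDet hM hx
  simp_rw [← enorm_mul, ← ofReal_norm]
  rw [← ENNReal.ofReal_tsum_of_nonneg (fun _ => norm_nonneg _) h]
  exact ENNReal.ofReal_le_ofReal (norm_tsum_le_tsum_norm h)

/-- The `L²` norm of a Poincaré series over a fundamental domain is computed by unfolding: it is
controlled by the integrals over the ball of `(ψ ∘ g) J_g ψ̄`. -/
theorem IsBallFundamentalDomain.lintegral_sq_poincareSeries_le (hD : IsBallFundamentalDomain G D)
    (hG : IsBallGroup G) {ψ : V → ℂ} (hψ : ContinuousOn ψ (ball 0 1)) {M : ℝ}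
    (hM : ∀ x ∈ ball (0 : V) 1, ‖ψ x‖ ≤ M)
    (hfin : ∑' g : G, ∫⁻ x in ball (0 : V) 1, ‖ψ (g.1 x)‖ₑ * ‖jacDet g.1 x‖ₑ * ‖ψ x‖ₑ ∂μ ≠ ⊤)
    {u : G → ℝ} (hu : Summable u)
    (hψu : ∀ g : G, ‖∫ x in ball (0 : V) 1, ψ (g.1 x) * jacDet g.1 x * star (ψ x) ∂μ‖ ≤ u g) :
    ∫⁻ x in D, ‖poincareSeries G ψ x‖ₑ ^ 2 ∂μ ≤ ENNReal.ofReal (∑' g, u g) := by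
  have := hG.countable
  have hDm := hD.measurableSet
  set Φ : G → V → ℂ := fun g x => ψ (g.1 x) * jacDet g.1 x * star (ψ x) with hΦ
  have hΦc : ∀ g, ContinuousOn (Φ g) (ball 0 1) := fun g =>
    (hG.continuousOn_mul_jacDet hψ g).mul (continuous_star.comp_continuousOn hψ)
  set T : G × G → V → ℂ := fun p x => (‖jacDet p.2.1 x‖ : ℂ) ^ 2 * Φ p.1 (p.2.1 x) with hT
  have hTc : ∀ p, ContinuousOn (T p) (ball 0 1) := fun p =>
    ((Complex.continuous_ofReal.comp_continuousOn (hG.continuousOn_jacDet p.2).norm).pow 2).mul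
      ((hΦc p.1).comp (hG.differentiableOn p.2).continuousOn (hG.mapsTo p.2))
  have hTm : ∀ p, AEStronglyMeasurable (T p) (μ.restrict D) := fun p =>
    ((hTc p).mono hD.subset_ball).aestronglyMeasurable hDm
  have hTe : ∀ p x, ‖T p x‖ₑ = ‖Φ p.1 (p.2.1 x)‖ₑ * ‖jacDet p.2.1 x‖ₑ ^ 2 := fun p x => by
    simp only [hT]
    rw [enorm_mul, enorm_pow, mul_comm]
    congr 2
    simp [← ofReal_norm]
  have hΦe : ∀ g x, ‖Φ g x‖ₑ = ‖ψ (g.1 x)‖ₑ * ‖jacDet g.1 x‖ₑ * ‖ψ x‖ₑ := fun g x => by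
    simp only [hΦ]
    rw [enorm_mul, enorm_mul]
    congr 1
    simp [← ofReal_norm]
  have hTfin : ∑' p : G × G, ∫⁻ x in D, ‖T p x‖ₑ ∂μ ≠ ⊤ := by
    rw [ENNReal.tsum_prod']
    convert hfin using 3 with g
    rw [← lintegral_congr (hΦe g), hD.lintegral_ball μ hG]
    exact tsum_congr fun h => lintegral_congr fun x => hTe _ x
  have hΦi : ∀ g, IntegrableOn (Φ g) (ball 0 1) μ := fun g => by
    refine ⟨(hΦc g).aestronglyMeasurable measurableSet_ball, ?_⟩
    rw [HasFiniteIntegral, lintegral_congr (hΦe g)]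
    exact (ENNReal.ne_top_of_tsum_ne_top hfin g).lt_top
  have hTs : ∀ x ∈ D, ∑' p, T p x = ((‖poincareSeries G ψ x‖ ^ 2 : ℝ) : ℂ) := fun x hx => by
    have hxB := hD.subset_ball hx
    set a : G → ℂ := fun g => ψ (g.1 x) * jacDet g.1 x with ha
    have has : Summable fun g => ‖a g‖ := hG.summable_norm_mul_jacDet hM hxB
    have has' : Summable fun g => ‖star (a g)‖ := by simpa using has
    have h1 := tsum_mul_tsum_of_summable_norm has has'
    rw [← tsum_star] at h1
    have h2 : (∑' g, a g) * star (∑' g, a g) = ((‖poincareSeries G ψ x‖ ^ 2 : ℝ) : ℂ) := by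
      rw [poincareSeries, Complex.star_def, Complex.mul_conj, Complex.normSq_eq_norm_sq]
    rw [← h2, h1]
    set e : G × G ≃ G × G :=
      { toFun := fun p => (p.1 * p.2, p.2)
        invFun := fun p => (p.1 * p.2⁻¹, p.2)
        left_inv := fun p => by simp
        right_inv := fun p => by simp } with he
    rw [← e.tsum_eq fun p : G × G => a p.1 * star (a p.2)]
    refine tsum_congr fun p => ?_
    simp only [he, ha, hT, hΦ, Equiv.coe_fn_mk]
    rw [hG.jacDet_mul p.1 p.2 hxB, ← Complex.ofReal_pow, ← Complex.normSq_eq_norm_sq,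
      ← Complex.mul_conj, star_mul', Subgroup.coe_mul, Equiv.Perm.mul_apply]
    simp only [Complex.star_def]
    ring
  have h1 : ∫ x in D, ((‖poincareSeries G ψ x‖ ^ 2 : ℝ) : ℂ) ∂μ
      = ∑' g, ∫ x in ball (0 : V) 1, Φ g x ∂μ := by
    rw [← setIntegral_congr_fun hDm hTs, integral_tsum hTm hTfin]
    have hs : Summable fun p => ∫ x in D, T p x ∂μ := by
      refine Summable.of_norm_bounded (g := fun p => (∫⁻ x in D, ‖T p x‖ₑ ∂μ).toReal)
        (ENNReal.summable_toReal hTfin) fun p => ?_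
      rw [← integral_norm_eq_lintegral_enorm (hTm p)]
      exact norm_integral_le_integral_norm _
    rw [hs.tsum_prod]
    exact tsum_congr fun g => (hD.hasSum_setIntegral μ hG (hΦi g)).tsum_eq
  have hfin2 : ∫⁻ x in D, ‖poincareSeries G ψ x‖ₑ ^ 2 ∂μ < ⊤ := by
    refine lt_of_le_of_lt ?_ hfin.lt_top
    rw [← hD.lintegral_sq_tsum_enorm μ hG hψ]
    refine setLIntegral_mono' hDm fun x hx => ?_
    gcongr
    exact hG.enorm_poincareSeries_le hM (hD.subset_ball hx)
  have hinteg : Integrable (fun x => ‖poincareSeries G ψ x‖ ^ 2) (μ.restrict D) := by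
    refine ⟨((hG.aemeasurable_poincareSeries μ hψ hM hDm hD.subset_ball).norm.pow_const
      2).aestronglyMeasurable, ?_⟩
    simpa [HasFiniteIntegral, enorm_pow] using hfin2
  have h2 : ∫⁻ x in D, ‖poincareSeries G ψ x‖ₑ ^ 2 ∂μ
      = ENNReal.ofReal (∫ x in D, ‖poincareSeries G ψ x‖ ^ 2 ∂μ) := by
    rw [ofReal_integral_eq_lintegral_ofReal hinteg (.of_forall fun x => by positivity)]
    refine lintegral_congr fun x => ?_
    rw [ENNReal.ofReal_pow (norm_nonneg _), ofReal_norm]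
  rw [h2]
  refine ENNReal.ofReal_le_ofReal ?_
  rw [integral_complex_ofReal] at h1
  refine (le_abs_self _).trans ?_
  rw [← Real.norm_eq_abs, ← Complex.norm_real, h1]
  exact tsum_of_norm_bounded hu.hasSum hψu

end

section

variable {V : Type*} [NormedAddCommGroup V] [InnerProductSpace ℂ V]

theorem norm_sub_inner_smul_sq {u : V} (hu : ‖u‖ = 1) (x : V) :
    ‖x - inner ℂ u x • u‖ ^ 2 = ‖x‖ ^ 2 - ‖inner ℂ u x‖ ^ 2 := by
  rw [norm_sub_sq (𝕜 := ℂ), inner_smul_right, ← inner_conj_symm x u, RCLike.mul_conj, norm_smul, hu]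
  norm_cast
  ring

theorem norm_one_sub_inner_le_two_mul {u x : V} (hu : ‖u‖ = 1) (hx : ‖x‖ ≤ 1) {s : ℝ}
    (hs0 : 0 ≤ s) (hs1 : s ≤ 1) :
    ‖1 - inner ℂ u x‖ ≤ 2 * ‖1 - inner ℂ ((s : ℂ) • u) x‖ := by
  set ζ := inner ℂ u x with hζ
  have hζ1 : ‖ζ‖ ≤ 1 := (norm_inner_le_norm u x).trans (by rw [hu, one_mul]; exact hx)
  rw [inner_smul_left, ← hζ, Complex.conj_ofReal]
  have h1 : ‖1 - ζ‖ ≤ ‖1 - s * ζ‖ + (1 - s) := by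
    calc ‖1 - ζ‖ = ‖(1 - s * ζ) - ((1 - s : ℝ) : ℂ) * ζ‖ := by push_cast; ring_nf
      _ ≤ ‖1 - s * ζ‖ + ‖((1 - s : ℝ) : ℂ) * ζ‖ := norm_sub_le _ _
      _ ≤ ‖1 - s * ζ‖ + (1 - s) := by
        rw [norm_mul, Complex.norm_of_nonneg (by linarith)]
        gcongr
        exact mul_le_of_le_one_right (by linarith) hζ1
  have h2 : 1 - s ≤ ‖1 - s * ζ‖ := by
    have := norm_sub_norm_le (1 : ℂ) (s * ζ)
    rw [norm_one, norm_mul, Complex.norm_of_nonneg hs0] at this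
    nlinarith
  linarith

theorem one_sub_norm_sq_le_two_mul_norm_one_sub_inner {c x : V} (hc : ‖c‖ < 1) (hx : ‖x‖ < 1) :
    1 - ‖c‖ ^ 2 ≤ 2 * ‖1 - inner ℂ c x‖ := by
  have h1 := norm_sub_norm_le (1 : ℂ) (inner ℂ c x)
  have h2 := norm_inner_le_norm (𝕜 := ℂ) c x
  rw [norm_one] at h1
  nlinarith [norm_nonneg c, norm_nonneg x]

variable [FiniteDimensional ℂ V] [MeasurableSpace V] [BorelSpace V] (μ : Measure V) [μ.IsAddHaarMeasure]

/-- The part of the unit ball where `‖1 - ⟪u, x⟫‖ ≤ s ^ 2` lies in an anisotropic box of size `s ^ 2`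
in the direction `u` and of size comparable to `s` in the orthogonal directions. -/
theorem measure_setOf_norm_one_sub_inner_le {u : V} (hu : ‖u‖ = 1) {s : ℝ} (hs : 0 < s) :
    μ {x ∈ ball (0 : V) 1 | ‖1 - inner ℂ u x‖ ≤ s ^ 2}
      ≤ ENNReal.ofReal (s ^ (2 * (Module.finrank ℂ V + 1))) * μ (ball 0 2) := by
  set A : V →ₗ[ℂ] V := (s : ℂ) • LinearMap.transvection
    (((s : ℂ) - 1) • (innerSL ℂ u : V →ₗ[ℂ] ℂ)) u with hA
  have hAv : ∀ v, A v = (s : ℂ) • (v + ((s - 1 : ℂ) * inner ℂ u v) • u) := fun v => by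
    simp [hA, LinearMap.transvection.apply]
  have hdet : LinearMap.det A = (s : ℂ) ^ (Module.finrank ℂ V + 1) := by
    rw [hA, LinearMap.det_smul, LinearMap.transvection.det]
    simp [inner_self_eq_norm_sq_to_K, hu, pow_succ]
  have hsub : {x ∈ ball (0 : V) 1 | ‖1 - inner ℂ u x‖ ≤ s ^ 2}
      ⊆ (fun y => u + y) '' (A.restrictScalars ℝ '' ball 0 2) := by
    rintro x ⟨hx, hxs⟩
    rw [mem_ball_zero_iff] at hx
    set ζ := inner ℂ u x with hζ
    have huu : inner ℂ u u = (1 : ℂ) := by simp [inner_self_eq_norm_sq_to_K, hu]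
    have hs' : (s : ℂ) ≠ 0 := by exact_mod_cast hs.ne'
    set w : V := (s : ℂ)⁻¹ • (x - ζ • u) with hw
    have hwu : inner ℂ u w = 0 := by
      rw [hw, inner_smul_right, inner_sub_right, inner_smul_right, huu, ← hζ]
      ring
    refine ⟨x - u, ⟨((ζ - 1) / s ^ 2) • u + w, ?_, ?_⟩, by simp⟩
    · rw [mem_ball_zero_iff]
      have h1 : ‖((ζ - 1) / (s : ℂ) ^ 2) • u‖ ≤ 1 := by
        rw [norm_smul, hu, mul_one, norm_div, norm_sub_rev, norm_pow, Complex.norm_of_nonneg hs.le]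
        exact (div_le_one (by positivity)).2 hxs
      have h2 : ‖w‖ ^ 2 ≤ 2 := by
        rw [hw, norm_smul, mul_pow, norm_sub_inner_smul_sq hu, norm_inv, Complex.norm_of_nonneg hs.le,
          inv_pow, inv_mul_le_iff₀ (by positivity)]
        have h3 := norm_sub_norm_le (1 : ℂ) ζ
        have h4 : ‖ζ‖ ≤ 1 := (norm_inner_le_norm u x).trans (by rw [hu, one_mul]; exact hx.le)
        rw [norm_one] at h3
        nlinarith [norm_nonneg x, norm_nonneg ζ]
      have h3 := norm_add_sq (𝕜 := ℂ) (((ζ - 1) / (s : ℂ) ^ 2) • u) w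
      rw [inner_smul_left, hwu, mul_zero, map_zero] at h3
      refine lt_of_pow_lt_pow_left₀ 2 (by norm_num) ?_
      have h4 : ‖((ζ - 1) / (s : ℂ) ^ 2) • u‖ ^ 2 ≤ 1 := pow_le_one₀ (norm_nonneg _) h1
      linarith
    · have hsw : (s : ℂ) • w = x - ζ • u := by rw [hw, smul_smul, mul_inv_cancel₀ hs', one_smul]
      rw [LinearMap.restrictScalars_apply, hAv, inner_add_right, hwu, inner_smul_right, huu,
        smul_add, smul_add, hsw, smul_smul, smul_smul, add_right_comm, ← add_smul]
      have : (s : ℂ) * ((ζ - 1) / s ^ 2) + s * ((s - 1) * ((ζ - 1) / s ^ 2 * 1 + 0)) = ζ - 1 := by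
        field_simp
        ring
      rw [this, sub_smul, one_smul]
      abel
  refine (measure_mono hsub).trans_eq ?_
  rw [image_add_left, measure_preimage_add, Measure.addHaar_image_linearMap,
    abs_det_restrictScalars, hdet, norm_pow, Complex.norm_of_nonneg hs.le, ← pow_mul, mul_comm 2]

/-- In dimension different from one, the `L¹` norm over the ball of the Jacobian determinant of an
automorphism `γ` is `O(1 - ‖γ 0‖ ^ 2)`. -/
theorem exists_lintegral_enorm_jacDet_le (hn : Module.finrank ℂ V ≠ 1) :
    ∃ C : ENNReal, C ≠ ⊤ ∧ ∀ γ : V → V, IsAutOn (ball 0 1) γ →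
      ∫⁻ x in ball (0 : V) 1, ‖jacDet γ x‖ₑ ∂μ ≤ C * ENNReal.ofReal (1 - ‖γ 0‖ ^ 2) := by
  rcases Nat.eq_zero_or_pos (Module.finrank ℂ V) with h0 | hpos
  · have := Module.finrank_zero_iff.1 h0
    refine ⟨μ (ball 0 1), measure_ball_lt_top.ne, fun γ hγ => ?_⟩
    rw [mul_comm, ← setLIntegral_const]
    refine lintegral_mono fun x => ?_
    rw [← ofReal_norm]
    refine ENNReal.ofReal_le_ofReal ?_
    rw [Subsingleton.elim x 0]
    simpa using hγ.norm_jacDet_le (mem_ball_self one_pos)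
  obtain ⟨m, hm⟩ : ∃ m, Module.finrank ℂ V = m + 2 := ⟨Module.finrank ℂ V - 2, by omega⟩
  have : Nontrivial V := Module.finrank_pos_iff.1 hpos
  obtain ⟨u₀, hu₀⟩ := exists_norm_eq V zero_le_one
  refine ⟨ENNReal.ofReal (8 ^ (m + 3)) * μ (ball 0 2) * 2, ENNReal.mul_ne_top (ENNReal.mul_ne_top
    ENNReal.ofReal_ne_top measure_ball_lt_top.ne) (by simp), fun γ hγ => ?_⟩
  obtain ⟨c, hc, hc0, hJ⟩ := hγ.exists_norm_jacDet_eq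
  obtain ⟨u, hu, hcu⟩ : ∃ u : V, ‖u‖ = 1 ∧ c = (‖c‖ : ℂ) • u := by
    rcases eq_or_ne c 0 with rfl | h
    · exact ⟨u₀, hu₀, by simp⟩
    · have h' : ‖c‖ ≠ 0 := norm_ne_zero_iff.2 h
      refine ⟨(‖c‖ : ℂ)⁻¹ • c, by simp [norm_smul, h'], ?_⟩
      rw [smul_smul, mul_inv_cancel₀ (by exact_mod_cast h'), one_smul]
  set δ := 1 - ‖c‖ ^ 2 with hδ
  have hδ0 : 0 < δ := by nlinarith [norm_nonneg c]
  set S : ℕ → Set V := fun k => {x ∈ ball (0 : V) 1 | ‖1 - inner ℂ u x‖ ≤ (2 * (1 / 2) ^ k) ^ 2 ∧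
    ((1 / 2) ^ k) ^ 2 ≤ ‖1 - inner ℂ u x‖} with hS
  have hcont : Continuous fun x : V => ‖1 - inner ℂ u x‖ := by fun_prop
  have hSm : ∀ k, MeasurableSet (S k) := fun k => measurableSet_ball.inter
    ((measurableSet_le hcont.measurable measurable_const).inter
      (measurableSet_le measurable_const hcont.measurable))
  have hSU : ball (0 : V) 1 ⊆ ⋃ k, S k := fun x hx => by
    have hx' := mem_ball_zero_iff.1 hx
    have h1 := norm_inner_le_norm (𝕜 := ℂ) u x
    have h2 := norm_sub_norm_le (1 : ℂ) (inner ℂ u x)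
    have h3 := norm_sub_le (1 : ℂ) (inner ℂ u x)
    rw [norm_one] at h2 h3
    rw [hu, one_mul] at h1
    have h4 : 0 < ‖1 - inner ℂ u x‖ / 4 := by linarith
    obtain ⟨k, hk1, hk2⟩ := exists_nat_pow_near_of_lt_one h4 (by linarith : _ ≤ (1 : ℝ))
      (by norm_num : (0 : ℝ) < 1 / 4) (by norm_num)
    refine mem_iUnion.2 ⟨k, hx, ?_, ?_⟩
    · rw [mul_pow, ← pow_mul, mul_comm k, pow_mul]
      norm_num at hk2 ⊢
      linarith
    · rw [← pow_mul, mul_comm k, pow_mul]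
      rw [pow_succ] at hk1
      norm_num at hk1 ⊢
      linarith
  have hbound : ∀ k, ∀ x ∈ S k, ‖jacDet γ x‖ ≤ δ * (2 ^ (m + 3) * (2 ^ k) ^ (m + 5)) := by
    rintro k x ⟨hx, -, hk⟩
    have hx' := mem_ball_zero_iff.1 hx
    rw [(hJ x hx).2, hm]
    set d := ‖1 - inner ℂ c x‖ with hd
    have hd1 : ‖1 - inner ℂ u x‖ ≤ 2 * d := by
      rw [hd, hcu]
      exact norm_one_sub_inner_le_two_mul hu hx'.le (norm_nonneg _) hc.le
    have hd2 : δ ≤ 2 * d := one_sub_norm_sq_le_two_mul_norm_one_sub_inner hc hx'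
    set q := √(2 * d) with hq
    have hqd : d = q ^ 2 / 2 := by rw [hq, Real.sq_sqrt (by linarith)]; ring
    have hqk : (1 / 2) ^ k ≤ q := Real.le_sqrt_of_sq_le (hk.trans hd1)
    have hq0 : 0 < q := lt_of_lt_of_le (by positivity) hqk
    have hqk' : q⁻¹ ≤ 2 ^ k := by
      refine (inv_anti₀ (by positivity) hqk).trans_eq ?_
      rw [one_div, inv_pow, inv_inv]
    have hδq : √δ ≤ q := Real.sqrt_le_sqrt hd2
    calc (√δ / d) ^ (m + 2 + 1) = √δ ^ 2 * √δ ^ (m + 1) / (q ^ 2 / 2) ^ (m + 3) := by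
          rw [← hqd, div_pow]
          ring
      _ ≤ δ * q ^ (m + 1) / (q ^ 2 / 2) ^ (m + 3) := by
          rw [Real.sq_sqrt hδ0.le]
          gcongr
      _ = δ * (2 ^ (m + 3) * q⁻¹ ^ (m + 5)) := by
          rw [inv_pow, div_pow, ← pow_mul, show 2 * (m + 3) = (m + 1) + (m + 5) by ring, pow_add]
          field_simp
          ring
      _ ≤ _ := by gcongr
  calc ∫⁻ x in ball (0 : V) 1, ‖jacDet γ x‖ₑ ∂μ ≤ ∫⁻ x in ⋃ k, S k, ‖jacDet γ x‖ₑ ∂μ :=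
        lintegral_mono_set hSU
    _ ≤ ∑' k, ∫⁻ x in S k, ‖jacDet γ x‖ₑ ∂μ := lintegral_iUnion_le _ _
    _ ≤ ∑' k : ℕ, ENNReal.ofReal (8 ^ (m + 3)) * μ (ball 0 2) * ENNReal.ofReal δ * 2⁻¹ ^ k := by
        refine ENNReal.tsum_le_tsum fun k => ?_
        have h1 : ∫⁻ x in S k, ‖jacDet γ x‖ₑ ∂μ
            ≤ ENNReal.ofReal (δ * (2 ^ (m + 3) * (2 ^ k) ^ (m + 5))) * μ (S k) := by
          rw [← setLIntegral_const]
          refine setLIntegral_mono' (hSm k) fun x hx => ?_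
          rw [← ofReal_norm]
          exact ENNReal.ofReal_le_ofReal (hbound k x hx)
        have h2 : μ (S k) ≤ ENNReal.ofReal ((2 * (1 / 2) ^ k) ^ (2 * (m + 3))) * μ (ball 0 2) := by
          have := measure_setOf_norm_one_sub_inner_le μ hu
            (by positivity : (0 : ℝ) < 2 * (1 / 2) ^ k)
          rw [hm] at this
          exact (measure_mono fun x (hx : x ∈ S k) => And.intro hx.1 hx.2.1).trans this
        refine h1.trans ((mul_le_mul_right h2 _).trans ?_)
        have h3 : (2⁻¹ : ENNReal) = ENNReal.ofReal (1 / 2) := by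
          rw [one_div, ENNReal.ofReal_inv_of_pos two_pos, ENNReal.ofReal_ofNat]
        rw [h3, ← ENNReal.ofReal_pow (by norm_num), ← mul_assoc, mul_right_comm _ (μ _),
          mul_right_comm _ (μ _), ← ENNReal.ofReal_mul (by positivity),
          ← ENNReal.ofReal_mul (by positivity), ← ENNReal.ofReal_mul (by positivity)]
        refine mul_le_mul_left (ENNReal.ofReal_le_ofReal ?_) _
        have h4 : (2 : ℝ) ^ k = ((1 / 2) ^ k)⁻¹ := by rw [one_div, inv_pow, inv_inv]
        rw [h4]
        set y : ℝ := (1 / 2) ^ k with hy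
        have hy0 : 0 < y := by positivity
        have hy1 : y ≤ 1 := pow_le_one₀ (by norm_num) (by norm_num)
        calc δ * (2 ^ (m + 3) * y⁻¹ ^ (m + 5)) * (2 * y) ^ (2 * (m + 3))
            = 8 ^ (m + 3) * δ * (y ^ (2 * m + 6) / y ^ (m + 5)) := by
              have h5 : (8 : ℝ) ^ (m + 3) = 2 ^ (m + 3) * 2 ^ (2 * (m + 3)) := by
                rw [pow_mul 2 2, ← mul_pow]
                norm_num
              rw [h5, mul_pow, inv_pow, div_eq_mul_inv, mul_add 2 m 3]
              ring
          _ = 8 ^ (m + 3) * δ * y ^ (m + 1) := by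
              rw [show 2 * m + 6 = (m + 1) + (m + 5) by ring, pow_add y (m + 1) (m + 5),
                mul_div_assoc, div_self (by positivity), mul_one]
          _ ≤ 8 ^ (m + 3) * δ * y := by
              gcongr
              exact pow_le_of_le_one hy0.le hy1 (by omega)
    _ = _ := by
        rw [ENNReal.tsum_mul_left, ENNReal.tsum_geometric, ENNReal.one_sub_inv_two, inv_inv, hc0]
        ring

end

section

variable {V : Type*} [NormedAddCommGroup V] [InnerProductSpace ℂ V] [MeasurableSpace V]
  [BorelSpace V] [FiniteDimensional ℂ V] (μ : Measure V) [μ.IsAddHaarMeasure]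
  {G : Subgroup (Equiv.Perm V)} {D : Set V}

theorem IsBallFundamentalDomain.lintegral_sq_poincareSeries_lt_top_of_finrank_ne_one
    (hD : IsBallFundamentalDomain G D) (hG : IsBallGroup G) (hn : Module.finrank ℂ V ≠ 1)
    {ψ : V → ℂ} (hψ : ContinuousOn ψ (ball 0 1)) {M : ℝ} (hM : ∀ x ∈ ball (0 : V) 1, ‖ψ x‖ ≤ M) :
    ∫⁻ x in D, ‖poincareSeries G ψ x‖ₑ ^ 2 ∂μ < ⊤ := by
  obtain ⟨C, hC, h⟩ := exists_lintegral_enorm_jacDet_le (V := V) μ hn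
  have hM' : ∀ x ∈ ball (0 : V) 1, ‖ψ x‖ₑ ≤ ENNReal.ofReal M := fun x hx => by
    rw [← ofReal_norm]
    exact ENNReal.ofReal_le_ofReal (hM x hx)
  calc ∫⁻ x in D, ‖poincareSeries G ψ x‖ₑ ^ 2 ∂μ
      ≤ ∫⁻ x in D, (∑' g : G, ‖ψ (g.1 x)‖ₑ * ‖jacDet g.1 x‖ₑ) ^ 2 ∂μ := by
        refine setLIntegral_mono' hD.measurableSet fun x hx => ?_
        gcongr
        exact hG.enorm_poincareSeries_le hM (hD.subset_ball hx)
    _ = ∑' g : G, ∫⁻ x in ball 0 1, ‖ψ (g.1 x)‖ₑ * ‖jacDet g.1 x‖ₑ * ‖ψ x‖ₑ ∂μ :=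
        hD.lintegral_sq_tsum_enorm μ hG hψ
    _ ≤ ∑' g : G, ENNReal.ofReal M * ENNReal.ofReal M * C * ENNReal.ofReal (1 - ‖g.1 0‖ ^ 2) := by
        refine ENNReal.tsum_le_tsum fun g => ?_
        rw [mul_assoc _ C]
        refine le_trans ?_ (mul_le_mul_right (h _ (hG.isAutOn g)) _)
        rw [← lintegral_const_mul' _ _ (by finiteness)]
        refine setLIntegral_mono' measurableSet_ball fun x hx => ?_
        rw [mul_right_comm]
        gcongr
        · exact hM' _ (hG.mapsTo g hx)
        · exact hM' _ hx
    _ < ⊤ := by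
        rw [ENNReal.tsum_mul_left]
        have := hG.summable.tsum_ofReal_lt_top
        finiteness

end

section

/-- `f` is real differentiable at `z` with Wirtinger derivatives `∂f = a` and `∂̄f = b`. -/
def HasWirtingerAt (f : ℂ → ℂ) (a b z : ℂ) : Prop :=
  HasFDerivAt f (a • ContinuousLinearMap.id ℝ ℂ + b • (Complex.conjCLE : ℂ →L[ℝ] ℂ)) z

namespace HasWirtingerAt

variable {f g : ℂ → ℂ} {a b a' b' z : ℂ}

theorem congr (h : HasWirtingerAt f a b z) (ha : a = a') (hb : b = b') :
    HasWirtingerAt f a' b' z := ha ▸ hb ▸ h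

theorem _root_.HasDerivAt.hasWirtingerAt (h : HasDerivAt f a z) : HasWirtingerAt f a 0 z := by
  refine (h.hasFDerivAt.restrictScalars ℝ).congr_fderiv ?_
  refine ContinuousLinearMap.ext fun v => ?_
  simp [mul_comm]

theorem _root_.hasWirtingerAt_conj (z : ℂ) : HasWirtingerAt (fun z => star z) 0 1 z := by
  refine (Complex.conjCLE : ℂ →L[ℝ] ℂ).hasFDerivAt.congr_fderiv ?_
  refine ContinuousLinearMap.ext fun v => ?_
  simp

theorem mul (hf : HasWirtingerAt f a b z) (hg : HasWirtingerAt g a' b' z) :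
    HasWirtingerAt (fun z => f z * g z) (a * g z + f z * a') (b * g z + f z * b') z := by
  refine (HasFDerivAt.mul hf hg).congr_fderiv ?_
  refine ContinuousLinearMap.ext fun v => ?_
  simp
  ring

theorem add (hf : HasWirtingerAt f a b z) (hg : HasWirtingerAt g a' b' z) :
    HasWirtingerAt (fun z => f z + g z) (a + a') (b + b') z := by
  refine (HasFDerivAt.add hf hg).congr_fderiv ?_
  refine ContinuousLinearMap.ext fun v => ?_
  simp
  ring

theorem neg (hf : HasWirtingerAt f a b z) : HasWirtingerAt (fun z => -f z) (-a) (-b) z := by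
  refine (HasFDerivAt.neg hf).congr_fderiv ?_
  refine ContinuousLinearMap.ext fun v => ?_
  simp
  ring

protected theorem star (hf : HasWirtingerAt f a b z) :
    HasWirtingerAt (fun z => star (f z)) (star b) (star a) z := by
  refine ((Complex.conjCLE : ℂ →L[ℝ] ℂ).hasFDerivAt.comp z hf).congr_fderiv ?_
  refine ContinuousLinearMap.ext fun v => ?_
  simp
  ring

theorem comp_hasDerivAt {c : ℂ} (hf : HasWirtingerAt f a b (g z)) (hg : HasDerivAt g c z) :
    HasWirtingerAt (fun z => f (g z)) (a * c) (b * star c) z := by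
  refine (HasFDerivAt.comp z hf (hg.hasFDerivAt.restrictScalars ℝ)).congr_fderiv ?_
  refine ContinuousLinearMap.ext fun v => ?_
  simp
  ring

theorem _root_.HasDerivAt.comp_hasWirtingerAt {c : ℂ} (hf : HasDerivAt f c (g z))
    (hg : HasWirtingerAt g a b z) : HasWirtingerAt (fun z => f (g z)) (c * a) (c * b) z := by
  refine ((hf.hasFDerivAt.restrictScalars ℝ).comp z hg).congr_fderiv ?_
  refine ContinuousLinearMap.ext fun v => ?_
  simp
  ring

theorem continuousAt (h : HasWirtingerAt f a b z) : ContinuousAt f z := HasFDerivAt.continuousAt h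

end HasWirtingerAt

variable {μ : Measure ℂ} [μ.IsAddHaarMeasure]

/-- Stokes' formula for functions on the disc that vanish to second order at the boundary. -/
theorem setIntegral_eq_zero_of_hasWirtingerAt {f a b : ℂ → ℂ}
    (hf : ∀ z ∈ ball (0 : ℂ) 1, HasWirtingerAt f (a z) (b z) z) {C : ℝ}
    (hC : ∀ z ∈ ball (0 : ℂ) 1, ‖f z‖ ≤ C * (1 - ‖z‖ ^ 2) ^ 2)
    (ha : IntegrableOn a (ball 0 1) μ) (hb : IntegrableOn b (ball 0 1) μ) :
    ∫ z in ball (0 : ℂ) 1, a z ∂μ = 0 := by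
  set B := ball (0 : ℂ) 1 with hB
  set F := B.indicator f with hF
  set A := B.indicator a with hA
  set A' := B.indicator b with hA'
  have hC0 : 0 ≤ C := by
    have := (norm_nonneg _).trans (hC 0 (mem_ball_self one_pos))
    simpa using this
  have hFC : ∀ z, ‖F z‖ ≤ C := fun z => by
    by_cases hz : z ∈ B
    · rw [hF, indicator_of_mem hz]
      refine (hC z hz).trans (mul_le_of_le_one_right hC0 (pow_le_one₀ ?_ ?_)) <;>
      nlinarith [norm_nonneg z, mem_ball_zero_iff.1 hz]
    · rw [hF, indicator_of_notMem hz, norm_zero]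
      exact hC0
  have hderiv : ∀ z, HasWirtingerAt F (A z) (A' z) z := fun z => by
    by_cases hz : z ∈ B
    · rw [hA, hA', indicator_of_mem hz, indicator_of_mem hz]
      refine HasFDerivAt.congr_of_eventuallyEq (hf z hz) ?_
      filter_upwards [isOpen_ball.mem_nhds hz] with y hy
      exact indicator_of_mem hy f
    · rw [hA, hA', indicator_of_notMem hz, indicator_of_notMem hz]
      have hz' : 1 ≤ ‖z‖ := by simpa [hB] using hz
      have hFz : F z = 0 := indicator_of_notMem hz f
      have hO : (fun y => F y) =O[𝓝 z] fun y => ‖y - z‖ ^ 2 := by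
        refine Asymptotics.IsBigO.of_bound (C * 4) (.of_forall fun y => ?_)
        by_cases hy : y ∈ B
        · rw [hF, indicator_of_mem hy]
          refine (hC y hy).trans ?_
          rw [norm_pow, norm_norm, mul_assoc]
          have h1 : ‖y‖ < 1 := mem_ball_zero_iff.1 hy
          have h2 := norm_sub_norm_le z y
          rw [norm_sub_rev] at h2
          have h3 : 1 - ‖y‖ ^ 2 ≤ 2 * ‖y - z‖ := by nlinarith [norm_nonneg y]
          have h4 : 0 ≤ 1 - ‖y‖ ^ 2 := by nlinarith [norm_nonneg y]
          gcongr
          nlinarith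
        · rw [hF, indicator_of_notMem hy, norm_zero]
          positivity
      have := hO.hasFDerivAt (𝕜 := ℝ) one_lt_two
      refine HasFDerivAt.congr_fderiv this ?_
      refine ContinuousLinearMap.ext fun v => ?_
      simp
  have hFc : Continuous F := continuous_iff_continuousAt.2 fun z => (hderiv z).continuousAt
  have hFi : Integrable F μ := by
    have h : IntegrableOn F B μ := Measure.integrableOn_of_bounded (M := C)
      measure_ball_lt_top.ne hFc.aestronglyMeasurable (.of_forall hFC)
    rw [← integrable_indicator_iff measurableSet_ball, hF, indicator_indicator, inter_self] at h
    exact h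
  have hAi : Integrable A μ := (integrable_indicator_iff measurableSet_ball).2 ha
  have hAi' : Integrable A' μ := (integrable_indicator_iff measurableSet_ball).2 hb
  have hi : ∀ v : ℂ, Integrable (fun z => A z * v + A' z * star v) μ := fun v =>
    (hAi.mul_const v).add (hAi'.mul_const _)
  have key : ∀ v : ℂ, (∫ z, A z ∂μ) * v + (∫ z, A' z ∂μ) * star v = 0 := fun v => by
    have := integral_bilinear_hasLineDerivAt_right_eq_neg_left_of_integrable (μ := μ) (v := v)
      (f := fun _ => (1 : ℂ)) (f' := fun _ => 0) (g := F) (g' := fun z => A z * v + A' z * star v)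
      (B := ContinuousLinearMap.mul ℝ ℂ) (by simp)
      (by simpa using hi v) (by simpa using hFi)
      (fun z _ => by simpa using (hasFDerivAt_const (𝕜 := ℝ) (1 : ℂ) z).hasLineDerivAt v)
      (fun z _ => by simpa using HasFDerivAt.hasLineDerivAt (hderiv z) v)
    simp only [ContinuousLinearMap.mul_apply', one_mul, zero_mul, integral_zero, neg_zero] at this
    rw [integral_add (hAi.mul_const v) (hAi'.mul_const _), integral_mul_const,
      integral_mul_const] at this
    exact this
  rw [← integral_indicator measurableSet_ball]
  have h1 := key 1
  have h2 := key Complex.I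
  simp only [star_one, mul_one, Complex.star_def, Complex.conj_I] at h1 h2
  have h3 : ((∫ z, A z ∂μ) - ∫ z, A' z ∂μ) * Complex.I = 0 := by linear_combination h2
  have h4 := (mul_eq_zero.1 h3).resolve_right Complex.I_ne_zero
  linear_combination (h1 + h4) / 2

end

section

theorem jacDet_eq_deriv (f : ℂ → ℂ) (z : ℂ) : jacDet f z = deriv f z := by
  rw [jacDet, LinearMap.det_ring]
  simp

variable (μ : Measure ℂ) [μ.IsAddHaarMeasure]

omit [μ.IsAddHaarMeasure] in
theorem ContinuousOn.integrableOn_ball_of_bounded [IsFiniteMeasureOnCompacts μ] {f : ℂ → ℂ}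
    (hf : ContinuousOn f (ball 0 1)) {C : ℝ} (hC : ∀ z ∈ ball (0 : ℂ) 1, ‖f z‖ ≤ C) :
    IntegrableOn f (ball 0 1) μ :=
  .of_bound measure_ball_lt_top (hf.aestronglyMeasurable measurableSet_ball) C
    ((ae_restrict_iff' measurableSet_ball).2 (.of_forall hC))

omit [μ.IsAddHaarMeasure] in
theorem IsAutOn.exists_bound_jacDet {γ : ℂ → ℂ} (hγ : IsAutOn (ball (0 : ℂ) 1) γ) :
    ∃ C ≥ 0, ∀ z ∈ ball (0 : ℂ) 1, ‖jacDet γ z‖ ≤ C ∧ 1 - ‖γ z‖ ^ 2 ≤ C * (1 - ‖z‖ ^ 2) := by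
  obtain ⟨c, hc, -, h⟩ := hγ.exists_norm_jacDet_eq
  have hd : 0 ≤ 1 - ‖c‖ ^ 2 := by nlinarith [norm_nonneg c]
  have hc' : 0 < 1 - ‖c‖ := by linarith
  refine ⟨(1 - ‖c‖ ^ 2) / (1 - ‖c‖) ^ 2, by positivity, fun z hz => ?_⟩
  have hz' : ‖z‖ < 1 := mem_ball_zero_iff.1 hz
  have ht : 0 ≤ 1 - ‖z‖ ^ 2 := by nlinarith [norm_nonneg z]
  have h1 : 1 - ‖c‖ ≤ ‖1 - inner ℂ c z‖ := by
    have h2 := norm_inner_le_norm (𝕜 := ℂ) c z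
    have h3 := norm_sub_norm_le (1 : ℂ) (inner ℂ c z)
    rw [norm_one] at h3
    nlinarith [norm_nonneg c]
  rw [(h z hz).1, (h z hz).2, Module.finrank_self, div_pow, Real.sq_sqrt hd]
  refine ⟨by gcongr, ?_⟩
  rw [div_mul_eq_mul_div]
  gcongr

/-- Integration by parts on the disc for `(ψ ∘ γ) γ' ψ̄`, where `ψ = ∂φ` and `φ` vanishes to second
order at the boundary. -/
theorem IsAutOn.setIntegral_comp_mul_jacDet_mul_star {γ : ℂ → ℂ}
    (hγ : IsAutOn (ball (0 : ℂ) 1) γ) {φ φ' ψ ψ' ψ'' : ℂ → ℂ}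
    (hφ : ∀ z ∈ ball (0 : ℂ) 1, HasWirtingerAt φ (ψ z) (φ' z) z)
    (hψ : ∀ z ∈ ball (0 : ℂ) 1, HasWirtingerAt ψ (ψ' z) (ψ'' z) z)
    {C : ℝ} (hφC : ∀ z ∈ ball (0 : ℂ) 1, ‖φ z‖ ≤ C * (1 - ‖z‖ ^ 2) ^ 2)
    (hφ'c : ContinuousOn φ' (closedBall 0 1)) (hψc : ContinuousOn ψ (closedBall 0 1))
    (hψ'c : ContinuousOn ψ' (closedBall 0 1)) (hψ''c : ContinuousOn ψ'' (closedBall 0 1)) :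
    ∫ z in ball (0 : ℂ) 1, ψ (γ z) * jacDet γ z * star (ψ z) ∂μ
      = -∫ z in ball (0 : ℂ) 1, φ (γ z) * star (ψ'' z) ∂μ := by
  have hsub : ball (0 : ℂ) 1 ⊆ closedBall 0 1 := ball_subset_closedBall
  obtain ⟨K, hK0, hK⟩ := hγ.exists_bound_jacDet
  have hbd : ∀ f : ℂ → ℂ, ContinuousOn f (closedBall 0 1) →
      ∃ M ≥ 0, ∀ z ∈ ball (0 : ℂ) 1, ‖f z‖ ≤ M := fun f hf => by
    obtain ⟨M, hM⟩ := (isCompact_closedBall (0 : ℂ) 1).exists_bound_of_continuousOn hf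
    exact ⟨M, (norm_nonneg _).trans (hM 0 (by simp)), fun z hz => hM z (hsub hz)⟩
  obtain ⟨M1, hM1, h1⟩ := hbd _ hφ'c
  obtain ⟨M2, hM2, h2⟩ := hbd _ hψc
  obtain ⟨M3, hM3, h3⟩ := hbd _ hψ'c
  obtain ⟨M4, hM4, h4⟩ := hbd _ hψ''c
  have hC0 : 0 ≤ C := by
    have := (norm_nonneg _).trans (hφC 0 (mem_ball_self one_pos))
    simpa using this
  have hφb : ∀ z ∈ ball (0 : ℂ) 1, ‖φ z‖ ≤ C := fun z hz => by
    refine (hφC z hz).trans (mul_le_of_le_one_right hC0 (pow_le_one₀ ?_ ?_)) <;>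
    nlinarith [norm_nonneg z, mem_ball_zero_iff.1 hz]
  have hm := hγ.2.1
  have hγc := hγ.1.continuousOn
  have hJc : ContinuousOn (jacDet γ) (ball 0 1) := (differentiableOn_jacDet isOpen_ball hγ.1).continuousOn
  have hφc : ContinuousOn φ (ball 0 1) := fun z hz => (hφ z hz).continuousAt.continuousWithinAt
  have hd : ∀ z ∈ ball (0 : ℂ) 1, HasDerivAt γ (jacDet γ z) z := fun z hz => by
    rw [jacDet_eq_deriv]
    exact (hγ.1.differentiableAt (isOpen_ball.mem_nhds hz)).hasDerivAt
  have hst : Continuous (star : ℂ → ℂ) := continuous_star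
  have ia1 : IntegrableOn (fun z => ψ (γ z) * jacDet γ z * star (ψ z)) (ball 0 1) μ := by
    refine ContinuousOn.integrableOn_ball_of_bounded μ ((((hψc.mono hsub).comp hγc hm).mul hJc).mul
      (hst.comp_continuousOn (hψc.mono hsub))) (C := M2 * K * M2) fun z hz => ?_
    rw [norm_mul, norm_mul, norm_star]
    gcongr
    exacts [h2 _ (hm hz), (hK z hz).1, h2 _ hz]
  have ia2 : IntegrableOn (fun z => φ (γ z) * star (ψ'' z)) (ball 0 1) μ := by
    refine ContinuousOn.integrableOn_ball_of_bounded μ ((hφc.comp hγc hm).mul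
      (hst.comp_continuousOn (hψ''c.mono hsub))) (C := C * M4) fun z hz => ?_
    rw [norm_mul, norm_star]
    gcongr
    exacts [hφb _ (hm hz), h4 _ hz]
  have ib1 : IntegrableOn (fun z => φ' (γ z) * star (jacDet γ z) * star (ψ z)) (ball 0 1) μ := by
    refine ContinuousOn.integrableOn_ball_of_bounded μ ((((hφ'c.mono hsub).comp hγc hm).mul
      (hst.comp_continuousOn hJc)).mul
      (hst.comp_continuousOn (hψc.mono hsub))) (C := M1 * K * M2) fun z hz => ?_
    rw [norm_mul, norm_mul, norm_star, norm_star]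
    gcongr
    exacts [h1 _ (hm hz), (hK z hz).1, h2 _ hz]
  have ib2 : IntegrableOn (fun z => φ (γ z) * star (ψ' z)) (ball 0 1) μ := by
    refine ContinuousOn.integrableOn_ball_of_bounded μ ((hφc.comp hγc hm).mul
      (hst.comp_continuousOn (hψ'c.mono hsub))) (C := C * M3) fun z hz => ?_
    rw [norm_mul, norm_star]
    gcongr
    exacts [hφb _ (hm hz), h3 _ hz]
  have key := setIntegral_eq_zero_of_hasWirtingerAt (μ := μ)
    (f := fun z => φ (γ z) * star (ψ z)) (C := C * K ^ 2 * M2)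
    (a := fun z => ψ (γ z) * jacDet γ z * star (ψ z) + φ (γ z) * star (ψ'' z))
    (b := fun z => φ' (γ z) * star (jacDet γ z) * star (ψ z) + φ (γ z) * star (ψ' z))
    (fun z hz => ((hφ _ (hm hz)).comp_hasDerivAt (hd z hz)).mul (hψ z hz).star)
    (fun z hz => ?_) (ia1.add ia2) (ib1.add ib2)
  · rw [integral_add ia1 ia2] at key
    linear_combination key
  · have ht : 0 ≤ 1 - ‖γ z‖ ^ 2 := by nlinarith [norm_nonneg (γ z), mem_ball_zero_iff.1 (hm hz)]
    rw [norm_mul, norm_star]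
    calc ‖φ (γ z)‖ * ‖ψ z‖ ≤ C * (1 - ‖γ z‖ ^ 2) ^ 2 * M2 := by
          gcongr
          exacts [hφC _ (hm hz), h2 z hz]
      _ ≤ C * (K * (1 - ‖z‖ ^ 2)) ^ 2 * M2 := by
          gcongr
          exact (hK z hz).2
      _ = _ := by ring

end

section

variable (μ : Measure ℂ) [μ.IsAddHaarMeasure]

theorem IsAutOn.setIntegral_one_sub_norm_sq_mul_le {γ : ℂ → ℂ} (hγ : IsAutOn (ball (0 : ℂ) 1) γ)
    {h : ℝ → ℝ} (hh : IntegrableOn (fun z : ℂ => h ‖z‖) (ball 0 1) μ)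
    (h0 : ∀ z ∈ ball (0 : ℂ) 1, 0 ≤ h ‖z‖) :
    ∫ z in ball (0 : ℂ) 1, (1 - ‖γ z‖ ^ 2) * h ‖z‖ ∂μ
      ≤ (1 - ‖γ 0‖ ^ 2) * ∫ z in ball (0 : ℂ) 1, h ‖z‖ ∂μ := by
  obtain ⟨c, hc, hc0, hγc⟩ := hγ.exists_norm_jacDet_eq
  rw [hc0]
  have hd : 0 ≤ 1 - ‖c‖ ^ 2 := by nlinarith [norm_nonneg c]
  set Ω : Set ℂ := {z | ‖inner ℂ c z‖ < 1} with hΩ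
  have hΩo : IsOpen Ω := isOpen_lt (by fun_prop) continuous_const
  have hsub : closedBall 0 1 ⊆ Ω := fun z hz => by
    have h2 := norm_inner_le_norm (𝕜 := ℂ) c z
    have h3 := mem_closedBall_zero_iff.1 hz
    rw [hΩ, mem_ofPred_eq]
    nlinarith [norm_nonneg c, norm_nonneg z]
  have hne : ∀ z ∈ Ω, 1 - inner ℂ c z ≠ 0 := fun z hz h => by
    have h4 : ‖inner ℂ c z‖ < 1 := hz
    rw [← sub_eq_zero.1 h, norm_one] at h4
    exact lt_irrefl _ h4
  set q : ℂ → ℂ := fun z => (1 + inner ℂ c z) / (1 - inner ℂ c z) with hq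
  have hin : Differentiable ℂ fun z => inner ℂ c z := (innerSL ℂ c).differentiable
  have hqd : DifferentiableOn ℂ q Ω := fun z hz =>
    (((hin z).const_add 1).div ((hin z).const_sub 1) (hne z hz)).differentiableWithinAt
  have hI := setIntegral_ball_radial_mul μ hΩo hsub hqd hh
  have hq0 : q 0 = 1 := by simp [hq]
  rw [hq0, mul_one] at hI
  obtain ⟨M, hM⟩ := (isCompact_closedBall (0 : ℂ) 1).exists_bound_of_continuousOn
    (hqd.continuousOn.mono hsub)
  have hi : IntegrableOn (fun z => (h ‖z‖ : ℂ) * q z) (ball 0 1) μ := by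
    refine Integrable.mul_bdd (c := M) hh.ofReal ?_ ?_
    · exact ((hqd.continuousOn.mono hsub).mono ball_subset_closedBall).aestronglyMeasurable
        measurableSet_ball
    · exact (ae_restrict_iff' measurableSet_ball).2
        (.of_forall fun z hz => hM z (ball_subset_closedBall hz))
  have hre : ∫ z in ball (0 : ℂ) 1, h ‖z‖ ∂μ = ∫ z in ball (0 : ℂ) 1, h ‖z‖ * (q z).re ∂μ := by
    have h1 := integral_re hi
    rw [hI] at h1
    simpa using h1.symm
  rw [hre, ← integral_const_mul]
  refine integral_mono_of_nonneg ?_ ?_ ?_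
  · refine (ae_restrict_iff' measurableSet_ball).2 (.of_forall fun z hz => ?_)
    have := mem_ball_zero_iff.1 (hγ.2.1 hz)
    exact mul_nonneg (by nlinarith [norm_nonneg (γ z)]) (h0 z hz)
  · have := hi.re.const_mul (1 - ‖c‖ ^ 2)
    simpa using this
  · refine (ae_restrict_iff' measurableSet_ball).2 (.of_forall fun z hz => ?_)
    have hz' := mem_ball_zero_iff.1 hz
    have hzΩ := hsub (ball_subset_closedBall hz)
    simp only
    rw [(hγc z hz).1]
    have h2 : ‖inner ℂ c z‖ ≤ ‖z‖ := (norm_inner_le_norm c z).trans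
      (mul_le_of_le_one_left (norm_nonneg _) hc.le)
    have h3 : (q z).re = (1 - ‖inner ℂ c z‖ ^ 2) / ‖1 - inner ℂ c z‖ ^ 2 := by
      simp only [hq]
      rw [Complex.div_re, ← Complex.normSq_eq_norm_sq, ← Complex.normSq_eq_norm_sq, ← add_div]
      congr 1
      simp [Complex.normSq_apply]
      ring
    rw [h3, mul_div_assoc, mul_assoc, mul_comm (h ‖z‖)]
    have h4 : ‖inner ℂ c z‖ ^ 2 ≤ ‖z‖ ^ 2 := by gcongr
    have := h0 z hz
    gcongr

theorem setIntegral_ball_two_mul_sq_div_le {ε : ℝ} (hε : 0 < ε) :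
    ∫ z in ball (0 : ℂ) 1, 2 * ε ^ 2 / (1 - ‖z‖ ^ 2 + ε) ^ 3 ∂μ ≤ μ.real (ball 0 1) := by
  set f : ℝ → ℝ := (Iio 1).indicator fun y => 2 * ε ^ 2 / (1 - y ^ 2 + ε) ^ 3 with hf
  have h1 : ∫ z in ball (0 : ℂ) 1, 2 * ε ^ 2 / (1 - ‖z‖ ^ 2 + ε) ^ 3 ∂μ = ∫ z, f ‖z‖ ∂μ := by
    rw [← integral_indicator measurableSet_ball]
    refine integral_congr_ae (.of_forall fun z => ?_)
    by_cases hz : ‖z‖ < 1 <;> simp [hf, indicator, hz]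
  have h2 : ∫ y in Ioi (0 : ℝ), y * f y = ∫ y in (0 : ℝ)..1, y * (2 * ε ^ 2 / (1 - y ^ 2 + ε) ^ 3) := by
    rw [intervalIntegral.integral_of_le zero_le_one, integral_Ioc_eq_integral_Ioo,
      ← integral_indicator measurableSet_Ioi, ← integral_indicator measurableSet_Ioo]
    refine integral_congr_ae (.of_forall fun y => ?_)
    by_cases hy : 0 < y <;> by_cases hy' : y < 1 <;> simp [hf, indicator, hy, hy']
  have hpos : ∀ y ∈ uIcc (0 : ℝ) 1, 0 < 1 - y ^ 2 + ε := fun y hy => by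
    rw [uIcc_of_le zero_le_one] at hy
    nlinarith [hy.1, hy.2]
  have h3 : ∫ y in (0 : ℝ)..1, y * (2 * ε ^ 2 / (1 - y ^ 2 + ε) ^ 3)
      = ε ^ 2 / (2 * (1 - 1 ^ 2 + ε) ^ 2) - ε ^ 2 / (2 * (1 - 0 ^ 2 + ε) ^ 2) := by
    refine intervalIntegral.integral_eq_sub_of_hasDerivAt
      (f := fun y => ε ^ 2 / (2 * (1 - y ^ 2 + ε) ^ 2)) (fun y hy => ?_) ?_
    · have hp := hpos y hy
      have := ((((hasDerivAt_pow 2 y).const_sub 1).add_const ε).pow 2).const_mul 2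
      refine ((hasDerivAt_const y (ε ^ 2)).div this (mul_pos two_pos (pow_pos hp 2)).ne').congr_deriv ?_
      simp
      field_simp
    · refine ContinuousOn.intervalIntegrable ?_
      refine continuousOn_id.mul (continuousOn_const.div (by fun_prop) fun y hy => ?_)
      exact (pow_pos (hpos y hy) 3).ne'
  rw [h1, integral_fun_norm_addHaar μ f, Complex.finrank_real_complex]
  simp only [Nat.add_one_sub_one, pow_one, smul_eq_mul, nsmul_eq_mul]
  rw [h2, h3]
  have h4 : 0 ≤ μ.real (ball (0 : ℂ) 1) := measureReal_nonneg
  have h5 : ε ^ 2 / (2 * (1 - 1 ^ 2 + ε) ^ 2) = 1 / 2 := by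
    field_simp
    ring
  have h6 : 0 ≤ ε ^ 2 / (2 * (1 - 0 ^ 2 + ε) ^ 2) := by positivity
  rw [h5]
  push_cast
  nlinarith

end

section

/-- A regularization of the identity function that vanishes to second order at `0`. -/
def cutoff (ε w : ℂ) : ℂ := w ^ 2 / (w + ε)

/-- The first derivative of `cutoff ε`. -/
def cutoffDeriv (ε w : ℂ) : ℂ := 1 - ε ^ 2 / (w + ε) ^ 2

/-- The second derivative of `cutoff ε`. -/
def cutoffDeriv₂ (ε w : ℂ) : ℂ := 2 * ε ^ 2 / (w + ε) ^ 3

theorem hasDerivAt_cutoff {ε w : ℂ} (h : w + ε ≠ 0) :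
    HasDerivAt (cutoff ε) (cutoffDeriv ε w) w := by
  refine ((hasDerivAt_pow 2 w).div ((hasDerivAt_id w).add_const ε) h).congr_deriv ?_
  simp only [cutoffDeriv, id]
  field_simp
  ring

theorem hasDerivAt_cutoffDeriv {ε w : ℂ} (h : w + ε ≠ 0) :
    HasDerivAt (cutoffDeriv ε) (cutoffDeriv₂ ε w) w := by
  refine (((hasDerivAt_const w (ε ^ 2)).div (((hasDerivAt_id w).add_const ε).pow 2)
    (pow_ne_zero 2 h)).const_sub 1).congr_deriv ?_
  simp only [cutoffDeriv₂, id]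
  field_simp
  simp
  ring

theorem norm_cutoff {ε t : ℝ} (hε : 0 < ε) (ht : 0 ≤ t) :
    ‖cutoff ε t‖ = t ^ 2 / (t + ε) := by
  rw [cutoff, ← Complex.ofReal_add, ← Complex.ofReal_pow, ← Complex.ofReal_div,
    Complex.norm_of_nonneg (by positivity)]

theorem norm_cutoff_le {ε t : ℝ} (hε : 0 < ε) (ht : 0 ≤ t) : ‖cutoff ε t‖ ≤ t := by
  rw [norm_cutoff hε ht, div_le_iff₀ (by positivity)]
  nlinarith

theorem norm_cutoff_le_div {ε t : ℝ} (hε : 0 < ε) (ht : 0 ≤ t) : ‖cutoff ε t‖ ≤ t ^ 2 / ε := by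
  rw [norm_cutoff hε ht]
  gcongr
  linarith

theorem norm_cutoffDeriv {ε t : ℝ} (hε : 0 < ε) (ht : 0 ≤ t) :
    ‖cutoffDeriv ε t‖ = 1 - ε ^ 2 / (t + ε) ^ 2 := by
  have : ε ^ 2 / (t + ε) ^ 2 ≤ 1 := div_le_one_of_le₀ (by gcongr; linarith) (by positivity)
  rw [cutoffDeriv, ← Complex.norm_of_nonneg (sub_nonneg.2 this)]
  push_cast
  rfl

theorem norm_cutoffDeriv_le_one {ε t : ℝ} (hε : 0 < ε) (ht : 0 ≤ t) : ‖cutoffDeriv ε t‖ ≤ 1 := by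
  rw [norm_cutoffDeriv hε ht]
  have : 0 ≤ ε ^ 2 / (t + ε) ^ 2 := by positivity
  linarith

theorem norm_cutoffDeriv_le_div {ε t : ℝ} (hε : 0 < ε) (ht : 0 ≤ t) :
    ‖cutoffDeriv ε t‖ ≤ 2 * t / ε := by
  rw [norm_cutoffDeriv hε ht, sub_le_iff_le_add, div_add_div _ _ hε.ne' (by positivity),
    one_le_div (by positivity)]
  nlinarith [mul_nonneg ht (sq_nonneg t), mul_nonneg ht (sq_nonneg ε), mul_nonneg hε.le (sq_nonneg t)]

theorem norm_cutoffDeriv₂ {ε t : ℝ} (hε : 0 < ε) (ht : 0 ≤ t) :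
    ‖cutoffDeriv₂ ε t‖ = 2 * ε ^ 2 / (t + ε) ^ 3 := by
  rw [cutoffDeriv₂, ← Complex.norm_of_nonneg (r := 2 * ε ^ 2 / (t + ε) ^ 3) (by positivity)]
  push_cast
  rfl

theorem one_sub_mul_star_eq (z : ℂ) : 1 - z * star z = ((1 - ‖z‖ ^ 2 : ℝ) : ℂ) := by
  rw [Complex.star_def, Complex.mul_conj, Complex.normSq_eq_norm_sq]
  push_cast
  rfl

theorem hasWirtingerAt_one_sub_mul_star (z : ℂ) :
    HasWirtingerAt (fun z => 1 - z * star z) (-star z) (-z) z := by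
  have := ((hasDerivAt_const z (1 : ℂ)).hasWirtingerAt).add
    ((hasDerivAt_id z).hasWirtingerAt.mul (hasWirtingerAt_conj z)).neg
  simpa [sub_eq_add_neg] using this

/-- For `k` holomorphic, `∂(k(z) λ(1 - |z|²))`, where `λ` is the cutoff. -/
theorem hasWirtingerAt_mul_cutoff {k : ℂ → ℂ} {k' z ε : ℂ} (hk : HasDerivAt k k' z)
    (h : 1 - z * star z + ε ≠ 0) :
    HasWirtingerAt (fun z => k z * cutoff ε (1 - z * star z))
      (k' * cutoff ε (1 - z * star z) - k z * (star z * cutoffDeriv ε (1 - z * star z)))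
      (-(k z * (z * cutoffDeriv ε (1 - z * star z)))) z := by
  refine (hk.hasWirtingerAt.mul
    ((hasDerivAt_cutoff h).comp_hasWirtingerAt (g := fun z => 1 - z * star z)
      (hasWirtingerAt_one_sub_mul_star z))).congr ?_ ?_ <;>
  ring

theorem hasWirtingerAt_mul_cutoffDeriv {k : ℂ → ℂ} {k' z ε : ℂ} (hk : HasDerivAt k k' z)
    (h : 1 - z * star z + ε ≠ 0) :
    HasWirtingerAt (fun z => k z * (star z * cutoffDeriv ε (1 - z * star z)))
      (k' * (star z * cutoffDeriv ε (1 - z * star z))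
        - k z * (star z ^ 2 * cutoffDeriv₂ ε (1 - z * star z)))
      (k z * cutoffDeriv ε (1 - z * star z)
        - k z * (z * star z * cutoffDeriv₂ ε (1 - z * star z))) z := by
  refine (hk.hasWirtingerAt.mul ((hasWirtingerAt_conj z).mul
    ((hasDerivAt_cutoffDeriv h).comp_hasWirtingerAt (g := fun z => 1 - z * star z)
      (hasWirtingerAt_one_sub_mul_star z)))).congr ?_ ?_ <;>
  ring

theorem continuousOn_cutoff {ε : ℝ} (hε : 0 < ε) :
    ContinuousOn (fun z : ℂ => cutoff ε (1 - z * star z)) (closedBall 0 1) ∧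
    ContinuousOn (fun z : ℂ => cutoffDeriv ε (1 - z * star z)) (closedBall 0 1) ∧
    ContinuousOn (fun z : ℂ => cutoffDeriv₂ ε (1 - z * star z)) (closedBall 0 1) := by
  have hne : ∀ z ∈ closedBall (0 : ℂ) 1, 1 - z * star z + ε ≠ 0 := fun z hz => by
    have hz' := mem_closedBall_zero_iff.1 hz
    rw [one_sub_mul_star_eq, ← Complex.ofReal_add, Complex.ofReal_ne_zero]
    nlinarith [norm_nonneg z]
  have hc : Continuous fun z : ℂ => 1 - z * star z + ε := by fun_prop
  refine ⟨?_, ?_, ?_⟩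
  · exact ContinuousOn.div (by fun_prop) hc.continuousOn hne
  · exact continuousOn_const.sub (ContinuousOn.div continuousOn_const (hc.pow 2).continuousOn
      fun z hz => pow_ne_zero 2 (hne z hz))
  · exact ContinuousOn.div continuousOn_const (hc.pow 3).continuousOn
      fun z hz => pow_ne_zero 3 (hne z hz)

variable (μ : Measure ℂ) [μ.IsAddHaarMeasure]

/-- A function holomorphic near the closed disc agrees, up to an error vanishing at the boundary,
with a limit of functions `ψ` for which `∫ (ψ ∘ γ) γ' ψ̄` is controlled by `1 - |γ(0)|²`. -/
theorem HolomorphicNearBall.exists_approx {g : ℂ → ℂ} (hg : HolomorphicNearBall g) :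
    ∃ (ψ : ℕ → ℂ → ℂ) (k : ℂ → ℂ) (C K : ℝ),
      ContinuousOn k (ball 0 1) ∧ (∀ z ∈ ball (0 : ℂ) 1, ‖k z‖ ≤ C) ∧
      (∀ n, ContinuousOn (ψ n) (ball 0 1)) ∧ (∀ n, ∀ z ∈ ball (0 : ℂ) 1, ‖ψ n z‖ ≤ C) ∧
      (∀ n, ∃ A, ∀ z ∈ ball (0 : ℂ) 1, ‖ψ n z‖ ≤ A * (1 - ‖z‖ ^ 2)) ∧
      (∀ z ∈ ball (0 : ℂ) 1,
        Tendsto (fun n => ψ n z) atTop (𝓝 (g z - ((1 - ‖z‖ ^ 2 : ℝ) : ℂ) * k z))) ∧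
      ∀ n, ∀ γ : ℂ → ℂ, IsAutOn (ball (0 : ℂ) 1) γ →
        ‖∫ z in ball (0 : ℂ) 1, ψ n (γ z) * jacDet γ z * star (ψ n z) ∂μ‖
          ≤ K * (1 - ‖γ 0‖ ^ 2) := by
  obtain ⟨R, hR, hgR⟩ := hg
  have hg1R := hgR.deriv isOpen_ball
  have hg2R := hg1R.deriv isOpen_ball
  have hsub : ball (0 : ℂ) 1 ⊆ closedBall 0 1 := ball_subset_closedBall
  have hsubR : closedBall (0 : ℂ) 1 ⊆ ball 0 R := closedBall_subset_ball hR
  set g1 := deriv g with hg1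
  set g2 := deriv g1 with hg2
  have hgc := hgR.continuousOn.mono hsubR
  have hg1c := hg1R.continuousOn.mono hsubR
  have hg2c := hg2R.continuousOn.mono hsubR
  obtain ⟨M', hM'⟩ := (isCompact_closedBall (0 : ℂ) 1).exists_bound_of_continuousOn hgc
  obtain ⟨M'', hM''⟩ := (isCompact_closedBall (0 : ℂ) 1).exists_bound_of_continuousOn hg1c
  set M := max M' M'' with hMdef
  have hM : ∀ z ∈ ball (0 : ℂ) 1, ‖g z‖ ≤ M := fun z hz => (hM' z (hsub hz)).trans (le_max_left _ _)
  have hM1 : ∀ z ∈ ball (0 : ℂ) 1, ‖g1 z‖ ≤ M :=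
    fun z hz => (hM'' z (hsub hz)).trans (le_max_right _ _)
  have hM0 : 0 ≤ M := (norm_nonneg _).trans (hM 0 (mem_ball_self one_pos))
  have hd : ∀ z ∈ ball (0 : ℂ) 1, HasDerivAt g (g1 z) z := fun z hz =>
    (hgR.differentiableAt (isOpen_ball.mem_nhds (hsubR (hsub hz)))).hasDerivAt
  have hd1 : ∀ z ∈ ball (0 : ℂ) 1, HasDerivAt g1 (g2 z) z := fun z hz =>
    (hg1R.differentiableAt (isOpen_ball.mem_nhds (hsubR (hsub hz)))).hasDerivAt
  set k1 : ℂ → ℂ := fun z => g z + z * g1 z with hk1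
  have hk1M : ∀ z ∈ ball (0 : ℂ) 1, ‖k1 z‖ ≤ 2 * M := fun z hz => by
    refine (norm_add_le _ _).trans ?_
    have h1 := hM z hz
    have h2 : ‖z * g1 z‖ ≤ 1 * M := by
      rw [norm_mul]
      gcongr
      exacts [(mem_ball_zero_iff.1 hz).le, hM1 z hz]
    linarith
  have hkd : ∀ z ∈ ball (0 : ℂ) 1, HasDerivAt (fun z => z * g z) (k1 z) z := fun z hz =>
    ((hasDerivAt_id z).mul (hd z hz)).congr_deriv (by simp [hk1])
  have hkd1 : ∀ z ∈ ball (0 : ℂ) 1, HasDerivAt k1 (g1 z + (g1 z + z * g2 z)) z := fun z hz =>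
    ((hd z hz).add ((hasDerivAt_id z).mul (hd1 z hz))).congr_deriv (by simp)
  have hk1c : ContinuousOn k1 (closedBall 0 1) := by fun_prop
  have ht : ∀ z ∈ ball (0 : ℂ) 1, 0 ≤ 1 - ‖z‖ ^ 2 ∧ 1 - ‖z‖ ^ 2 ≤ 1 := fun z hz => by
    constructor <;> nlinarith [norm_nonneg z, mem_ball_zero_iff.1 hz]
  set φ : ℝ → ℂ → ℂ := fun ε z => -(z * g z * cutoff ε (1 - z * star z)) with hφ
  set ψ : ℝ → ℂ → ℂ := fun ε z => -(k1 z * cutoff ε (1 - z * star z))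
    + z * g z * (star z * cutoffDeriv ε (1 - z * star z)) with hψ
  have hne : ∀ {ε : ℝ}, 0 < ε → ∀ z ∈ ball (0 : ℂ) 1, 1 - z * star z + ε ≠ 0 :=
    fun hε z hz => by
      rw [one_sub_mul_star_eq, ← Complex.ofReal_add, Complex.ofReal_ne_zero]
      linarith [(ht z hz).1]
  have hzg : ∀ z ∈ ball (0 : ℂ) 1, ‖z * g z‖ ≤ M := fun z hz => by
    rw [norm_mul]
    exact (mul_le_of_le_one_left (norm_nonneg _) (mem_ball_zero_iff.1 hz).le).trans (hM z hz)
  have hφM : ∀ {ε : ℝ}, 0 < ε → ∀ z ∈ ball (0 : ℂ) 1, ‖φ ε z‖ ≤ M * (1 - ‖z‖ ^ 2) ∧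
      ‖φ ε z‖ ≤ M / ε * (1 - ‖z‖ ^ 2) ^ 2 := fun {ε} hε z hz => by
    simp only [hφ]
    rw [norm_neg, norm_mul, one_sub_mul_star_eq]
    have h1 := norm_cutoff_le hε (ht z hz).1
    have h2 := norm_cutoff_le_div hε (ht z hz).1
    have h3 := hzg z hz
    refine ⟨by gcongr, ?_⟩
    rw [div_mul_eq_mul_div, mul_div_assoc]
    gcongr
  have hψM : ∀ {ε : ℝ}, 0 < ε → ∀ z ∈ ball (0 : ℂ) 1, ∀ a b : ℝ, 0 ≤ a → 0 ≤ b →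
      ‖cutoff ε (1 - ‖z‖ ^ 2 : ℝ)‖ ≤ a → ‖cutoffDeriv ε (1 - ‖z‖ ^ 2 : ℝ)‖ ≤ b →
      ‖ψ ε z‖ ≤ 2 * M * a + M * b := fun {ε} hε z hz a b ha hb h1 h2 => by
    simp only [hψ]
    rw [one_sub_mul_star_eq]
    refine (norm_add_le _ _).trans (add_le_add ?_ ?_)
    · rw [norm_neg, norm_mul]
      have := hk1M z hz
      gcongr
    · rw [norm_mul, norm_mul (star z), norm_star]
      have := hzg z hz
      gcongr
      exact (mul_le_of_le_one_left (norm_nonneg _) (mem_ball_zero_iff.1 hz).le).trans h2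
  have hψ'M : ∀ {ε : ℝ}, 0 < ε → ∀ z ∈ ball (0 : ℂ) 1,
      ‖k1 z * (z * cutoffDeriv ε (1 - z * star z)) + (z * g z * cutoffDeriv ε (1 - z * star z)
        - z * g z * (z * star z * cutoffDeriv₂ ε (1 - z * star z)))‖
        ≤ M * (3 + 2 * ε ^ 2 / (1 - ‖z‖ ^ 2 + ε) ^ 3) := fun {ε} hε z hz => by
    rw [one_sub_mul_star_eq]
    have h1 := norm_cutoffDeriv_le_one hε (ht z hz).1
    have h2 := norm_cutoffDeriv₂ hε (ht z hz).1
    have h3 := (mem_ball_zero_iff.1 hz).le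
    have h4 := hzg z hz
    have h5 := hk1M z hz
    set d1 := cutoffDeriv ε (1 - ‖z‖ ^ 2 : ℝ)
    set d2 := cutoffDeriv₂ ε (1 - ‖z‖ ^ 2 : ℝ)
    have h6 : ‖k1 z * (z * d1)‖ ≤ 2 * M * (1 * 1) := by
      rw [norm_mul, norm_mul]
      gcongr
    have h7 : ‖z * g z * d1‖ ≤ M * 1 := by
      rw [norm_mul]
      gcongr
    have h8 : ‖z * g z * (z * star z * d2)‖ ≤ M * (1 * 1 * ‖d2‖) := by
      rw [norm_mul (z * g z), norm_mul (z * star z), norm_mul z (star z), norm_star]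
      gcongr
    rw [← h2]
    have h9 := norm_add_le (k1 z * (z * d1)) (z * g z * d1 - z * g z * (z * star z * d2))
    have h10 := norm_sub_le (z * g z * d1) (z * g z * (z * star z * d2))
    linarith
  set ε : ℕ → ℝ := fun n => 1 / ((n : ℝ) + 1) with hε
  have hεpos : ∀ n, 0 < ε n := fun n => by positivity
  have hzgc : ContinuousOn (fun z => z * g z) (closedBall 0 1) := by fun_prop
  have hsc : Continuous (star : ℂ → ℂ) := continuous_star
  have hψc : ∀ n, ContinuousOn (ψ (ε n)) (closedBall 0 1) := fun n =>
    (hk1c.mul (continuousOn_cutoff (hεpos n)).1).neg.add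
      (hzgc.mul (hsc.continuousOn.mul (continuousOn_cutoff (hεpos n)).2.1))
  refine ⟨fun n => ψ (ε n), fun z => g z + k1 z, 3 * M, M ^ 2 * (4 * μ.real (ball 0 1)),
    (hgc.add hk1c).mono hsub, fun z hz => ?_, fun n => (hψc n).mono hsub, fun n z hz => ?_,
    fun n => ⟨2 * M + M * (2 / ε n), fun z hz => ?_⟩, fun z hz => ?_, fun n γ hγ => ?_⟩
  · have := norm_add_le (g z) (k1 z)
    linarith [hM z hz, hk1M z hz]
  · have := hψM (hεpos n) z hz 1 1 zero_le_one zero_le_one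
      ((norm_cutoff_le (hεpos n) (ht z hz).1).trans (ht z hz).2)
      (norm_cutoffDeriv_le_one (hεpos n) (ht z hz).1)
    linarith
  · have h1 := (ht z hz).1
    have h2 := hεpos n
    refine (hψM h2 z hz _ (2 * (1 - ‖z‖ ^ 2) / ε n) h1 (by positivity)
      (norm_cutoff_le h2 h1) (norm_cutoffDeriv_le_div h2 h1)).trans_eq ?_
    ring
  · have hz0 : 1 - z * star z ≠ 0 := by
      rw [one_sub_mul_star_eq, Complex.ofReal_ne_zero]
      nlinarith [norm_nonneg z, mem_ball_zero_iff.1 hz]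
    have h1 : Tendsto (fun n => (ε n : ℂ)) atTop (𝓝 0) := by
      have := (Complex.continuous_ofReal.tendsto 0).comp
        (tendsto_one_div_add_atTop_nhds_zero_nat (𝕜 := ℝ))
      rw [Complex.ofReal_zero] at this
      exact this
    have h2 : Tendsto (fun n => 1 - z * star z + (ε n : ℂ)) atTop (𝓝 (1 - z * star z)) := by
      simpa using h1.const_add (1 - z * star z)
    have h3 : Tendsto (fun n => cutoff (ε n) (1 - z * star z)) atTop (𝓝 (1 - z * star z)) := by
      have := (tendsto_const_nhds (x := (1 - z * star z) ^ 2)).div h2 hz0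
      rw [show (1 - z * star z) ^ 2 / (1 - z * star z) = 1 - z * star z by field_simp] at this
      exact this
    have h4 : Tendsto (fun n => cutoffDeriv (ε n) (1 - z * star z)) atTop (𝓝 1) := by
      have := ((h1.pow 2).div (h2.pow 2) (pow_ne_zero 2 hz0)).const_sub 1
      simpa [cutoffDeriv] using this
    have h5 := (h3.const_mul (k1 z)).neg.add ((h4.const_mul (star z)).const_mul (z * g z))
    convert h5 using 2
    rw [← one_sub_mul_star_eq]
    ring
  · have hε0 := hεpos n
    have c0 := (continuousOn_cutoff hε0).1
    have c1 := (continuousOn_cutoff hε0).2.1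
    have c2 := (continuousOn_cutoff hε0).2.2
    have h1 : ContinuousOn (fun z => star z) (closedBall (0 : ℂ) 1) := hsc.continuousOn
    rw [hγ.setIntegral_comp_mul_jacDet_mul_star μ (φ := φ (ε n)) (ψ := ψ (ε n))
      (φ' := fun z => z * g z * (z * cutoffDeriv (ε n) (1 - z * star z)))
      (ψ'' := fun z => k1 z * (z * cutoffDeriv (ε n) (1 - z * star z))
        + (z * g z * cutoffDeriv (ε n) (1 - z * star z)
        - z * g z * (z * star z * cutoffDeriv₂ (ε n) (1 - z * star z))))
      (fun z hz => ((hasWirtingerAt_mul_cutoff (hkd z hz) (hne hε0 z hz)).neg).congr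
        (by simp only [hψ]; ring) (by ring))
      (fun z hz => (((hasWirtingerAt_mul_cutoff (hkd1 z hz) (hne hε0 z hz)).neg).add
        (hasWirtingerAt_mul_cutoffDeriv (hkd z hz) (hne hε0 z hz))).congr rfl (by ring))
      (fun z hz => (hφM hε0 z hz).2)
      (hzgc.mul (continuousOn_id.mul c1)) (hψc n) (by fun_prop) (by fun_prop), norm_neg]
    have hcn : ContinuousOn (fun z : ℂ => 2 * ε n ^ 2 / (1 - ‖z‖ ^ 2 + ε n) ^ 3)
        (closedBall 0 1) := by
      refine continuousOn_const.div (by fun_prop) fun z hz => ?_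
      have : 0 < 1 - ‖z‖ ^ 2 + ε n := by
        nlinarith [norm_nonneg z, mem_closedBall_zero_iff.1 hz]
      positivity
    have hinteg : IntegrableOn (fun z : ℂ => 2 * ε n ^ 2 / (1 - ‖z‖ ^ 2 + ε n) ^ 3) (ball 0 1) μ :=
      (hcn.integrableOn_compact (isCompact_closedBall 0 1)).mono_set hsub
    set h : ℝ → ℝ := fun y => 3 + 2 * ε n ^ 2 / (1 - y ^ 2 + ε n) ^ 3 with hh
    have hcst : IntegrableOn (fun _ : ℂ => (3 : ℝ)) (ball 0 1) μ :=
      integrableOn_const measure_ball_lt_top.ne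
    have hint3 : IntegrableOn (fun z : ℂ => h ‖z‖) (ball 0 1) μ := hcst.add hinteg
    have h0 : ∀ z ∈ ball (0 : ℂ) 1, 0 ≤ h ‖z‖ := fun z hz => by
      have := (ht z hz).1
      simp only [hh]
      positivity
    have hγ0 : 0 ≤ 1 - ‖γ 0‖ ^ 2 := (ht _ (hγ.2.1 (mem_ball_self one_pos))).1
    have hle := hγ.setIntegral_one_sub_norm_sq_mul_le μ hint3 h0
    have hval : ∫ z in ball (0 : ℂ) 1, h ‖z‖ ∂μ ≤ 4 * μ.real (ball 0 1) := by
      have := setIntegral_ball_two_mul_sq_div_le μ hε0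
      simp only [hh]
      rw [integral_add hcst hinteg, setIntegral_const, smul_eq_mul]
      linarith
    have hinteg' : IntegrableOn (fun z : ℂ => M ^ 2 * ((1 - ‖γ z‖ ^ 2) * h ‖z‖)) (ball 0 1) μ := by
      refine Integrable.const_mul ?_ _
      refine Integrable.bdd_mul (c := 1) hint3 ?_ ?_
      · refine ContinuousOn.aestronglyMeasurable ?_ measurableSet_ball
        have := hγ.1.continuousOn
        fun_prop
      · refine (ae_restrict_iff' measurableSet_ball).2 (.of_forall fun z hz => ?_)
        obtain ⟨h2, h3⟩ := ht _ (hγ.2.1 hz)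
        rwa [Real.norm_of_nonneg h2]
    calc _ ≤ ∫ z in ball (0 : ℂ) 1, M ^ 2 * ((1 - ‖γ z‖ ^ 2) * h ‖z‖) ∂μ := by
          refine norm_integral_le_of_norm_le hinteg' ?_
          refine (ae_restrict_iff' measurableSet_ball).2 (.of_forall fun z hz => ?_)
          rw [norm_mul, norm_star]
          refine (mul_le_mul (hφM hε0 _ (hγ.2.1 hz)).1 (hψ'M hε0 z hz) (norm_nonneg _) ?_).trans_eq ?_
          · exact mul_nonneg hM0 (ht _ (hγ.2.1 hz)).1
          · simp only [hh]
            ring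
      _ = M ^ 2 * ∫ z in ball (0 : ℂ) 1, (1 - ‖γ z‖ ^ 2) * h ‖z‖ ∂μ := integral_const_mul _ _
      _ ≤ M ^ 2 * ((1 - ‖γ 0‖ ^ 2) * (4 * μ.real (ball 0 1))) := by gcongr; exact hle.trans (by gcongr)
      _ = _ := by ring

end

section

section

variable {V W : Type*} [NormedAddCommGroup V] [InnerProductSpace ℂ V] [NormedAddCommGroup W]
  [InnerProductSpace ℂ W] (e : W ≃ₗᵢ[ℂ] V)

theorem IsAutOn.conj {γ : V → V} (hγ : IsAutOn (ball (0 : V) 1) γ) :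
    IsAutOn (ball (0 : W) 1) (e.symm ∘ γ ∘ e) := by
  have hm : MapsTo e (ball (0 : W) 1) (ball (0 : V) 1) := fun z hz => by simpa using hz
  have hm' : MapsTo e.symm (ball (0 : V) 1) (ball (0 : W) 1) := fun z hz => by simpa using hz
  have hd : ∀ f : V → V, DifferentiableOn ℂ f (ball 0 1) →
      DifferentiableOn ℂ (e.symm ∘ f ∘ e) (ball 0 1) := fun f hf =>
    e.symm.differentiable.comp_differentiableOn (hf.comp e.differentiable.differentiableOn hm)
  obtain ⟨h1, h2, σ, h3, h4, h5, h6⟩ := hγ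
  refine ⟨hd _ h1, hm'.comp (h2.comp hm), e.symm ∘ σ ∘ e, hd _ h3, hm'.comp (h4.comp hm),
    fun z hz => ?_, fun z hz => ?_⟩
  · simpa using congrArg e.symm (h5 (hm hz))
  · simpa using congrArg e.symm (h6 (hm hz))

theorem jacDet_conj (γ : V → V) (z : W) : jacDet (e.symm ∘ γ ∘ e) z = jacDet γ (e z) := by
  have h : fderiv ℂ (e.symm ∘ γ ∘ e) z = (e.symm.toContinuousLinearEquiv : V →L[ℂ] W).comp
      ((fderiv ℂ γ (e z)).comp (e.toContinuousLinearEquiv : W →L[ℂ] V)) := by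
    have h1 := e.symm.toContinuousLinearEquiv.comp_fderiv (f := γ ∘ e) (x := z)
    have h2 := e.toContinuousLinearEquiv.comp_right_fderiv (f := γ) (x := z)
    exact h1.trans (congrArg _ h2)
  rw [jacDet, h, jacDet, ← LinearMap.det_conj _ e.symm.toLinearEquiv]
  rfl

end

theorem exists_linearIsometryEquiv_complex {V : Type*} [NormedAddCommGroup V]
    [InnerProductSpace ℂ V] [FiniteDimensional ℂ V] (h1 : Module.finrank ℂ V = 1) :
    Nonempty (ℂ ≃ₗᵢ[ℂ] V) := by
  have : Nontrivial V := Module.nontrivial_of_finrank_pos (R := ℂ) (by omega)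
  obtain ⟨v, hv⟩ := exists_norm_eq V zero_le_one
  exact ⟨(LinearIsometry.toSpanSingleton ℂ V hv).toLinearIsometryEquiv (by simp [h1])⟩

variable {V : Type*} [NormedAddCommGroup V] [InnerProductSpace ℂ V] [MeasurableSpace V]
  [BorelSpace V] [FiniteDimensional ℂ V] (μ : Measure V) [μ.IsAddHaarMeasure]

omit [FiniteDimensional ℂ V] [μ.IsAddHaarMeasure] in
theorem setIntegral_ball_map_symm {F : Type*} [NormedAddCommGroup F] [NormedSpace ℝ F]
    (e : ℂ ≃ₗᵢ[ℂ] V) (f : V → F) :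
    ∫ z in ball (0 : ℂ) 1, f (e z) ∂(μ.map e.symm) = ∫ x in ball (0 : V) 1, f x ∂μ := by
  have := (e.symm.continuous.measurable.measurePreserving μ).setIntegral_preimage_emb
    e.symm.toHomeomorph.measurableEmbedding (fun z => f (e z)) (ball 0 1)
  rw [← this]
  have h : e.symm ⁻¹' ball (0 : ℂ) 1 = ball (0 : V) 1 := by
    ext x
    simp
  rw [h]
  simp

instance isAddHaarMeasure_map_symm (e : ℂ ≃ₗᵢ[ℂ] V) : (μ.map e.symm).IsAddHaarMeasure :=
  ContinuousLinearEquiv.isAddHaarMeasure_map e.symm.toContinuousLinearEquiv μ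

theorem IsAutOn.setIntegral_one_sub_norm_sq_le (h1 : Module.finrank ℂ V = 1) {γ : V → V}
    (hγ : IsAutOn (ball (0 : V) 1) γ) :
    ∫ x in ball (0 : V) 1, (1 - ‖γ x‖ ^ 2) ∂μ ≤ (1 - ‖γ 0‖ ^ 2) * μ.real (ball 0 1) := by
  obtain ⟨e⟩ := exists_linearIsometryEquiv_complex h1
  have h := (hγ.conj e).setIntegral_one_sub_norm_sq_mul_le (μ.map e.symm) (h := fun _ => 1)
    (integrableOn_const measure_ball_lt_top.ne) fun _ _ => zero_le_one
  have h2 := setIntegral_ball_map_symm μ e fun x => 1 - ‖γ x‖ ^ 2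
  have h3 := setIntegral_ball_map_symm μ e fun _ => (1 : ℝ)
  simp only [setIntegral_const, smul_eq_mul, mul_one, Function.comp_apply,
    LinearIsometryEquiv.norm_map, map_zero] at h h2 h3
  rwa [h2, h3] at h

theorem HolomorphicNearBall.exists_approx_of_finrank_eq_one (h1 : Module.finrank ℂ V = 1)
    {g : V → ℂ} (hg : HolomorphicNearBall g) :
    ∃ (ψ : ℕ → V → ℂ) (k : V → ℂ) (C K : ℝ),
      ContinuousOn k (ball 0 1) ∧ (∀ x ∈ ball (0 : V) 1, ‖k x‖ ≤ C) ∧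
      (∀ n, ContinuousOn (ψ n) (ball 0 1)) ∧ (∀ n, ∀ x ∈ ball (0 : V) 1, ‖ψ n x‖ ≤ C) ∧
      (∀ n, ∃ A, ∀ x ∈ ball (0 : V) 1, ‖ψ n x‖ ≤ A * (1 - ‖x‖ ^ 2)) ∧
      (∀ x ∈ ball (0 : V) 1, Tendsto (fun n => ψ n x) atTop
        (𝓝 (g x - ((1 - ‖x‖ ^ 2 : ℝ) : ℂ) * k x))) ∧
      ∀ n, ∀ γ : V → V, IsAutOn (ball (0 : V) 1) γ →
        ‖∫ x in ball (0 : V) 1, ψ n (γ x) * jacDet γ x * star (ψ n x) ∂μ‖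
          ≤ K * (1 - ‖γ 0‖ ^ 2) := by
  obtain ⟨e⟩ := exists_linearIsometryEquiv_complex h1
  have hm : ∀ R, MapsTo e (ball (0 : ℂ) R) (ball (0 : V) R) := fun R z hz => by simpa using hz
  have hm' : MapsTo e.symm (ball (0 : V) 1) (ball (0 : ℂ) 1) := fun z hz => by simpa using hz
  have hg' : HolomorphicNearBall (g ∘ e) := by
    obtain ⟨R, hR, h⟩ := hg
    exact ⟨R, hR, h.comp e.differentiable.differentiableOn (hm R)⟩
  obtain ⟨ψ, k, C, K, hk, hkC, hψ, hψC, hA, hlim, hinteg⟩ := hg'.exists_approx (μ.map e.symm)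
  have hs : ContinuousOn e.symm (ball (0 : V) 1) := e.symm.continuous.continuousOn
  refine ⟨fun n => ψ n ∘ e.symm, k ∘ e.symm, C, K, hk.comp hs hm', fun x hx => hkC _ (hm' hx),
    fun n => (hψ n).comp hs hm', fun n x hx => hψC n _ (hm' hx), fun n => ?_, fun x hx => ?_,
    fun n γ hγ => ?_⟩
  · obtain ⟨A, hA⟩ := hA n
    exact ⟨A, fun x hx => by simpa using hA _ (hm' hx)⟩
  · simpa using hlim _ (hm' hx)
  · have h := hinteg n _ (hγ.conj e)
    rw [← setIntegral_ball_map_symm μ e]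
    simp only [jacDet_conj] at h
    simpa using h

end

section

variable {V : Type*} [NormedAddCommGroup V] [InnerProductSpace ℂ V] [MeasurableSpace V]
  [BorelSpace V] [FiniteDimensional ℂ V] (μ : Measure V) [μ.IsAddHaarMeasure]
  {G : Subgroup (Equiv.Perm V)} {D : Set V}

theorem IsBallGroup.tsum_lintegral_ne_top (hG : IsBallGroup G) (h1 : Module.finrank ℂ V = 1)
    {ψ : V → ℂ} {A : ℝ} (hA : ∀ x ∈ ball (0 : V) 1, ‖ψ x‖ ≤ A * (1 - ‖x‖ ^ 2)) :
    ∑' g : G, ∫⁻ x in ball (0 : V) 1, ‖ψ (g.1 x)‖ₑ * ‖jacDet g.1 x‖ₑ * ‖ψ x‖ₑ ∂μ ≠ ⊤ := by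
  have ht : ∀ x ∈ ball (0 : V) 1, 0 ≤ 1 - ‖x‖ ^ 2 ∧ 1 - ‖x‖ ^ 2 ≤ 1 := fun z hz => by
    constructor <;> nlinarith [norm_nonneg z, mem_ball_zero_iff.1 hz]
  have hA0 : 0 ≤ A := by
    have := (norm_nonneg _).trans (hA 0 (mem_ball_self one_pos))
    simpa using this
  refine ne_top_of_le_ne_top ((hG.summable.mul_left (A ^ 2)).mul_right
    (μ.real (ball 0 1))).tsum_ofReal_ne_top (ENNReal.tsum_le_tsum fun g => ?_)
  have hJ : ∀ x ∈ ball (0 : V) 1, ‖jacDet g.1 x‖ * (1 - ‖x‖ ^ 2) = 1 - ‖g.1 x‖ ^ 2 :=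
    fun x hx => by
      have := (hG.isAutOn g).norm_jacDet_mul hx
      rwa [h1, Real.sq_sqrt (ht x hx).1, Real.sq_sqrt (ht _ (hG.mapsTo g hx)).1] at this
  have hinteg : IntegrableOn (fun x => A ^ 2 * (1 - ‖g.1 x‖ ^ 2)) (ball 0 1) μ := by
    refine IntegrableOn.of_bound measure_ball_lt_top ?_ (A ^ 2) ?_
    · refine ContinuousOn.aestronglyMeasurable ?_ measurableSet_ball
      have := (hG.differentiableOn g).continuousOn
      fun_prop
    · refine (ae_restrict_iff' measurableSet_ball).2 (.of_forall fun x hx => ?_)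
      obtain ⟨h2, h3⟩ := ht _ (hG.mapsTo g hx)
      rw [Real.norm_of_nonneg (by positivity)]
      exact mul_le_of_le_one_right (sq_nonneg A) h3
  calc ∫⁻ x in ball (0 : V) 1, ‖ψ (g.1 x)‖ₑ * ‖jacDet g.1 x‖ₑ * ‖ψ x‖ₑ ∂μ
      ≤ ∫⁻ x in ball (0 : V) 1, ENNReal.ofReal (A ^ 2 * (1 - ‖g.1 x‖ ^ 2)) ∂μ := by
        refine setLIntegral_mono' measurableSet_ball fun x hx => ?_
        rw [← enorm_mul, ← enorm_mul, ← ofReal_norm]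
        refine ENNReal.ofReal_le_ofReal ?_
        obtain ⟨h2, h3⟩ := ht _ (hG.mapsTo g hx)
        rw [norm_mul, norm_mul, ← hJ x hx]
        calc ‖ψ (g.1 x)‖ * ‖jacDet g.1 x‖ * ‖ψ x‖
            ≤ A * ‖jacDet g.1 x‖ * (A * (1 - ‖x‖ ^ 2)) := by
              gcongr
              · exact (hA _ (hG.mapsTo g hx)).trans (mul_le_of_le_one_right hA0 h3)
              · exact hA x hx
          _ = A ^ 2 * (‖jacDet g.1 x‖ * (1 - ‖x‖ ^ 2)) := by ring
    _ = ENNReal.ofReal (∫ x in ball (0 : V) 1, A ^ 2 * (1 - ‖g.1 x‖ ^ 2) ∂μ) := by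
        rw [ofReal_integral_eq_lintegral_ofReal hinteg]
        refine (ae_restrict_iff' measurableSet_ball).2 (.of_forall fun x hx => ?_)
        exact mul_nonneg (sq_nonneg A) (ht _ (hG.mapsTo g hx)).1
    _ ≤ _ := by
        refine ENNReal.ofReal_le_ofReal ?_
        rw [integral_const_mul, mul_assoc]
        gcongr
        exact (hG.isAutOn g).setIntegral_one_sub_norm_sq_le μ h1

theorem IsBallFundamentalDomain.lintegral_sq_poincareSeries_lt_top_of_le
    (hD : IsBallFundamentalDomain G D) (hG : IsBallGroup G) (h1 : Module.finrank ℂ V = 1)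
    {ψ : V → ℂ} (hψ : ContinuousOn ψ (ball 0 1)) {A : ℝ}
    (hA : ∀ x ∈ ball (0 : V) 1, ‖ψ x‖ ≤ A * (1 - ‖x‖ ^ 2)) :
    ∫⁻ x in D, ‖poincareSeries G ψ x‖ₑ ^ 2 ∂μ < ⊤ := by
  have hM : ∀ x ∈ ball (0 : V) 1, ‖ψ x‖ ≤ A := fun x hx => by
    have h2 := (norm_nonneg _).trans (hA 0 (mem_ball_self one_pos))
    have h3 := hA x hx
    simp only [norm_zero, ne_eq, OfNat.ofNat_ne_zero, not_false_eq_true, zero_pow, sub_zero,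
      mul_one] at h2
    nlinarith [sq_nonneg ‖x‖]
  refine lt_of_le_of_lt ?_ (hG.tsum_lintegral_ne_top μ h1 hA).lt_top
  rw [← hD.lintegral_sq_tsum_enorm μ hG hψ]
  refine setLIntegral_mono' hD.measurableSet fun x hx => ?_
  gcongr
  exact hG.enorm_poincareSeries_le hM (hD.subset_ball hx)

omit [MeasurableSpace V] [BorelSpace V] in
theorem IsBallGroup.tendsto_poincareSeries (hG : IsBallGroup G) {ψ : ℕ → V → ℂ} {f : V → ℂ}
    {C : ℝ} (hC : ∀ n, ∀ x ∈ ball (0 : V) 1, ‖ψ n x‖ ≤ C)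
    (hlim : ∀ x ∈ ball (0 : V) 1, Tendsto (fun n => ψ n x) atTop (𝓝 (f x))) {x : V}
    (hx : x ∈ ball (0 : V) 1) :
    Tendsto (fun n => poincareSeries G (ψ n) x) atTop (𝓝 (poincareSeries G f x)) := by
  obtain ⟨r, hr, -, C', -, h⟩ := hG.exists_norm_jacDet_le hx
  refine tendsto_tsum_of_dominated_convergence (bound := fun g : G => C * (C' * (1 - ‖g.1 0‖ ^ 2)))
    ((hG.summable.mul_left C').mul_left C) (fun g => (hlim _ (hG.mapsTo g hx)).mul_const _)
    (.of_forall fun n g => ?_)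
  rw [norm_mul]
  exact mul_le_mul (hC n _ (hG.mapsTo g hx)) (h g x (mem_ball_self hr)) (norm_nonneg _)
    ((norm_nonneg _).trans (hC n _ (hG.mapsTo g hx)))

omit [MeasurableSpace V] [BorelSpace V] in
theorem IsBallGroup.poincareSeries_add (hG : IsBallGroup G) {ψ φ : V → ℂ} {C C' : ℝ}
    (hC : ∀ x ∈ ball (0 : V) 1, ‖ψ x‖ ≤ C) (hC' : ∀ x ∈ ball (0 : V) 1, ‖φ x‖ ≤ C') {x : V}
    (hx : x ∈ ball (0 : V) 1) :
    poincareSeries G (fun y => ψ y + φ y) x = poincareSeries G ψ x + poincareSeries G φ x := by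
  rw [poincareSeries, poincareSeries, poincareSeries,
    ← (hG.summable_norm_mul_jacDet hC hx).of_norm.tsum_add
      (hG.summable_norm_mul_jacDet hC' hx).of_norm]
  simp only [add_mul]

theorem ENNReal.add_sq_le_four_mul (a b : ENNReal) : (a + b) ^ 2 ≤ 4 * (a ^ 2 + b ^ 2) := by
  have h : ∀ a b : ENNReal, a ≤ b → (a + b) ^ 2 ≤ 4 * (a ^ 2 + b ^ 2) := fun a b hab => by
    calc (a + b) ^ 2 ≤ (b + b) ^ 2 := by gcongr
      _ = 4 * b ^ 2 := by ring
      _ ≤ _ := by gcongr; exact le_add_self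
  rcases le_total a b with hab | hab
  · exact h a b hab
  · rw [add_comm a, add_comm (a ^ 2)]
    exact h b a hab

/-- Poincaré series of functions holomorphic near the closed ball are square integrable. -/
theorem IsBallFundamentalDomain.lintegral_sq_poincareSeries_lt_top
    (hD : IsBallFundamentalDomain G D) (hG : IsBallGroup G) {f : V → ℂ}
    (hf : HolomorphicNearBall f) :
    ∫⁻ x in D, ‖poincareSeries G f x‖ₑ ^ 2 ∂μ < ⊤ := by
  obtain ⟨M, -, hM⟩ := hf.exists_bound
  by_cases h1 : Module.finrank ℂ V = 1
  swap
  · exact hD.lintegral_sq_poincareSeries_lt_top_of_finrank_ne_one μ hG h1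
      hf.differentiableOn.continuousOn hM
  obtain ⟨ψ, k, C, K, hk, hkC, hψ, hψC, hA, hlim, hinteg⟩ := hf.exists_approx_of_finrank_eq_one μ h1
  set t : V → ℂ := fun x => ((1 - ‖x‖ ^ 2 : ℝ) : ℂ) * k x with ht
  have htc : ContinuousOn t (ball 0 1) :=
    (Complex.continuous_ofReal.comp (by fun_prop)).continuousOn.mul hk
  have htC : ∀ x ∈ ball (0 : V) 1, ‖t x‖ ≤ C * (1 - ‖x‖ ^ 2) := fun x hx => by
    have h2 : 0 ≤ 1 - ‖x‖ ^ 2 := by nlinarith [norm_nonneg x, mem_ball_zero_iff.1 hx]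
    rw [ht, norm_mul, Complex.norm_of_nonneg h2, mul_comm]
    gcongr
    exact hkC x hx
  have htC' : ∀ x ∈ ball (0 : V) 1, ‖t x‖ ≤ C := fun x hx => by
    have h2 := (norm_nonneg _).trans (hkC x hx)
    have h3 := htC x hx
    nlinarith [sq_nonneg ‖x‖]
  have hsC : ∀ x ∈ ball (0 : V) 1, ‖f x - t x‖ ≤ M + C := fun x hx =>
    (norm_sub_le _ _).trans (add_le_add (hM x hx) (htC' x hx))
  have hmeas : ∀ n, AEMeasurable (poincareSeries G (ψ n)) (μ.restrict D) := fun n =>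
    hG.aemeasurable_poincareSeries μ (hψ n) (hψC n) hD.measurableSet hD.subset_ball
  have hbd : ∀ n, ∫⁻ x in D, ‖poincareSeries G (ψ n) x‖ₑ ^ 2 ∂μ
      ≤ ENNReal.ofReal (∑' g : G, K * (1 - ‖g.1 0‖ ^ 2)) := fun n => by
    obtain ⟨A, hA⟩ := hA n
    exact hD.lintegral_sq_poincareSeries_le μ hG (hψ n) (hψC n)
      (hG.tsum_lintegral_ne_top μ h1 hA) (hG.summable.mul_left K)
      fun g => hinteg n g.1 (hG.isAutOn g)
  have hs : ∫⁻ x in D, ‖poincareSeries G (fun y => f y - t y) x‖ₑ ^ 2 ∂μ < ⊤ := by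
    refine lt_of_le_of_lt ?_ (ENNReal.ofReal_lt_top (r := ∑' g : G, K * (1 - ‖g.1 0‖ ^ 2)))
    calc ∫⁻ x in D, ‖poincareSeries G (fun y => f y - t y) x‖ₑ ^ 2 ∂μ
        = ∫⁻ x in D, liminf (fun n => ‖poincareSeries G (ψ n) x‖ₑ ^ 2) atTop ∂μ := by
          refine setLIntegral_congr_fun hD.measurableSet fun x hx => ?_
          have h2 := hG.tendsto_poincareSeries hψC hlim (hD.subset_ball hx)
          exact ((ENNReal.continuous_pow 2).tendsto _ |>.comp h2.enorm).liminf_eq.symm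
      _ ≤ liminf (fun n => ∫⁻ x in D, ‖poincareSeries G (ψ n) x‖ₑ ^ 2 ∂μ) atTop :=
          lintegral_liminf_le' fun n => (hmeas n).enorm.pow_const 2
      _ ≤ _ := liminf_le_of_le (by isBoundedDefault) fun b hb => by
          obtain ⟨n, hn⟩ := hb.exists
          exact hn.trans (hbd n)
  have hts := hD.lintegral_sq_poincareSeries_lt_top_of_le μ hG h1 htc htC
  have hsm : AEMeasurable (fun x => ‖poincareSeries G (fun y => f y - t y) x‖ₑ ^ 2)
      (μ.restrict D) :=
    (hG.aemeasurable_poincareSeries μ (hf.differentiableOn.continuousOn.sub htc) hsC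
      hD.measurableSet hD.subset_ball).enorm.pow_const 2
  calc ∫⁻ x in D, ‖poincareSeries G f x‖ₑ ^ 2 ∂μ
      ≤ ∫⁻ x in D, 4 * (‖poincareSeries G (fun y => f y - t y) x‖ₑ ^ 2
        + ‖poincareSeries G t x‖ₑ ^ 2) ∂μ := by
        refine setLIntegral_mono' hD.measurableSet fun x hx => ?_
        have h2 := hG.poincareSeries_add hsC htC' (hD.subset_ball hx)
        simp only [sub_add_cancel] at h2
        refine le_trans ?_ (ENNReal.add_sq_le_four_mul _ _)
        rw [h2]
        gcongr
        exact enorm_add_le _ _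
    _ < ⊤ := by
        rw [lintegral_const_mul' _ _ (by simp), lintegral_add_left' hsm]
        exact ENNReal.mul_lt_top (by simp) (ENNReal.add_lt_top.2 ⟨hs, hts⟩)

end

section

variable {V : Type*} [NormedAddCommGroup V] [InnerProductSpace ℂ V] [MeasurableSpace V]
  [BorelSpace V] [FiniteDimensional ℂ V] (μ : Measure V) [μ.IsAddHaarMeasure]
  {G : Subgroup (Equiv.Perm V)} {D : Set V}

/-- A function of automorphic weight one has less mass on a small ball than on a fundamental
domain. -/
theorem IsBallFundamentalDomain.lintegral_ball_sq_le (hD : IsBallFundamentalDomain G D)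
    (hG : IsBallGroup G) {f : V → ℂ}
    (hf : ∀ g : G, ∀ x ∈ ball (0 : V) 1, f (g.1 x) * jacDet g.1 x = f x) {z : V} {r : ℝ}
    (hr : ball z r ⊆ ball 0 1) (hdisj : ∀ g : G, g ≠ 1 → ∀ x ∈ ball z r, g.1 x ∉ ball z r) :
    ∫⁻ x in ball z r, ‖f x‖ₑ ^ 2 ∂μ ≤ ∫⁻ x in D, ‖f x‖ₑ ^ 2 ∂μ := by
  have := hG.countable
  set T : G → Set V := fun g => ball (0 : V) 1 ∩ g.1 ⁻¹' ball z r with hT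
  have hTm : ∀ g, MeasurableSet (T g) := fun g =>
    ((hG.differentiableOn g).continuousOn.isOpen_inter_preimage isOpen_ball
      isOpen_ball).measurableSet
  have hTd : Pairwise (Function.onFun Disjoint fun g => T g ∩ D) := fun g h hgh => by
    refine disjoint_left.2 fun x hx hx' => hdisj (h * g⁻¹) ?_ (g.1 x) hx.1.2 ?_
    · rw [Ne, mul_inv_eq_one]
      exact hgh.symm
    · simpa using hx'.1.2
  calc ∫⁻ x in ball z r, ‖f x‖ₑ ^ 2 ∂μ
      = ∫⁻ x in ball (0 : V) 1, (ball z r).indicator (fun x => ‖f x‖ₑ ^ 2) x ∂μ := by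
        rw [setLIntegral_indicator measurableSet_ball, inter_eq_left.2 hr]
    _ = ∑' g : G, ∫⁻ x in T g ∩ D, ‖f x‖ₑ ^ 2 ∂μ := by
        rw [hD.lintegral_ball μ hG]
        refine tsum_congr fun g => ?_
        rw [← setLIntegral_indicator (hTm g)]
        refine setLIntegral_congr_fun hD.measurableSet fun x hx => ?_
        have hxB := hD.subset_ball hx
        by_cases h : g.1 x ∈ ball z r
        · have hx' : x ∈ T g := ⟨hxB, h⟩
          simp only [indicator_of_mem h, indicator_of_mem hx']
          rw [← mul_pow, ← enorm_mul, hf g x hxB]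
        · have hx' : x ∉ T g := fun hx' => h hx'.2
          simp only [indicator_of_notMem h, indicator_of_notMem hx', zero_mul]
    _ = ∫⁻ x in ⋃ g, T g ∩ D, ‖f x‖ₑ ^ 2 ∂μ :=
        (lintegral_iUnion (fun g => (hTm g).inter hD.measurableSet) hTd _).symm
    _ ≤ _ := lintegral_mono_set (iUnion_subset fun g => inter_subset_right)

/-- Square-integrable holomorphic functions of automorphic weight one. -/
def bergmanSubmodule (G : Subgroup (Equiv.Perm V)) (D : Set V) : Submodule ℂ (V → ℂ) where
  carrier := {f | DifferentiableOn ℂ f (ball 0 1) ∧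
    (∀ g : G, ∀ x ∈ ball (0 : V) 1, f (g.1 x) * jacDet g.1 x = f x) ∧ MemLp f 2 (μ.restrict D)}
  add_mem' := fun {f h} hf hh => ⟨hf.1.add hh.1, fun g x hx => by
    rw [Pi.add_apply, add_mul, hf.2.1 g x hx, hh.2.1 g x hx, Pi.add_apply], hf.2.2.add hh.2.2⟩
  zero_mem' := ⟨differentiableOn_const 0, fun g x _ => by simp, MemLp.zero'⟩
  smul_mem' := fun c f hf => ⟨hf.1.const_smul c, fun g x hx => by
    rw [Pi.smul_apply, smul_mul_assoc, hf.2.1 g x hx, Pi.smul_apply], hf.2.2.const_smul c⟩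

/-- The inclusion of `bergmanSubmodule` into `L²`. -/
def bergmanToLp (G : Subgroup (Equiv.Perm V)) (D : Set V) :
    bergmanSubmodule μ G D →ₗ[ℂ] Lp ℂ 2 (μ.restrict D) where
  toFun f := f.2.2.2.toLp f.1
  map_add' f g := MemLp.toLp_add f.2.2.2 g.2.2.2
  map_smul' c f := MemLp.toLp_const_smul c f.2.2.2

omit [BorelSpace V] [FiniteDimensional ℂ V] [μ.IsAddHaarMeasure] in
theorem norm_bergmanToLp_sq (f : bergmanSubmodule μ G D) :
    ‖bergmanToLp μ G D f‖ ^ 2 = ∫ x in D, ‖f.1 x‖ ^ 2 ∂μ := by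
  have h := f.2.2.2
  rw [show bergmanToLp μ G D f = h.toLp f.1 from rfl, Lp.norm_toLp,
    h.eLpNorm_eq_integral_rpow_norm two_ne_zero ENNReal.ofNat_ne_top,
    ENNReal.toReal_ofReal (by positivity)]
  simp only [ENNReal.toReal_ofNat, Real.rpow_ofNat]
  exact Real.rpow_inv_natCast_pow (n := 2) (by positivity) two_ne_zero

theorem IsBallFundamentalDomain.memLp_poincareSeries (hD : IsBallFundamentalDomain G D)
    (hG : IsBallGroup G) {ψ : V → ℂ} (hψ : HolomorphicNearBall ψ) :
    poincareSeries G ψ ∈ bergmanSubmodule μ G D := by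
  obtain ⟨M, -, hM⟩ := hψ.exists_bound
  have hd := hG.differentiableOn_poincareSeries hψ.differentiableOn hM
  have hm : AEStronglyMeasurable (poincareSeries G ψ) (μ.restrict D) :=
    (hd.continuousOn.mono hD.subset_ball).aestronglyMeasurable hD.measurableSet
  refine ⟨hd, fun g x hx => hG.poincareSeries_mul_jacDet ψ g hx,
    (memLp_two_iff_integrable_sq_norm hm).2 ⟨(hm.norm.pow 2), ?_⟩⟩
  simpa [HasFiniteIntegral, enorm_pow] using hD.lintegral_sq_poincareSeries_lt_top μ hG hψ

theorem IsBallFundamentalDomain.exists_norm_le (hD : IsBallFundamentalDomain G D)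
    (hG : IsBallGroup G) {z : V} (hz : z ∈ ball (0 : V) 1) :
    ∃ r > 0, ∃ C ≥ 0, ball z r ⊆ ball 0 1 ∧ ∀ f : bergmanSubmodule μ G D, ∀ x ∈ ball z r,
      ‖f.1 x‖ ≤ C * ‖bergmanToLp μ G D f‖ := by
  obtain ⟨r, hr, hrB, hdisj⟩ := hG.exists_ball_disjoint hz
  have hrB' := ball_subset_closedBall.trans hrB
  have hm : 0 < μ.real (ball (0 : V) (r / 4)) :=
    ENNReal.toReal_pos (measure_ball_pos μ _ (by positivity)).ne' measure_ball_lt_top.ne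
  refine ⟨r / 2, by positivity, (√(μ.real (ball (0 : V) (r / 4))))⁻¹, by positivity,
    (ball_subset_ball (by linarith)).trans hrB', fun f x hx => ?_⟩
  have hsub : closedBall x (r / 4) ⊆ ball z r := fun y hy => by
    rw [mem_ball, mem_closedBall] at *
    linarith [dist_triangle y x z]
  have h1 := norm_sq_mul_measureReal_ball_le μ isOpen_ball (hsub.trans hrB') f.2.1
  have h2 := hD.lintegral_ball_sq_le μ hG f.2.2.1 hrB' hdisj
  have hD2 : IntegrableOn (fun x => ‖f.1 x‖ ^ 2) D μ :=
    (memLp_two_iff_integrable_sq_norm f.2.2.2.1).1 f.2.2.2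
  have hfin : ∫⁻ x in D, ‖f.1 x‖ₑ ^ 2 ∂μ < ⊤ := by
    simpa [HasFiniteIntegral, enorm_pow] using hD2.2
  have hI : IntegrableOn (fun x => ‖f.1 x‖ ^ 2) (ball z r) μ := by
    refine ⟨?_, ?_⟩
    · exact ((f.2.1.continuousOn.mono hrB').norm.pow 2).aestronglyMeasurable measurableSet_ball
    · simpa [HasFiniteIntegral, enorm_pow] using h2.trans_lt hfin
  have hv : ∀ s, IntegrableOn (fun x => ‖f.1 x‖ ^ 2) s μ →
      ∫ x in s, ‖f.1 x‖ ^ 2 ∂μ = (∫⁻ x in s, ‖f.1 x‖ₑ ^ 2 ∂μ).toReal := fun s hs => by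
    rw [integral_eq_lintegral_of_nonneg_ae (.of_forall fun x => by positivity) hs.1]
    congr 1
    refine lintegral_congr fun x => ?_
    rw [ENNReal.ofReal_pow (norm_nonneg _), ofReal_norm]
  have h3 : ‖f.1 x‖ ^ 2 * μ.real (ball (0 : V) (r / 4)) ≤ ‖bergmanToLp μ G D f‖ ^ 2 := by
    rw [norm_bergmanToLp_sq, hv D hD2]
    calc _ = ‖f.1 x‖ ^ 2 * μ.real (ball x (r / 4)) := by
          rw [measureReal_def, measureReal_def, Measure.addHaar_ball_center μ x]
      _ ≤ _ := h1
      _ ≤ ∫ y in ball z r, ‖f.1 y‖ ^ 2 ∂μ :=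
          setIntegral_mono_set hI (.of_forall fun x => by positivity)
            (ball_subset_closedBall.trans hsub).eventuallyLE
      _ = _ := hv _ hI
      _ ≤ _ := ENNReal.toReal_mono hfin.ne h2
  rw [← div_eq_inv_mul, le_div_iff₀ (Real.sqrt_pos.2 hm)]
  refine le_of_sq_le_sq ?_ (norm_nonneg _)
  rwa [mul_pow, Real.sq_sqrt hm.le]

/-- The Bergman kernel of the quotient of the ball by `G` is positive and the Levi form of its
logarithm is positive definite. -/
theorem IsBallFundamentalDomain.bergman_lineLaplacian_pos (hD : IsBallFundamentalDomain G D)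
    (hG : IsBallGroup G) {K : V → ℝ}
    (hK : ∀ x ∈ ball (0 : V) 1, K x = sSup {t : ℝ | ∃ f : V → ℂ, DifferentiableOn ℂ f (ball 0 1) ∧
      (∀ g : G, ∀ x ∈ ball (0 : V) 1, f (g.1 x) * jacDet g.1 x = f x) ∧
      IntegrableOn (fun x => ‖f x‖ ^ 2) D μ ∧ ∫ x in D, ‖f x‖ ^ 2 ∂μ ≤ 1 ∧ t = ‖f x‖ ^ 2})
    {z : V} (hz : z ∈ ball (0 : V) 1) :
    0 < K z ∧ ∀ v : V, v ≠ 0 → 0 < lineLaplacian (fun x => Real.log (K x)) z v := by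
  have hK' : ∀ x ∈ ball (0 : V) 1, K x = sSup {t : ℝ | ∃ f : bergmanSubmodule μ G D,
      ‖bergmanToLp μ G D f‖ ≤ 1 ∧ t = ‖f.1 x‖ ^ 2} := fun x hx => by
    rw [hK x hx]
    congr 1
    ext t
    constructor
    · rintro ⟨f, hf, hfa, hfi, hf1, ht⟩
      have hm : AEStronglyMeasurable f (μ.restrict D) :=
        (hf.continuousOn.mono hD.subset_ball).aestronglyMeasurable hD.measurableSet
      refine ⟨⟨f, hf, hfa, (memLp_two_iff_integrable_sq_norm hm).2 hfi⟩, ?_, ht⟩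
      rwa [← sq_le_one_iff₀ (norm_nonneg _), norm_bergmanToLp_sq]
    · rintro ⟨f, hf1, ht⟩
      refine ⟨f.1, f.2.1, f.2.2.1, (memLp_two_iff_integrable_sq_norm f.2.2.2.1).1 f.2.2.2, ?_, ht⟩
      rwa [← norm_bergmanToLp_sq, sq_le_one_iff₀ (norm_nonneg _)]
  obtain ⟨ψ, hψ, hψ0⟩ := hG.exists_poincareSeries_ne_zero hz
  obtain ⟨h1, h2⟩ := _root_.bergman_lineLaplacian_pos isOpen_ball (bergmanToLp μ G D)
    (fun f => f.2.1) (fun z hz => hD.exists_norm_le μ hG hz) hK' hz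
    ⟨⟨_, hD.memLp_poincareSeries μ hG hψ⟩, hψ0⟩
  refine ⟨h1, fun v hv => h2 v fun α => ?_⟩
  obtain ⟨φ, hφ, h⟩ := hG.exists_fderiv_poincareSeries_ne hz hv α
  exact ⟨⟨_, hD.memLp_poincareSeries μ hG hφ⟩, h⟩

end

section

variable {V : Type*} [NormedAddCommGroup V] [InnerProductSpace ℂ V] {Γ : Set (V → V)}

theorem IsAutOn.congr {Ω : Set V} {f g : V → V} (hf : IsAutOn Ω f) (h : EqOn g f Ω) :
    IsAutOn Ω g := by
  obtain ⟨h1, h2, σ, h3, h4, h5, h6⟩ := hf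
  exact ⟨h1.congr h, h2.congr h.symm, σ, h3, h4, fun x hx => by simpa [h hx] using h5 hx,
    fun x hx => by simpa [h (h4 hx)] using h6 hx⟩

/-- The permutations of the whole space that restrict to elements of `Γ` on the unit ball and fix
its complement. -/
def ballPermGroup (hΓ : IsAutGroupOn (ball (0 : V) 1) Γ) : Subgroup (Equiv.Perm V) where
  carrier := {e | (∀ x ∉ ball (0 : V) 1, e x = x) ∧ ∃ γ ∈ Γ, EqOn e γ (ball 0 1)}
  mul_mem' := by
    rintro e f ⟨he, γ, hγ, heγ⟩ ⟨hf, σ, hσ, hfσ⟩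
    refine ⟨fun x hx => by rw [Equiv.Perm.mul_apply, hf x hx, he x hx], γ ∘ σ,
      hΓ.comp_mem γ hγ σ hσ, fun x hx => ?_⟩
    rw [Equiv.Perm.mul_apply, hfσ hx, heγ ((hΓ.aut σ hσ).2.1 hx), Function.comp_apply]
  one_mem' := ⟨fun _ _ => rfl, id, hΓ.id_mem, fun _ _ => rfl⟩
  inv_mem' := by
    rintro e ⟨he, γ, hγ, heγ⟩
    obtain ⟨σ, hσ, -, h⟩ := hΓ.inv_mem γ hγ
    refine ⟨fun x hx => ?_, σ, hσ, fun x hx => ?_⟩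
    · rw [Equiv.Perm.inv_eq_iff_eq, he x hx]
    · rw [Equiv.Perm.inv_eq_iff_eq, heγ ((hΓ.aut σ hσ).2.1 hx)]
      exact (h hx).symm

variable (hΓ : IsAutGroupOn (ball (0 : V) 1) Γ)

theorem exists_ballPermGroup_eqOn {γ : V → V} (hγ : γ ∈ Γ) :
    ∃ g : ballPermGroup hΓ, EqOn g.1 γ (ball 0 1) := by
  classical
  obtain ⟨σ, hσ, h1, h2⟩ := hΓ.inv_mem γ hγ
  have hm := (hΓ.aut γ hγ).2.1
  have hm' := (hΓ.aut σ hσ).2.1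
  have key : ∀ f g : V → V, MapsTo f (ball 0 1) (ball 0 1) → EqOn (g ∘ f) id (ball 0 1) →
      Function.LeftInverse ((ball (0 : V) 1).piecewise g id) ((ball (0 : V) 1).piecewise f id) :=
    fun f g hf hfg x => by
      by_cases hx : x ∈ ball (0 : V) 1
      · rw [piecewise_eq_of_mem _ _ _ hx, piecewise_eq_of_mem _ _ _ (hf hx)]
        exact hfg hx
      · rw [piecewise_eq_of_notMem (ball (0 : V) 1) f id hx, id,
          piecewise_eq_of_notMem (ball (0 : V) 1) g id hx, id]
  refine ⟨⟨⟨(ball (0 : V) 1).piecewise γ id, (ball (0 : V) 1).piecewise σ id, key _ _ hm h1,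
    key _ _ hm' h2⟩, fun x hx => piecewise_eq_of_notMem _ _ _ hx, γ, hγ, fun x hx =>
    piecewise_eq_of_mem _ _ _ hx⟩, fun x hx => piecewise_eq_of_mem _ _ _ hx⟩

theorem ballPermGroup_ext {g h : ballPermGroup hΓ} (H : EqOn g.1 h.1 (ball 0 1)) : g = h := by
  refine Subtype.ext (Equiv.ext fun x => ?_)
  by_cases hx : x ∈ ball (0 : V) 1
  · exact H hx
  · rw [g.2.1 x hx, h.2.1 x hx]

theorem isBallGroup_ballPermGroup [FiniteDimensional ℂ V] (hfree : FreeActionOn (ball (0 : V) 1) Γ)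
    {a : V} (ha : a ∈ ball (0 : V) 1) (hsum : Summable fun γ : Γ => 1 - ‖γ.1 a‖) :
    IsBallGroup (ballPermGroup hΓ) := by
  have haut : ∀ g : ballPermGroup hΓ, IsAutOn (ball (0 : V) 1) g.1 := fun g => by
    obtain ⟨-, γ, hγ, h⟩ := g.2
    exact (hΓ.aut γ hγ).congr h
  have ha' := mem_ball_zero_iff.1 ha
  refine ⟨haut, fun g z hz hgz => ?_, ?_⟩
  · obtain ⟨-, γ, hγ, h⟩ := g.2
    have := hfree γ hγ ⟨z, hz, (h hz).symm.trans hgz⟩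
    exact ballPermGroup_ext hΓ fun x hx => (h hx).trans (this hx)
  · choose s hs hsE using fun g : ballPermGroup hΓ => g.2.2
    have hinj : Function.Injective fun g => (⟨s g, hs g⟩ : Γ) := fun g h hgh => by
      have : s g = s h := congrArg Subtype.val hgh
      exact ballPermGroup_ext hΓ ((hsE g).trans (this ▸ (hsE h).symm))
    have hpos : 0 < 1 - ‖a‖ ^ 2 := by nlinarith [norm_nonneg a]
    refine .of_nonneg_of_le (fun g => ?_) (fun g => ?_)
      ((hsum.comp_injective hinj).mul_left (4 / (1 - ‖a‖ ^ 2) * 2))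
    · have := mem_ball_zero_iff.1 ((haut g).2.1 (mem_ball_self one_pos))
      nlinarith [norm_nonneg (g.1 0)]
    · refine ((haut g).le_one_sub_norm_sq ha).trans ?_
      have h1 := mem_ball_zero_iff.1 ((haut g).2.1 ha)
      rw [show ((fun γ : Γ => 1 - ‖γ.1 a‖) ∘ fun g => ⟨s g, hs g⟩) g = 1 - ‖g.1 a‖ by
        rw [hsE g ha, Function.comp_apply], mul_assoc]
      gcongr
      nlinarith [norm_nonneg (g.1 a)]

end

/-- **Corollary 1.** Let `Γ` be a free, properly discontinuous group of automorphisms of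
the unit ball `B ⊂ ℂⁿ` such that `∑_{γ ∈ Γ} (1 − |γ(a)|) < ∞` for some point `a ∈ B`.
Then the Bergman metric exists on the quotient manifold `B/Γ`. -/
theorem bergman_metric_exists_on_ball_quotient (n : ℕ)
    (Γ : Set (EuclideanSpace ℂ (Fin n) → EuclideanSpace ℂ (Fin n)))
    (hgrp : IsAutGroupOn (ball (0 : EuclideanSpace ℂ (Fin n)) 1) Γ)
    (hfree : FreeActionOn (ball (0 : EuclideanSpace ℂ (Fin n)) 1) Γ)
    (hpd : ProperlyDiscontinuousOn (ball (0 : EuclideanSpace ℂ (Fin n)) 1) Γ)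
    (a : EuclideanSpace ℂ (Fin n)) (ha : a ∈ ball (0 : EuclideanSpace ℂ (Fin n)) 1)
    (hsum : Summable fun γ : Γ => 1 - ‖γ.1 a‖) :
    QuotientBergmanMetricExists (ball (0 : EuclideanSpace ℂ (Fin n)) 1) Γ := by
  have hG := isBallGroup_ballPermGroup hgrp hfree ha hsum
  obtain ⟨D, hDm, hDB, hDe, hD1⟩ := hG.exists_fundamentalDomain
  have hD : IsBallFundamentalDomain (ballPermGroup hgrp) D := ⟨hDm, hDB, hDe, hD1⟩
  refine ⟨D, ⟨hDB, fun z hz => ?_, fun z hz w hw => ?_⟩, hDm, fun z hz =>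
    hD.bergman_lineLaplacian_pos Measure.addHaar hG (fun x _ => ?_) hz⟩
  · obtain ⟨g, hg⟩ := hDe z hz
    obtain ⟨-, γ, hγ, h⟩ := g.2
    exact ⟨γ, hγ, h hz ▸ hg⟩
  · rintro ⟨γ, hγ, rfl⟩
    obtain ⟨g, hg⟩ := exists_ballPermGroup_eqOn hgrp hγ
    rw [← hg (hDB hz)] at hw ⊢
    rw [hD1 z hz g hw]
    rfl
  · refine congrArg sSup (Set.ext fun t => exists_congr fun f => and_congr_right fun _ =>
      and_congr ⟨fun h g y hy => ?_, fun h γ hγ y hy => ?_⟩ Iff.rfl)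
    · obtain ⟨-, γ, hγ, hg⟩ := g.2
      rw [hg hy, jacDet_congr (hg.eventuallyEq_of_mem (isOpen_ball.mem_nhds hy)), h γ hγ y hy]
    · obtain ⟨g, hg⟩ := exists_ballPermGroup_eqOn hgrp hγ
      rw [← hg hy, ← jacDet_congr (hg.eventuallyEq_of_mem (isOpen_ball.mem_nhds hy)), h g y hy]

end
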